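/- Substitution property of the self-translation, stoup-free computation term into stoup: if Γ | x:A̲ ⊢ t : B̲ and Γ ⊢ u : A̲ are derivable in EEC, then Γᶜ ⊢ (t[u/x])ᶜ = λ°k:B̲ᶜ. uᶜ[tᶜ[k/k_x]] : B̲ᶜ ⊸ R̲ in the equational theory of EEC (where λ° denotes linear abstraction and uᶜ[s] denotes linear application of uᶜ to s). -/

import Mathlib

set_option autoImplicit false

namespace EEC

/-! # The enriched effect calculus (EEC)

A deep embedding of the enriched effect calculus of Egger, Møgelberg and
Simpson: value types and computation types, raw terms (de Bruijn indices for
value variables, together with a designated stoup variable `svar`), typing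
derivations with an (at most singleton) stoup, the βη-equational theory, the
simply-typed λ-calculus together with βη-equality and Moggi's computational
λ-calculus equality, the standard cbv/cbn translations of typed λ-calculus
into EEC, Hasegawa's linear-use CPS translations, and the generic linear-use
CPS self-translation of EEC. -/

mutual
  /-- Value types of EEC. -/
  inductive VType : Type
    | base : ℕ → VType                 -- value type constants α
    | unit : VType                     -- 1
    | prod : VType → VType → VType     -- A × B
    | arr : VType → VType → VType      -- A → B
    | comp : CType → VType             -- every computation type is a value type
    | lin : CType → CType → VType      -- A̲ ⊸ B̲
  /-- Computation types of EEC. -/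
  inductive CType : Type
    | base : ℕ → CType                 -- computation type constants α̲
    | cunit : CType                    -- 1̲
    | cand : CType → CType → CType     -- A̲ & B̲
    | carr : VType → CType → CType     -- A ⇒ B̲
    | iunit : CType                    -- I̲
    | bang : VType → CType             -- !A
    | copow : VType → CType → CType    -- !A ⊗ B̲
    | czero : CType                    -- 0̲
    | csum : CType → CType → CType     -- A̲ ⊕ B̲
end

/-- Raw terms of EEC.  Value variables are de Bruijn indices (`var n`, with
`var 0` the innermost bound variable); the unique stoup variable is `svar`
(the constructs `llam`, `copowlet` (in its body) and `ccase` (in its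
branches) bind the stoup variable). -/
inductive Tm : Type
  | var : ℕ → Tm                -- value variable
  | svar : Tm                   -- the stoup variable
  | unit : Tm                   -- * : 1
  | vpair : Tm → Tm → Tm        -- ⟨t,u⟩
  | vfst : Tm → Tm
  | vsnd : Tm → Tm
  | vlam : VType → Tm → Tm      -- λx:A. t
  | vapp : Tm → Tm → Tm
  | cunit : Tm                  -- ⋆ : 1̲
  | cpair : Tm → Tm → Tm        -- ⟨t,u⟩ : A̲ & B̲
  | cfst : Tm → Tm
  | csnd : Tm → Tm
  | clam : VType → Tm → Tm      -- λx:A ⇒ t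
  | capp : Tm → Tm → Tm         -- s ⋅ t
  | top : Tm                    -- ⊤ : I̲
  | ilet : Tm → Tm → Tm         -- t to ⊤. u
  | bang : Tm → Tm              -- !t
  | banglet : Tm → Tm → Tm      -- let !x = t in u   (binds a value variable in u)
  | copow : Tm → Tm → Tm        -- !t ⊗ u
  | copowlet : Tm → Tm → Tm     -- let !x⊗y = s in t (binds a value variable and the stoup variable in t)
  | cimage : CType → Tm → Tm    -- image_{A̲}(t)
  | cinl : Tm → Tm
  | cinr : Tm → Tm
  | ccase : Tm → Tm → Tm → Tm   -- case s of (x. t | y. u)  (branches bind the stoup variable)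
  | llam : CType → Tm → Tm      -- λ°z:A̲. t (binds the stoup variable)
  | lapp : Tm → Tm → Tm         -- s[t]

namespace Tm

/-- Lift a renaming of value variables under a binder. -/
def liftN (f : ℕ → ℕ) : ℕ → ℕ
  | 0 => 0
  | n + 1 => f n + 1

/-- Renaming of value variables. -/
def rename (f : ℕ → ℕ) : Tm → Tm
  | .var n => .var (f n)
  | .svar => .svar
  | .unit => .unit
  | .vpair t u => .vpair (rename f t) (rename f u)
  | .vfst t => .vfst (rename f t)
  | .vsnd t => .vsnd (rename f t)
  | .vlam A t => .vlam A (rename (liftN f) t)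
  | .vapp s t => .vapp (rename f s) (rename f t)
  | .cunit => .cunit
  | .cpair t u => .cpair (rename f t) (rename f u)
  | .cfst t => .cfst (rename f t)
  | .csnd t => .csnd (rename f t)
  | .clam A t => .clam A (rename (liftN f) t)
  | .capp s t => .capp (rename f s) (rename f t)
  | .top => .top
  | .ilet t u => .ilet (rename f t) (rename f u)
  | .bang t => .bang (rename f t)
  | .banglet t u => .banglet (rename f t) (rename (liftN f) u)
  | .copow t u => .copow (rename f t) (rename f u)
  | .copowlet s t => .copowlet (rename f s) (rename (liftN f) t)
  | .cimage A t => .cimage A (rename f t)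
  | .cinl t => .cinl (rename f t)
  | .cinr t => .cinr (rename f t)
  | .ccase s t u => .ccase (rename f s) (rename f t) (rename f u)
  | .llam A t => .llam A (rename f t)
  | .lapp s t => .lapp (rename f s) (rename f t)

/-- Weakening of value variables. -/
def shift (t : Tm) : Tm := rename Nat.succ t

/-- Lift a parallel substitution of value variables under a binder. -/
def liftS (σ : ℕ → Tm) : ℕ → Tm
  | 0 => .var 0
  | n + 1 => shift (σ n)

/-- Parallel (capture-avoiding) substitution for value variables. -/
def psubst (σ : ℕ → Tm) : Tm → Tm
  | .var n => σ n
  | .svar => .svar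
  | .unit => .unit
  | .vpair t u => .vpair (psubst σ t) (psubst σ u)
  | .vfst t => .vfst (psubst σ t)
  | .vsnd t => .vsnd (psubst σ t)
  | .vlam A t => .vlam A (psubst (liftS σ) t)
  | .vapp s t => .vapp (psubst σ s) (psubst σ t)
  | .cunit => .cunit
  | .cpair t u => .cpair (psubst σ t) (psubst σ u)
  | .cfst t => .cfst (psubst σ t)
  | .csnd t => .csnd (psubst σ t)
  | .clam A t => .clam A (psubst (liftS σ) t)
  | .capp s t => .capp (psubst σ s) (psubst σ t)
  | .top => .top
  | .ilet t u => .ilet (psubst σ t) (psubst σ u)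
  | .bang t => .bang (psubst σ t)
  | .banglet t u => .banglet (psubst σ t) (psubst (liftS σ) u)
  | .copow t u => .copow (psubst σ t) (psubst σ u)
  | .copowlet s t => .copowlet (psubst σ s) (psubst (liftS σ) t)
  | .cimage A t => .cimage A (psubst σ t)
  | .cinl t => .cinl (psubst σ t)
  | .cinr t => .cinr (psubst σ t)
  | .ccase s t u => .ccase (psubst σ s) (psubst σ t) (psubst σ u)
  | .llam A t => .llam A (psubst σ t)
  | .lapp s t => .lapp (psubst σ s) (psubst σ t)

/-- Capture-avoiding substitution `t[u/x]` of a term `u` for the innermost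
value variable of `t`. -/
def subst0 (u : Tm) (t : Tm) : Tm :=
  psubst (fun n => match n with | 0 => u | m + 1 => .var m) t

/-- Capture-avoiding substitution `t[u/z]` of a term `u` for the stoup
variable of `t`.  The substitution stops at the stoup-variable binders
(`llam`-bodies, `copowlet`-bodies and `ccase`-branches). -/
def ssubst (u : Tm) : Tm → Tm
  | .var n => .var n
  | .svar => u
  | .unit => .unit
  | .vpair t t' => .vpair (ssubst u t) (ssubst u t')
  | .vfst t => .vfst (ssubst u t)
  | .vsnd t => .vsnd (ssubst u t)
  | .vlam A t => .vlam A (ssubst (shift u) t)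
  | .vapp s t => .vapp (ssubst u s) (ssubst u t)
  | .cunit => .cunit
  | .cpair t t' => .cpair (ssubst u t) (ssubst u t')
  | .cfst t => .cfst (ssubst u t)
  | .csnd t => .csnd (ssubst u t)
  | .clam A t => .clam A (ssubst (shift u) t)
  | .capp s t => .capp (ssubst u s) (ssubst u t)
  | .top => .top
  | .ilet t t' => .ilet (ssubst u t) (ssubst u t')
  | .bang t => .bang (ssubst u t)
  | .banglet t t' => .banglet (ssubst u t) (ssubst (shift u) t')
  | .copow t t' => .copow (ssubst u t) (ssubst u t')
  | .copowlet s t => .copowlet (ssubst u s) t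
  | .cimage A t => .cimage A (ssubst u t)
  | .cinl t => .cinl (ssubst u t)
  | .cinr t => .cinr (ssubst u t)
  | .ccase s t t' => .ccase (ssubst u s) t t'
  | .llam A t => .llam A t
  | .lapp s t => .lapp (ssubst u s) (ssubst u t)

end Tm

/-- Typing derivations of EEC (Figure 1 of the paper).  `Deriv Γ none t A`
is the judgement `Γ ⊢ t : A` (empty stoup); `Deriv Γ (some A̲) t (.comp B̲)`
is the judgement `Γ | z:A̲ ⊢ t : B̲`.  In the rules below `Δ` ranges over an
arbitrary (possibly empty) stoup. -/
inductive Deriv : List VType → Option CType → Tm → VType → Type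
  | var (Γ : List VType) (n : ℕ) (A : VType) :
      Γ[n]? = some A → Deriv Γ none (.var n) A
  | svar (Γ : List VType) (A : CType) : Deriv Γ (some A) .svar (.comp A)
  | unit (Γ : List VType) : Deriv Γ none .unit .unit
  | vpair (Γ : List VType) (t u : Tm) (A B : VType) :
      Deriv Γ none t A → Deriv Γ none u B → Deriv Γ none (.vpair t u) (.prod A B)
  | vfst (Γ : List VType) (t : Tm) (A B : VType) :
      Deriv Γ none t (.prod A B) → Deriv Γ none (.vfst t) A
  | vsnd (Γ : List VType) (t : Tm) (A B : VType) :
      Deriv Γ none t (.prod A B) → Deriv Γ none (.vsnd t) B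
  | vlam (Γ : List VType) (t : Tm) (A B : VType) :
      Deriv (A :: Γ) none t B → Deriv Γ none (.vlam A t) (.arr A B)
  | vapp (Γ : List VType) (s t : Tm) (A B : VType) :
      Deriv Γ none s (.arr A B) → Deriv Γ none t A → Deriv Γ none (.vapp s t) B
  | cunit (Γ : List VType) (Δ : Option CType) : Deriv Γ Δ .cunit (.comp .cunit)
  | cpair (Γ : List VType) (Δ : Option CType) (t u : Tm) (A B : CType) :
      Deriv Γ Δ t (.comp A) → Deriv Γ Δ u (.comp B) →
      Deriv Γ Δ (.cpair t u) (.comp (.cand A B))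
  | cfst (Γ : List VType) (Δ : Option CType) (t : Tm) (A B : CType) :
      Deriv Γ Δ t (.comp (.cand A B)) → Deriv Γ Δ (.cfst t) (.comp A)
  | csnd (Γ : List VType) (Δ : Option CType) (t : Tm) (A B : CType) :
      Deriv Γ Δ t (.comp (.cand A B)) → Deriv Γ Δ (.csnd t) (.comp B)
  | clam (Γ : List VType) (Δ : Option CType) (t : Tm) (A : VType) (B : CType) :
      Deriv (A :: Γ) Δ t (.comp B) → Deriv Γ Δ (.clam A t) (.comp (.carr A B))
  | capp (Γ : List VType) (Δ : Option CType) (s t : Tm) (A : VType) (B : CType) :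
      Deriv Γ Δ s (.comp (.carr A B)) → Deriv Γ none t A →
      Deriv Γ Δ (.capp s t) (.comp B)
  | top (Γ : List VType) : Deriv Γ none .top (.comp .iunit)
  | ilet (Γ : List VType) (Δ : Option CType) (t u : Tm) (A : CType) :
      Deriv Γ Δ t (.comp .iunit) → Deriv Γ none u (.comp A) →
      Deriv Γ Δ (.ilet t u) (.comp A)
  | bang (Γ : List VType) (t : Tm) (A : VType) :
      Deriv Γ none t A → Deriv Γ none (.bang t) (.comp (.bang A))
  | banglet (Γ : List VType) (Δ : Option CType) (t u : Tm) (A : VType) (B : CType) :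
      Deriv Γ Δ t (.comp (.bang A)) → Deriv (A :: Γ) none u (.comp B) →
      Deriv Γ Δ (.banglet t u) (.comp B)
  | copow (Γ : List VType) (Δ : Option CType) (t u : Tm) (A : VType) (B : CType) :
      Deriv Γ none t A → Deriv Γ Δ u (.comp B) →
      Deriv Γ Δ (.copow t u) (.comp (.copow A B))
  | copowlet (Γ : List VType) (Δ : Option CType) (s t : Tm) (A : VType) (B C : CType) :
      Deriv Γ Δ s (.comp (.copow A B)) → Deriv (A :: Γ) (some B) t (.comp C) →
      Deriv Γ Δ (.copowlet s t) (.comp C)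
  | cimage (Γ : List VType) (Δ : Option CType) (t : Tm) (A : CType) :
      Deriv Γ Δ t (.comp .czero) → Deriv Γ Δ (.cimage A t) (.comp A)
  | cinl (Γ : List VType) (Δ : Option CType) (t : Tm) (A B : CType) :
      Deriv Γ Δ t (.comp A) → Deriv Γ Δ (.cinl t) (.comp (.csum A B))
  | cinr (Γ : List VType) (Δ : Option CType) (t : Tm) (A B : CType) :
      Deriv Γ Δ t (.comp B) → Deriv Γ Δ (.cinr t) (.comp (.csum A B))
  | ccase (Γ : List VType) (Δ : Option CType) (s t u : Tm) (A B C : CType) :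
      Deriv Γ Δ s (.comp (.csum A B)) → Deriv Γ (some A) t (.comp C) →
      Deriv Γ (some B) u (.comp C) → Deriv Γ Δ (.ccase s t u) (.comp C)
  | llam (Γ : List VType) (t : Tm) (A B : CType) :
      Deriv Γ (some A) t (.comp B) → Deriv Γ none (.llam A t) (.lin A B)
  | lapp (Γ : List VType) (Δ : Option CType) (s t : Tm) (A B : CType) :
      Deriv Γ none s (.lin A B) → Deriv Γ Δ t (.comp A) →
      Deriv Γ Δ (.lapp s t) (.comp B)

/-- The equational theory of EEC: the smallest type-respecting congruence
containing the βη-equalities of Figure 2 of the paper. -/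
inductive EEq : List VType → Option CType → Tm → Tm → VType → Prop
  -- equivalence
  | refl {Γ Δ t A} : Deriv Γ Δ t A → EEq Γ Δ t t A
  | symm {Γ Δ t u A} : EEq Γ Δ t u A → EEq Γ Δ u t A
  | trans {Γ Δ t u v A} : EEq Γ Δ t u A → EEq Γ Δ u v A → EEq Γ Δ t v A
  -- congruence rules
  | vpair_cong {Γ t t' u u' A B} : EEq Γ none t t' A → EEq Γ none u u' B →
      EEq Γ none (.vpair t u) (.vpair t' u') (.prod A B)
  | vfst_cong {Γ t t' A B} : EEq Γ none t t' (.prod A B) →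
      EEq Γ none (.vfst t) (.vfst t') A
  | vsnd_cong {Γ t t' A B} : EEq Γ none t t' (.prod A B) →
      EEq Γ none (.vsnd t) (.vsnd t') B
  | vlam_cong {Γ t t' A B} : EEq (A :: Γ) none t t' B →
      EEq Γ none (.vlam A t) (.vlam A t') (.arr A B)
  | vapp_cong {Γ s s' t t' A B} : EEq Γ none s s' (.arr A B) → EEq Γ none t t' A →
      EEq Γ none (.vapp s t) (.vapp s' t') B
  | cpair_cong {Γ Δ t t' u u' A B} : EEq Γ Δ t t' (.comp A) → EEq Γ Δ u u' (.comp B) →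
      EEq Γ Δ (.cpair t u) (.cpair t' u') (.comp (.cand A B))
  | cfst_cong {Γ Δ t t' A B} : EEq Γ Δ t t' (.comp (.cand A B)) →
      EEq Γ Δ (.cfst t) (.cfst t') (.comp A)
  | csnd_cong {Γ Δ t t' A B} : EEq Γ Δ t t' (.comp (.cand A B)) →
      EEq Γ Δ (.csnd t) (.csnd t') (.comp B)
  | clam_cong {Γ Δ t t' A B} : EEq (A :: Γ) Δ t t' (.comp B) →
      EEq Γ Δ (.clam A t) (.clam A t') (.comp (.carr A B))
  | capp_cong {Γ Δ s s' t t' A B} : EEq Γ Δ s s' (.comp (.carr A B)) → EEq Γ none t t' A →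
      EEq Γ Δ (.capp s t) (.capp s' t') (.comp B)
  | ilet_cong {Γ Δ t t' u u' A} : EEq Γ Δ t t' (.comp .iunit) → EEq Γ none u u' (.comp A) →
      EEq Γ Δ (.ilet t u) (.ilet t' u') (.comp A)
  | bang_cong {Γ t t' A} : EEq Γ none t t' A →
      EEq Γ none (.bang t) (.bang t') (.comp (.bang A))
  | banglet_cong {Γ Δ t t' u u' A B} : EEq Γ Δ t t' (.comp (.bang A)) →
      EEq (A :: Γ) none u u' (.comp B) →
      EEq Γ Δ (.banglet t u) (.banglet t' u') (.comp B)
  | copow_cong {Γ Δ t t' u u' A B} : EEq Γ none t t' A → EEq Γ Δ u u' (.comp B) →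
      EEq Γ Δ (.copow t u) (.copow t' u') (.comp (.copow A B))
  | copowlet_cong {Γ Δ s s' t t' A B C} : EEq Γ Δ s s' (.comp (.copow A B)) →
      EEq (A :: Γ) (some B) t t' (.comp C) →
      EEq Γ Δ (.copowlet s t) (.copowlet s' t') (.comp C)
  | cimage_cong {Γ Δ t t' A} : EEq Γ Δ t t' (.comp .czero) →
      EEq Γ Δ (.cimage A t) (.cimage A t') (.comp A)
  | cinl_cong {Γ Δ t t' A B} : EEq Γ Δ t t' (.comp A) →
      EEq Γ Δ (.cinl t) (.cinl t') (.comp (.csum A B))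
  | cinr_cong {Γ Δ t t' A B} : EEq Γ Δ t t' (.comp B) →
      EEq Γ Δ (.cinr t) (.cinr t') (.comp (.csum A B))
  | ccase_cong {Γ Δ s s' t t' u u' A B C} : EEq Γ Δ s s' (.comp (.csum A B)) →
      EEq Γ (some A) t t' (.comp C) → EEq Γ (some B) u u' (.comp C) →
      EEq Γ Δ (.ccase s t u) (.ccase s' t' u') (.comp C)
  | llam_cong {Γ t t' A B} : EEq Γ (some A) t t' (.comp B) →
      EEq Γ none (.llam A t) (.llam A t') (.lin A B)
  | lapp_cong {Γ Δ s s' t t' A B} : EEq Γ none s s' (.lin A B) → EEq Γ Δ t t' (.comp A) →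
      EEq Γ Δ (.lapp s t) (.lapp s' t') (.comp B)
  -- the equalities of Figure 2
  | unit_eta {Γ t} : Deriv Γ none t .unit → EEq Γ none t .unit .unit
  | vfst_beta {Γ t u A B} : Deriv Γ none t A → Deriv Γ none u B →
      EEq Γ none (.vfst (.vpair t u)) t A
  | vsnd_beta {Γ t u A B} : Deriv Γ none t A → Deriv Γ none u B →
      EEq Γ none (.vsnd (.vpair t u)) u B
  | vpair_eta {Γ t A B} : Deriv Γ none t (.prod A B) →
      EEq Γ none (.vpair (.vfst t) (.vsnd t)) t (.prod A B)
  | vlam_beta {Γ t u A B} : Deriv (A :: Γ) none t B → Deriv Γ none u A →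
      EEq Γ none (.vapp (.vlam A t) u) (Tm.subst0 u t) B
  | vlam_eta {Γ t A B} : Deriv Γ none t (.arr A B) →
      EEq Γ none (.vlam A (.vapp (Tm.shift t) (.var 0))) t (.arr A B)
  | cunit_eta {Γ Δ t} : Deriv Γ Δ t (.comp .cunit) → EEq Γ Δ t .cunit (.comp .cunit)
  | cfst_beta {Γ Δ t u A B} : Deriv Γ Δ t (.comp A) → Deriv Γ Δ u (.comp B) →
      EEq Γ Δ (.cfst (.cpair t u)) t (.comp A)
  | csnd_beta {Γ Δ t u A B} : Deriv Γ Δ t (.comp A) → Deriv Γ Δ u (.comp B) →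
      EEq Γ Δ (.csnd (.cpair t u)) u (.comp B)
  | cpair_eta {Γ Δ t A B} : Deriv Γ Δ t (.comp (.cand A B)) →
      EEq Γ Δ (.cpair (.cfst t) (.csnd t)) t (.comp (.cand A B))
  | clam_beta {Γ Δ t u A B} : Deriv (A :: Γ) Δ t (.comp B) → Deriv Γ none u A →
      EEq Γ Δ (.capp (.clam A t) u) (Tm.subst0 u t) (.comp B)
  | clam_eta {Γ Δ t A B} : Deriv Γ Δ t (.comp (.carr A B)) →
      EEq Γ Δ (.clam A (.capp (Tm.shift t) (.var 0))) t (.comp (.carr A B))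
  | ilet_beta {Γ t A} : Deriv Γ none t (.comp A) →
      EEq Γ none (.ilet .top t) t (.comp A)
  | ilet_eta {Γ Δ t u A} : Deriv Γ Δ t (.comp .iunit) → Deriv Γ (some .iunit) u (.comp A) →
      EEq Γ Δ (.ilet t (Tm.ssubst .top u)) (Tm.ssubst t u) (.comp A)
  | bang_beta {Γ t u A B} : Deriv Γ none t A → Deriv (A :: Γ) none u (.comp B) →
      EEq Γ none (.banglet (.bang t) u) (Tm.subst0 t u) (.comp B)
  | bang_eta {Γ Δ t u A B} : Deriv Γ Δ t (.comp (.bang A)) →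
      Deriv Γ (some (.bang A)) u (.comp B) →
      EEq Γ Δ (.banglet t (Tm.ssubst (.bang (.var 0)) (Tm.shift u))) (Tm.ssubst t u) (.comp B)
  | copow_beta {Γ Δ t s u A B C} : Deriv Γ none t A → Deriv Γ Δ s (.comp B) →
      Deriv (A :: Γ) (some B) u (.comp C) →
      EEq Γ Δ (.copowlet (.copow t s) u) (Tm.ssubst s (Tm.subst0 t u)) (.comp C)
  | copow_eta {Γ Δ t u A B C} : Deriv Γ Δ t (.comp (.copow A B)) →
      Deriv Γ (some (.copow A B)) u (.comp C) →
      EEq Γ Δ (.copowlet t (Tm.ssubst (.copow (.var 0) .svar) (Tm.shift u))) (Tm.ssubst t u) (.comp C)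
  | czero_eta {Γ Δ t u A} : Deriv Γ Δ t (.comp .czero) → Deriv Γ (some .czero) u (.comp A) →
      EEq Γ Δ (.cimage A t) (Tm.ssubst t u) (.comp A)
  | csum_beta_inl {Γ Δ t u u' A B C} : Deriv Γ (some A) u (.comp C) →
      Deriv Γ (some B) u' (.comp C) → Deriv Γ Δ t (.comp A) →
      EEq Γ Δ (.ccase (.cinl t) u u') (Tm.ssubst t u) (.comp C)
  | csum_beta_inr {Γ Δ t u u' A B C} : Deriv Γ (some A) u (.comp C) →
      Deriv Γ (some B) u' (.comp C) → Deriv Γ Δ t (.comp B) →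
      EEq Γ Δ (.ccase (.cinr t) u u') (Tm.ssubst t u') (.comp C)
  | csum_eta {Γ Δ t u A B C} : Deriv Γ Δ t (.comp (.csum A B)) →
      Deriv Γ (some (.csum A B)) u (.comp C) →
      EEq Γ Δ (.ccase t (Tm.ssubst (.cinl .svar) u) (Tm.ssubst (.cinr .svar) u)) (Tm.ssubst t u) (.comp C)
  | llam_beta {Γ Δ t u A B} : Deriv Γ (some A) t (.comp B) → Deriv Γ Δ u (.comp A) →
      EEq Γ Δ (.lapp (.llam A t) u) (Tm.ssubst u t) (.comp B)
  | llam_eta {Γ t A B} : Deriv Γ none t (.lin A B) →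
      EEq Γ none (.llam A (.lapp t .svar)) t (.lin A B)

end EEC

namespace EEC

/-! ## The generic linear-use CPS self-translation of EEC (Figures 4–6) -/

mutual
  /-- CPS translation `Aᶜ` of value types, relative to the result type `R̲`. -/
  def cpsV (R : CType) : VType → VType
    | .base a => .base a
    | .unit => .unit
    | .prod A B => .prod (cpsV R A) (cpsV R B)
    | .arr A B => .arr (cpsV R A) (cpsV R B)
    | .comp A => .lin (cpsC R A) R
    | .lin A B => .lin (cpsC R B) (cpsC R A)
  /-- CPS translation `A̲ᶜ` of computation types, relative to the result type
  `R̲` (a computation-type constant equal to `R̲` is translated to `I̲`). -/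
  def cpsC (R : CType) : CType → CType
    | .base a =>
        match R with
        | .base b => if b = a then .iunit else .base a
        | _ => .base a
    | .cunit => .czero
    | .cand A B => .csum (cpsC R A) (cpsC R B)
    | .carr A B => .copow (cpsV R A) (cpsC R B)
    | .iunit => R
    | .bang A => .carr (cpsV R A) R
    | .copow A B => .carr (cpsV R A) (cpsC R B)
    | .czero => .cunit
    | .csum A B => .cand (cpsC R A) (cpsC R B)
end

/-- Pointwise CPS translation `Γᶜ` of a context. -/
def cpsCtx (R : CType) (Γ : List VType) : List VType := Γ.map (cpsV R)

/-- The generic linear-use CPS self-translation on terms (Figures 5 and 6 of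
the paper), defined by recursion on typing derivations.  A value judgement
`Γ ⊢ t : A` is sent to a term `tᶜ` with `Γᶜ ⊢ tᶜ : Aᶜ`, and a stoup
judgement `Γ | z:A̲ ⊢ t : B̲` is sent (contravariantly) to a term `tᶜ` with
`Γᶜ | k_z:B̲ᶜ ⊢ tᶜ : A̲ᶜ`. -/
def cps (R : CType) : {Γ : List VType} → {Δ : Option CType} → {t : Tm} → {A : VType} →
    Deriv Γ Δ t A → Tm
  | _, _, _, _, .var _ n _ _ => .var n
  | _, _, _, _, .svar _ _ => .svar
  | _, _, _, _, .unit _ => .unit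
  | _, _, _, _, .vpair _ _ _ _ _ d1 d2 => .vpair (cps R d1) (cps R d2)
  | _, _, _, _, .vfst _ _ _ _ d => .vfst (cps R d)
  | _, _, _, _, .vsnd _ _ _ _ d => .vsnd (cps R d)
  | _, _, _, _, .vlam _ _ A _ d => .vlam (cpsV R A) (cps R d)
  | _, _, _, _, .vapp _ _ _ _ _ d1 d2 => .vapp (cps R d1) (cps R d2)
  | _, _, _, _, .cunit _ none => .llam .czero (.cimage R .svar)
  | _, _, _, _, .cunit _ (some D) => .cimage (cpsC R D) .svar
  | _, _, _, _, .cpair _ none _ _ A B d1 d2 =>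
      .llam (.csum (cpsC R A) (cpsC R B))
        (.ccase .svar (.lapp (cps R d1) .svar) (.lapp (cps R d2) .svar))
  | _, _, _, _, .cpair _ (some _) _ _ _ _ d1 d2 => .ccase .svar (cps R d1) (cps R d2)
  | _, _, _, _, .cfst _ none _ A _ d => .llam (cpsC R A) (.lapp (cps R d) (.cinl .svar))
  | _, _, _, _, .cfst _ (some _) _ _ _ d => Tm.ssubst (.cinl .svar) (cps R d)
  | _, _, _, _, .csnd _ none _ _ B d => .llam (cpsC R B) (.lapp (cps R d) (.cinr .svar))
  | _, _, _, _, .csnd _ (some _) _ _ _ d => Tm.ssubst (.cinr .svar) (cps R d)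
  | _, _, _, _, .clam _ none _ A B d =>
      .llam (.copow (cpsV R A) (cpsC R B)) (.copowlet .svar (.lapp (cps R d) .svar))
  | _, _, _, _, .clam _ (some _) _ _ _ d => .copowlet .svar (cps R d)
  | _, _, _, _, .capp _ none _ _ _ B d1 d2 =>
      .llam (cpsC R B) (.lapp (cps R d1) (.copow (cps R d2) .svar))
  | _, _, _, _, .capp _ (some _) _ _ _ _ d1 d2 =>
      Tm.ssubst (.copow (cps R d2) .svar) (cps R d1)
  | _, _, _, _, .top _ => .llam R .svar
  | _, _, _, _, .ilet _ none _ _ A d1 d2 =>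
      .llam (cpsC R A) (.lapp (cps R d1) (.lapp (cps R d2) .svar))
  | _, _, _, _, .ilet _ (some _) _ _ _ d1 d2 =>
      Tm.ssubst (.lapp (cps R d2) .svar) (cps R d1)
  | _, _, _, _, .bang _ _ A d => .llam (.carr (cpsV R A) R) (.capp .svar (cps R d))
  | _, _, _, _, .banglet _ none _ _ A B d1 d2 =>
      .llam (cpsC R B) (.lapp (cps R d1) (.clam (cpsV R A) (.lapp (cps R d2) .svar)))
  | _, _, _, _, .banglet _ (some _) _ _ A _ d1 d2 =>
      Tm.ssubst (.clam (cpsV R A) (.lapp (cps R d2) .svar)) (cps R d1)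
  | _, _, _, _, .copow _ none _ _ A B d1 d2 =>
      .llam (.carr (cpsV R A) (cpsC R B)) (.lapp (cps R d2) (.capp .svar (cps R d1)))
  | _, _, _, _, .copow _ (some _) _ _ _ _ d1 d2 =>
      Tm.ssubst (.capp .svar (cps R d1)) (cps R d2)
  | _, _, _, _, .copowlet _ none _ _ A _ C d1 d2 =>
      .llam (cpsC R C) (.lapp (cps R d1) (.clam (cpsV R A) (cps R d2)))
  | _, _, _, _, .copowlet _ (some _) _ _ A _ _ d1 d2 =>
      Tm.ssubst (.clam (cpsV R A) (cps R d2)) (cps R d1)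
  | _, _, _, _, .cimage _ none _ A d => .llam (cpsC R A) (.lapp (cps R d) .cunit)
  | _, _, _, _, .cimage _ (some _) _ _ d => Tm.ssubst .cunit (cps R d)
  | _, _, _, _, .cinl _ none _ A B d =>
      .llam (.cand (cpsC R A) (cpsC R B)) (.lapp (cps R d) (.cfst .svar))
  | _, _, _, _, .cinl _ (some _) _ _ _ d => Tm.ssubst (.cfst .svar) (cps R d)
  | _, _, _, _, .cinr _ none _ A B d =>
      .llam (.cand (cpsC R A) (cpsC R B)) (.lapp (cps R d) (.csnd .svar))
  | _, _, _, _, .cinr _ (some _) _ _ _ d => Tm.ssubst (.csnd .svar) (cps R d)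
  | _, _, _, _, .ccase _ none _ _ _ _ _ C d1 d2 d3 =>
      .llam (cpsC R C) (.lapp (cps R d1) (.cpair (cps R d2) (cps R d3)))
  | _, _, _, _, .ccase _ (some _) _ _ _ _ _ _ d1 d2 d3 =>
      Tm.ssubst (.cpair (cps R d2) (cps R d3)) (cps R d1)
  | _, _, _, _, .llam _ _ _ B d => .llam (cpsC R B) (cps R d)
  | _, _, _, _, .lapp _ none _ _ _ B d1 d2 =>
      .llam (cpsC R B) (.lapp (cps R d2) (.lapp (cps R d1) .svar))
  | _, _, _, _, .lapp _ (some _) _ _ _ _ d1 d2 =>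
      Tm.ssubst (.lapp (cps R d1) .svar) (cps R d2)

end EEC

namespace EEC

/-! ## The type isomorphisms `ι` of Figure 7, with explicit inverses -/

mutual
  /-- The closed term `ι_A : (Aᶜ)ᶜ → A` (Figure 7). -/
  def iotaV (R : CType) : VType → Tm
    | .base a => .vlam (.base a) (.var 0)
    | .unit => .vlam .unit .unit
    | .prod A B => .vlam (cpsV R (cpsV R (.prod A B)))
        (.vpair (.vapp (iotaV R A) (.vfst (.var 0))) (.vapp (iotaV R B) (.vsnd (.var 0))))
    | .arr A B => .vlam (cpsV R (cpsV R (.arr A B)))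
        (.vlam A (.vapp (iotaV R B) (.vapp (.var 1) (.vapp (iotaVinv R A) (.var 0)))))
    | .comp A => .vlam (cpsV R (cpsV R (.comp A)))
        (.lapp (iotaC R A) (.lapp (.var 0) .top))
    | .lin A B => .vlam (cpsV R (cpsV R (.lin A B)))
        (.llam A (.lapp (iotaC R B) (.lapp (.var 0) (.lapp (iotaCinv R A) .svar))))
  /-- The closed term `ι_A⁻¹ : A → (Aᶜ)ᶜ`. -/
  def iotaVinv (R : CType) : VType → Tm
    | .base a => .vlam (.base a) (.var 0)
    | .unit => .vlam .unit .unit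
    | .prod A B => .vlam (.prod A B)
        (.vpair (.vapp (iotaVinv R A) (.vfst (.var 0))) (.vapp (iotaVinv R B) (.vsnd (.var 0))))
    | .arr A B => .vlam (.arr A B)
        (.vlam (cpsV R (cpsV R A)) (.vapp (iotaVinv R B) (.vapp (.var 1) (.vapp (iotaV R A) (.var 0)))))
    | .comp A => .vlam (.comp A)
        (.llam .iunit (.ilet .svar (.lapp (iotaCinv R A) (.var 0))))
    | .lin A B => .vlam (.lin A B)
        (.llam (cpsC R (cpsC R A)) (.lapp (iotaCinv R B) (.lapp (.var 0) (.lapp (iotaC R A) .svar))))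
  /-- The closed term `ι_A̲ : (A̲ᶜ)ᶜ ⊸ A̲` (Figure 7). -/
  def iotaC (R : CType) : CType → Tm
    | .base a => .llam (cpsC R (cpsC R (.base a))) .svar
    | .cunit => .llam (cpsC R (cpsC R .cunit)) .cunit
    | .cand A B => .llam (cpsC R (cpsC R (.cand A B)))
        (.cpair (.lapp (iotaC R A) (.cfst .svar)) (.lapp (iotaC R B) (.csnd .svar)))
    | .carr A B => .llam (cpsC R (cpsC R (.carr A B)))
        (.clam A (.lapp (iotaC R B) (.capp .svar (.vapp (iotaVinv R A) (.var 0)))))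
    | .iunit => .llam (cpsC R (cpsC R .iunit)) .svar
    | .bang A => .llam (cpsC R (cpsC R (.bang A)))
        (.copowlet .svar (.ilet .svar (.bang (.vapp (iotaV R A) (.var 0)))))
    | .copow A B => .llam (cpsC R (cpsC R (.copow A B)))
        (.copowlet .svar (.copow (.vapp (iotaV R A) (.var 0)) (.lapp (iotaC R B) .svar)))
    | .czero => .llam (cpsC R (cpsC R .czero)) .svar
    | .csum A B => .llam (cpsC R (cpsC R (.csum A B)))
        (.ccase .svar (.cinl (.lapp (iotaC R A) .svar)) (.cinr (.lapp (iotaC R B) .svar)))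
  /-- The closed term `ι_A̲⁻¹ : A̲ ⊸ (A̲ᶜ)ᶜ`. -/
  def iotaCinv (R : CType) : CType → Tm
    | .base a => .llam (.base a) .svar
    | .cunit => .llam .cunit .cunit
    | .cand A B => .llam (.cand A B)
        (.cpair (.lapp (iotaCinv R A) (.cfst .svar)) (.lapp (iotaCinv R B) (.csnd .svar)))
    | .carr A B => .llam (.carr A B)
        (.clam (cpsV R (cpsV R A)) (.lapp (iotaCinv R B) (.capp .svar (.vapp (iotaV R A) (.var 0)))))
    | .iunit => .llam .iunit .svar
    | .bang A => .llam (.bang A)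
        (.banglet .svar (.copow (.vapp (iotaVinv R A) (.var 0)) .top))
    | .copow A B => .llam (.copow A B)
        (.copowlet .svar (.copow (.vapp (iotaVinv R A) (.var 0)) (.lapp (iotaCinv R B) .svar)))
    | .czero => .llam .czero .svar
    | .csum A B => .llam (.csum A B)
        (.ccase .svar (.cinl (.lapp (iotaCinv R A) .svar)) (.cinr (.lapp (iotaCinv R B) .svar)))
end

/-- The substitution `[ι⁻¹(Γ)]`, replacing each variable `xᵢ : Cᵢ` of `Γ` by
`ι_{Cᵢ}⁻¹(xᵢ)`. -/
def iotaSubst (R : CType) (Γ : List VType) (t : Tm) : Tm :=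
  Tm.psubst (fun n =>
    match Γ[n]? with
    | some C => .vapp (iotaVinv R C) (.var n)
    | none => .var n) t

/-! ## The simply-typed λ-calculus -/

/-- Simple types. -/
inductive STy : Type
  | base : ℕ → STy
  | unit : STy
  | prod : STy → STy → STy
  | arr : STy → STy → STy

/-- Raw simply-typed λ-terms (de Bruijn indices). -/
inductive LTm : Type
  | var : ℕ → LTm
  | unit : LTm
  | pair : LTm → LTm → LTm
  | fst : LTm → LTm
  | snd : LTm → LTm
  | lam : STy → LTm → LTm
  | app : LTm → LTm → LTm

namespace LTm

/-- Renaming of variables. -/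
def rename (f : ℕ → ℕ) : LTm → LTm
  | .var n => .var (f n)
  | .unit => .unit
  | .pair M N => .pair (rename f M) (rename f N)
  | .fst M => .fst (rename f M)
  | .snd M => .snd (rename f M)
  | .lam σ M => .lam σ (rename (Tm.liftN f) M)
  | .app M N => .app (rename f M) (rename f N)

/-- Weakening. -/
def shift (M : LTm) : LTm := rename Nat.succ M

/-- Parallel capture-avoiding substitution. -/
def psubst (σ : ℕ → LTm) : LTm → LTm
  | .var n => σ n
  | .unit => .unit
  | .pair M N => .pair (psubst σ M) (psubst σ N)
  | .fst M => .fst (psubst σ M)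
  | .snd M => .snd (psubst σ M)
  | .lam τ M => .lam τ (psubst (fun n => match n with | 0 => .var 0 | m + 1 => shift (σ m)) M)
  | .app M N => .app (psubst σ M) (psubst σ N)

/-- Capture-avoiding substitution `M[N/x]` for the innermost variable. -/
def subst0 (N : LTm) (M : LTm) : LTm :=
  psubst (fun n => match n with | 0 => N | m + 1 => .var m) M

end LTm

/-- Typing derivations of the simply-typed λ-calculus (Figure 3). -/
inductive LDeriv : List STy → LTm → STy → Type
  | var (Θ : List STy) (n : ℕ) (σ : STy) : Θ[n]? = some σ → LDeriv Θ (.var n) σ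
  | unit (Θ : List STy) : LDeriv Θ .unit .unit
  | pair (Θ : List STy) (M N : LTm) (σ τ : STy) :
      LDeriv Θ M σ → LDeriv Θ N τ → LDeriv Θ (.pair M N) (.prod σ τ)
  | fst (Θ : List STy) (M : LTm) (σ τ : STy) :
      LDeriv Θ M (.prod σ τ) → LDeriv Θ (.fst M) σ
  | snd (Θ : List STy) (M : LTm) (σ τ : STy) :
      LDeriv Θ M (.prod σ τ) → LDeriv Θ (.snd M) τ
  | lam (Θ : List STy) (M : LTm) (σ τ : STy) :
      LDeriv (σ :: Θ) M τ → LDeriv Θ (.lam σ M) (.arr σ τ)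
  | app (Θ : List STy) (M N : LTm) (σ τ : STy) :
      LDeriv Θ M (.arr σ τ) → LDeriv Θ N σ → LDeriv Θ (.app M N) τ

/-- Values of the (call-by-value) λ-calculus. -/
inductive LVal : LTm → Prop
  | var (n : ℕ) : LVal (.var n)
  | unit : LVal .unit
  | lam (σ : STy) (M : LTm) : LVal (.lam σ M)
  | pair {M N : LTm} : LVal M → LVal N → LVal (.pair M N)

/-- βη-equality of the simply-typed λ-calculus. -/
inductive LBetaEta : List STy → LTm → LTm → STy → Prop
  | refl {Θ M σ} : LDeriv Θ M σ → LBetaEta Θ M M σ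
  | symm {Θ M N σ} : LBetaEta Θ M N σ → LBetaEta Θ N M σ
  | trans {Θ M N P σ} : LBetaEta Θ M N σ → LBetaEta Θ N P σ → LBetaEta Θ M P σ
  | pair_cong {Θ M M' N N' σ τ} : LBetaEta Θ M M' σ → LBetaEta Θ N N' τ →
      LBetaEta Θ (.pair M N) (.pair M' N') (.prod σ τ)
  | fst_cong {Θ M M' σ τ} : LBetaEta Θ M M' (.prod σ τ) → LBetaEta Θ (.fst M) (.fst M') σ
  | snd_cong {Θ M M' σ τ} : LBetaEta Θ M M' (.prod σ τ) → LBetaEta Θ (.snd M) (.snd M') τ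
  | lam_cong {Θ M M' σ τ} : LBetaEta (σ :: Θ) M M' τ →
      LBetaEta Θ (.lam σ M) (.lam σ M') (.arr σ τ)
  | app_cong {Θ M M' N N' σ τ} : LBetaEta Θ M M' (.arr σ τ) → LBetaEta Θ N N' σ →
      LBetaEta Θ (.app M N) (.app M' N') τ
  | beta {Θ M N σ τ} : LDeriv (σ :: Θ) M τ → LDeriv Θ N σ →
      LBetaEta Θ (.app (.lam σ M) N) (LTm.subst0 N M) τ
  | eta {Θ M σ τ} : LDeriv Θ M (.arr σ τ) →
      LBetaEta Θ (.lam σ (.app (LTm.shift M) (.var 0))) M (.arr σ τ)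
  | fst_beta {Θ M N σ τ} : LDeriv Θ M σ → LDeriv Θ N τ →
      LBetaEta Θ (.fst (.pair M N)) M σ
  | snd_beta {Θ M N σ τ} : LDeriv Θ M σ → LDeriv Θ N τ →
      LBetaEta Θ (.snd (.pair M N)) N τ
  | pair_eta {Θ M σ τ} : LDeriv Θ M (.prod σ τ) →
      LBetaEta Θ (.pair (.fst M) (.snd M)) M (.prod σ τ)
  | unit_eta {Θ M} : LDeriv Θ M .unit → LBetaEta Θ M .unit .unit

/-- Equality in Moggi's computational λ-calculus `λc` (call-by-value
βη-equalities restricted to values, together with the `let`-laws, expressed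
via the standard encoding `let x = M in N := (λx.N) M`). -/
inductive LamC : List STy → LTm → LTm → STy → Prop
  | refl {Θ M σ} : LDeriv Θ M σ → LamC Θ M M σ
  | symm {Θ M N σ} : LamC Θ M N σ → LamC Θ N M σ
  | trans {Θ M N P σ} : LamC Θ M N σ → LamC Θ N P σ → LamC Θ M P σ
  | pair_cong {Θ M M' N N' σ τ} : LamC Θ M M' σ → LamC Θ N N' τ →
      LamC Θ (.pair M N) (.pair M' N') (.prod σ τ)
  | fst_cong {Θ M M' σ τ} : LamC Θ M M' (.prod σ τ) → LamC Θ (.fst M) (.fst M') σ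
  | snd_cong {Θ M M' σ τ} : LamC Θ M M' (.prod σ τ) → LamC Θ (.snd M) (.snd M') τ
  | lam_cong {Θ M M' σ τ} : LamC (σ :: Θ) M M' τ →
      LamC Θ (.lam σ M) (.lam σ M') (.arr σ τ)
  | app_cong {Θ M M' N N' σ τ} : LamC Θ M M' (.arr σ τ) → LamC Θ N N' σ →
      LamC Θ (.app M N) (.app M' N') τ
  | beta_v {Θ M V σ τ} : LDeriv (σ :: Θ) M τ → LDeriv Θ V σ → LVal V →
      LamC Θ (.app (.lam σ M) V) (LTm.subst0 V M) τ
  | eta_v {Θ V σ τ} : LVal V → LDeriv Θ V (.arr σ τ) →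
      LamC Θ (.lam σ (.app (LTm.shift V) (.var 0))) V (.arr σ τ)
  | fst_beta_v {Θ V W σ τ} : LVal V → LVal W → LDeriv Θ V σ → LDeriv Θ W τ →
      LamC Θ (.fst (.pair V W)) V σ
  | snd_beta_v {Θ V W σ τ} : LVal V → LVal W → LDeriv Θ V σ → LDeriv Θ W τ →
      LamC Θ (.snd (.pair V W)) W τ
  | pair_eta_v {Θ V σ τ} : LVal V → LDeriv Θ V (.prod σ τ) →
      LamC Θ (.pair (.fst V) (.snd V)) V (.prod σ τ)
  | unit_eta_v {Θ V} : LVal V → LDeriv Θ V .unit → LamC Θ V .unit .unit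
  | let_eta {Θ M σ} : LDeriv Θ M σ → LamC Θ (.app (.lam σ (.var 0)) M) M σ
  | let_assoc {Θ M N L σ ρ τ} : LDeriv (σ :: Θ) M τ → LDeriv (ρ :: Θ) N σ →
      LDeriv Θ L ρ →
      LamC Θ (.app (.lam σ M) (.app (.lam ρ N) L))
        (.app (.lam ρ (.app (.lam σ (LTm.rename (Tm.liftN Nat.succ) M)) N)) L) τ
  | app_left {Θ M N σ τ} : LDeriv Θ M (.arr σ τ) → LDeriv Θ N σ →
      LamC Θ (.app M N) (.app (.lam (.arr σ τ) (.app (.var 0) (LTm.shift N))) M) τ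
  | app_right {Θ V N σ τ} : LVal V → LDeriv Θ V (.arr σ τ) → LDeriv Θ N σ →
      LamC Θ (.app V N) (.app (.lam σ (.app (LTm.shift V) (.var 0))) N) τ
  | pair_left {Θ M N σ τ} : LDeriv Θ M σ → LDeriv Θ N τ →
      LamC Θ (.pair M N) (.app (.lam σ (.pair (.var 0) (LTm.shift N))) M) (.prod σ τ)
  | pair_right {Θ V N σ τ} : LVal V → LDeriv Θ V σ → LDeriv Θ N τ →
      LamC Θ (.pair V N) (.app (.lam τ (.pair (LTm.shift V) (.var 0))) N) (.prod σ τ)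
  | fst_cc {Θ M σ τ} : LDeriv Θ M (.prod σ τ) →
      LamC Θ (.fst M) (.app (.lam (.prod σ τ) (.fst (.var 0))) M) σ
  | snd_cc {Θ M σ τ} : LDeriv Θ M (.prod σ τ) →
      LamC Θ (.snd M) (.app (.lam (.prod σ τ) (.snd (.var 0))) M) τ

end EEC

namespace EEC

/-! ## The standard cbv and cbn translations of typed λ-calculus into EEC -/

/-- The computation-type constant `α̲` associated with a simply-typed
λ-calculus type constant `α` (the association is injective but not
surjective, so that some computation-type constants of EEC are different
from `α̲` for every λ-calculus type constant `α`). -/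
def assocC (a : ℕ) : CType := .base (a + 1)

/-- The call-by-value translation `σᵛ` on types. -/
def cbvT : STy → VType
  | .base a => .base a
  | .unit => .unit
  | .prod σ τ => .prod (cbvT σ) (cbvT τ)
  | .arr σ τ => .arr (cbvT σ) (.comp (.bang (cbvT τ)))

/-- The call-by-value translation `Θᵛ` on contexts. -/
def cbvCtx (Θ : List STy) : List VType := Θ.map cbvT

/-- The call-by-value translation on terms: `Θ ⊢ M : τ` is sent to
`Θᵛ ⊢ Mᵛ : !(τᵛ)`. -/
def cbvTm : LTm → Tm
  | .var n => .bang (.var n)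
  | .unit => .bang .unit
  | .pair M N => .banglet (cbvTm M) (.banglet (Tm.shift (cbvTm N)) (.bang (.vpair (.var 1) (.var 0))))
  | .fst M => .banglet (cbvTm M) (.bang (.vfst (.var 0)))
  | .snd M => .banglet (cbvTm M) (.bang (.vsnd (.var 0)))
  | .lam σ M => .bang (.vlam (cbvT σ) (cbvTm M))
  | .app M N => .banglet (cbvTm M) (.banglet (Tm.shift (cbvTm N)) (.vapp (.var 1) (.var 0)))

/-- The call-by-name translation `σⁿ` on types. -/
def cbnT : STy → CType
  | .base a => assocC a
  | .unit => .cunit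
  | .prod σ τ => .cand (cbnT σ) (cbnT τ)
  | .arr σ τ => .carr (.comp (cbnT σ)) (cbnT τ)

/-- The call-by-name translation `Θⁿ` on contexts. -/
def cbnCtx (Θ : List STy) : List VType := Θ.map (fun σ => .comp (cbnT σ))

/-- The call-by-name translation on terms: `Θ ⊢ M : τ` is sent to
`Θⁿ ⊢ Mⁿ : τⁿ`, mimicking each construct by the corresponding
computation-type construct of EEC. -/
def cbnTm : LTm → Tm
  | .var n => .var n
  | .unit => .cunit
  | .pair M N => .cpair (cbnTm M) (cbnTm N)
  | .fst M => .cfst (cbnTm M)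
  | .snd M => .csnd (cbnTm M)
  | .lam σ M => .clam (.comp (cbnT σ)) (cbnTm M)
  | .app M N => .capp (cbnTm M) (cbnTm N)

/-! ## Hasegawa's linear-use CPS translations (Section 4) -/

/-- The call-by-value linear-use CPS translation `σᵛᶜ` on types. -/
def cbvcpsT (R : CType) : STy → VType
  | .base a => .base a
  | .unit => .unit
  | .prod σ τ => .prod (cbvcpsT R σ) (cbvcpsT R τ)
  | .arr σ τ => .arr (cbvcpsT R σ) (.lin (.carr (cbvcpsT R τ) R) R)

/-- `Θᵛᶜ`. -/
def cbvcpsCtx (R : CType) (Θ : List STy) : List VType := Θ.map (cbvcpsT R)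

/-- The call-by-value linear-use CPS translation on terms: `Θ ⊢ M : τ` is
sent to `Θᵛᶜ ⊢ Mᵛᶜ : (τᵛᶜ ⇒ R̲) ⊸ R̲`. -/
def cbvcps (R : CType) : {Θ : List STy} → {M : LTm} → {σ : STy} → LDeriv Θ M σ → Tm
  | _, _, _, .var _ n σ _ => .llam (.carr (cbvcpsT R σ) R) (.capp .svar (.var n))
  | _, _, _, .unit _ => .llam (.carr .unit R) (.capp .svar .unit)
  | _, _, _, .pair _ _ _ σ τ dM dN =>
      .llam (.carr (.prod (cbvcpsT R σ) (cbvcpsT R τ)) R)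
        (.lapp (cbvcps R dM)
          (.clam (cbvcpsT R σ)
            (.lapp (Tm.shift (cbvcps R dN))
              (.clam (cbvcpsT R τ) (.capp .svar (.vpair (.var 1) (.var 0)))))))
  | _, _, _, .fst _ _ σ τ dM =>
      .llam (.carr (cbvcpsT R σ) R)
        (.lapp (cbvcps R dM)
          (.clam (.prod (cbvcpsT R σ) (cbvcpsT R τ)) (.capp .svar (.vfst (.var 0)))))
  | _, _, _, .snd _ _ σ τ dM =>
      .llam (.carr (cbvcpsT R τ) R)
        (.lapp (cbvcps R dM)
          (.clam (.prod (cbvcpsT R σ) (cbvcpsT R τ)) (.capp .svar (.vsnd (.var 0)))))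
  | _, _, _, .lam _ _ σ τ dM =>
      .llam (.carr (.arr (cbvcpsT R σ) (.lin (.carr (cbvcpsT R τ) R) R)) R)
        (.capp .svar (.vlam (cbvcpsT R σ) (cbvcps R dM)))
  | _, _, _, .app _ _ _ σ τ dM dN =>
      .llam (.carr (cbvcpsT R τ) R)
        (.lapp (cbvcps R dM)
          (.clam (.arr (cbvcpsT R σ) (.lin (.carr (cbvcpsT R τ) R) R))
            (.lapp (Tm.shift (cbvcps R dN))
              (.clam (cbvcpsT R σ) (.lapp (.vapp (.var 1) (.var 0)) .svar)))))

/-- The call-by-name linear-use CPS translation `σⁿᶜ` on types. -/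
def cbncpsT (R : CType) : STy → CType
  | .base a => assocC a
  | .unit => .czero
  | .prod σ τ => .csum (cbncpsT R σ) (cbncpsT R τ)
  | .arr σ τ => .copow (.lin (cbncpsT R σ) R) (cbncpsT R τ)

/-- `Θⁿᶜ ⊸ R̲`, assigning each variable `xᵢ : σᵢ` the type `σᵢⁿᶜ ⊸ R̲`. -/
def cbncpsCtx (R : CType) (Θ : List STy) : List VType :=
  Θ.map (fun σ => .lin (cbncpsT R σ) R)

/-- The call-by-name linear-use CPS translation on terms: `Θ ⊢ M : τ` is
sent to `Θⁿᶜ ⊸ R̲ ⊢ Mⁿᶜ : τⁿᶜ ⊸ R̲`. -/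
def cbncps (R : CType) : {Θ : List STy} → {M : LTm} → {σ : STy} → LDeriv Θ M σ → Tm
  | _, _, _, .var _ n _ _ => .var n
  | _, _, _, .unit _ => .llam .czero (.cimage R .svar)
  | _, _, _, .pair _ _ _ σ τ dM dN =>
      .llam (.csum (cbncpsT R σ) (cbncpsT R τ))
        (.ccase .svar (.lapp (cbncps R dM) .svar) (.lapp (cbncps R dN) .svar))
  | _, _, _, .fst _ _ σ _τ dM => .llam (cbncpsT R σ) (.lapp (cbncps R dM) (.cinl .svar))
  | _, _, _, .snd _ _ _ τ dM => .llam (cbncpsT R τ) (.lapp (cbncps R dM) (.cinr .svar))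
  | _, _, _, .lam _ _ σ τ dM =>
      .llam (.copow (.lin (cbncpsT R σ) R) (cbncpsT R τ))
        (.copowlet .svar (.lapp (cbncps R dM) .svar))
  | _, _, _, .app _ _ _ σ τ dM dN =>
      .llam (cbncpsT R τ) (.lapp (cbncps R dM) (.copow (cbncps R dN) .svar))

end EEC

namespace EEC

namespace Tm

theorem liftN_comp (f g : ℕ → ℕ) : liftN f ∘ liftN g = liftN (f ∘ g) := by
  funext n; cases n <;> rfl

theorem liftS_comp_liftN (σ : ℕ → Tm) (f : ℕ → ℕ) : liftS σ ∘ liftN f = liftS (σ ∘ f) := by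
  funext n; cases n <;> rfl

theorem liftS_var : liftS .var = .var := by
  funext n; cases n <;> rfl

theorem rename_rename (t : Tm) (f g : ℕ → ℕ) :
    rename f (rename g t) = rename (f ∘ g) t := by
  induction t generalizing f g <;> simp_all [rename, liftN_comp]

theorem psubst_rename (t : Tm) (σ : ℕ → Tm) (f : ℕ → ℕ) :
    psubst σ (rename f t) = psubst (σ ∘ f) t := by
  induction t generalizing σ f <;> simp_all [rename, psubst, liftS_comp_liftN]

theorem rename_liftN_shift (t : Tm) (f : ℕ → ℕ) :
    rename (liftN f) (shift t) = shift (rename f t) := by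
  simp only [shift, rename_rename]; rfl

theorem rename_liftN_comp_liftS (σ : ℕ → Tm) (f : ℕ → ℕ) :
    rename (liftN f) ∘ liftS σ = liftS (rename f ∘ σ) := by
  funext n
  cases n
  · rfl
  · simp [liftS, rename_liftN_shift]

theorem rename_psubst (t : Tm) (σ : ℕ → Tm) (f : ℕ → ℕ) :
    rename f (psubst σ t) = psubst (rename f ∘ σ) t := by
  induction t generalizing σ f <;> simp_all [rename, psubst, rename_liftN_comp_liftS]

theorem psubst_liftS_shift (t : Tm) (σ : ℕ → Tm) :
    psubst (liftS σ) (shift t) = shift (psubst σ t) := by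
  simp only [shift, psubst_rename, rename_psubst]; rfl

theorem psubst_liftS_comp_liftS (σ τ : ℕ → Tm) :
    psubst (liftS τ) ∘ liftS σ = liftS (psubst τ ∘ σ) := by
  funext n
  cases n
  · rfl
  · simp [liftS, psubst_liftS_shift]

theorem psubst_psubst (t : Tm) (σ τ : ℕ → Tm) :
    psubst τ (psubst σ t) = psubst (psubst τ ∘ σ) t := by
  induction t generalizing σ τ <;> simp_all [psubst, psubst_liftS_comp_liftS]

theorem psubst_var (t : Tm) : psubst .var t = t := by
  induction t <;> simp_all [psubst, liftS_var]

theorem rename_ssubst (t u : Tm) (f : ℕ → ℕ) :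
    rename f (ssubst u t) = ssubst (rename f u) (rename f t) := by
  induction t generalizing u f <;> simp_all [rename, ssubst, rename_liftN_shift]

/-- Extension of a substitution by a term for the innermost variable. -/
def cons (u : Tm) (σ : ℕ → Tm) : ℕ → Tm
  | 0 => u
  | n + 1 => σ n

theorem subst0_eq (u t : Tm) : subst0 u t = psubst (cons u .var) t := by
  unfold subst0
  congr 1

theorem rename_subst0 (t u : Tm) (f : ℕ → ℕ) :
    rename f (subst0 u t) = subst0 (rename f u) (rename (liftN f) t) := by
  simp only [subst0_eq, rename_psubst, psubst_rename]
  congr 1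
  funext n; cases n <;> rfl

theorem subst0_shift (t u : Tm) : subst0 u (shift t) = t := by
  rw [subst0_eq, shift, psubst_rename]
  exact psubst_var t

theorem subst0_psubst_liftS (t u : Tm) (σ : ℕ → Tm) :
    subst0 u (psubst (liftS σ) t) = psubst (cons u σ) t := by
  rw [subst0_eq, psubst_psubst]
  congr 1
  funext n
  cases n
  · rfl
  · exact (subst0_eq _ _).symm.trans (subst0_shift _ _)

end Tm

/-- Renamings of value variables that respect contexts. -/
def Ren (f : ℕ → ℕ) (Γ Γ' : List VType) : Prop :=
  ∀ (n : ℕ) (A : VType), Γ[n]? = some A → Γ'[f n]? = some A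

theorem Ren.lift {f : ℕ → ℕ} {Γ Γ' : List VType} (h : Ren f Γ Γ') (A : VType) :
    Ren (Tm.liftN f) (A :: Γ) (A :: Γ') := by
  intro n B hn
  cases n
  · exact hn
  · exact h _ _ hn

theorem Ren.succ (Γ : List VType) (A : VType) : Ren Nat.succ Γ (A :: Γ) :=
  fun _ _ h => h

namespace Deriv

/-- Typing is preserved by renaming. -/
def rename {Γ : List VType} {Δ : Option CType} {t : Tm} {A : VType} (d : Deriv Γ Δ t A)
    {Γ' : List VType} {f : ℕ → ℕ} (h : Ren f Γ Γ') : Deriv Γ' Δ (Tm.rename f t) A :=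
  match d with
  | var _ n A hn => .var _ _ _ (h n A hn)
  | svar _ A => .svar _ A
  | unit _ => .unit _
  | vpair _ _ _ _ _ d e => .vpair _ _ _ _ _ (d.rename h) (e.rename h)
  | vfst _ _ _ _ d => .vfst _ _ _ _ (d.rename h)
  | vsnd _ _ _ _ d => .vsnd _ _ _ _ (d.rename h)
  | vlam _ _ A _ d => .vlam _ _ _ _ (d.rename (h.lift A))
  | vapp _ _ _ _ _ d e => .vapp _ _ _ _ _ (d.rename h) (e.rename h)
  | cunit _ _ => .cunit _ _
  | cpair _ _ _ _ _ _ d e => .cpair _ _ _ _ _ _ (d.rename h) (e.rename h)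
  | cfst _ _ _ _ _ d => .cfst _ _ _ _ _ (d.rename h)
  | csnd _ _ _ _ _ d => .csnd _ _ _ _ _ (d.rename h)
  | clam _ _ _ A _ d => .clam _ _ _ _ _ (d.rename (h.lift A))
  | capp _ _ _ _ _ _ d e => .capp _ _ _ _ _ _ (d.rename h) (e.rename h)
  | top _ => .top _
  | ilet _ _ _ _ _ d e => .ilet _ _ _ _ _ (d.rename h) (e.rename h)
  | bang _ _ _ d => .bang _ _ _ (d.rename h)
  | banglet _ _ _ _ A _ d e => .banglet _ _ _ _ _ _ (d.rename h) (e.rename (h.lift A))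
  | copow _ _ _ _ _ _ d e => .copow _ _ _ _ _ _ (d.rename h) (e.rename h)
  | copowlet _ _ _ _ A _ _ d e => .copowlet _ _ _ _ _ _ _ (d.rename h) (e.rename (h.lift A))
  | cimage _ _ _ _ d => .cimage _ _ _ _ (d.rename h)
  | cinl _ _ _ _ _ d => .cinl _ _ _ _ _ (d.rename h)
  | cinr _ _ _ _ _ d => .cinr _ _ _ _ _ (d.rename h)
  | ccase _ _ _ _ _ _ _ _ d e e' =>
      .ccase _ _ _ _ _ _ _ _ (d.rename h) (e.rename h) (e'.rename h)
  | llam _ _ _ _ d => .llam _ _ _ _ (d.rename h)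
  | lapp _ _ _ _ _ _ d e => .lapp _ _ _ _ _ _ (d.rename h) (e.rename h)

/-- Typing is preserved by weakening. -/
def shift {Γ : List VType} {Δ : Option CType} {t : Tm} {A : VType} (d : Deriv Γ Δ t A)
    (B : VType) : Deriv (B :: Γ) Δ (Tm.shift t) A :=
  d.rename (Ren.succ Γ B)

/-- The innermost variable is well-typed. -/
def var0 (A : VType) (Γ : List VType) : Deriv (A :: Γ) none (.var 0) A :=
  .var _ _ _ rfl

end Deriv

/-- Well-typed substitutions for value variables. -/
def Sub (σ : ℕ → Tm) (Γ Γ' : List VType) : Type :=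
  ∀ (n : ℕ) (A : VType), Γ[n]? = some A → Deriv Γ' none (σ n) A

/-- Lifting of a well-typed substitution under a binder. -/
def Sub.lift {σ : ℕ → Tm} {Γ Γ' : List VType} (h : Sub σ Γ Γ') (A : VType) :
    Sub (Tm.liftS σ) (A :: Γ) (A :: Γ')
  | 0, _, hn => .var _ _ _ hn
  | n + 1, B, hn => (h n B hn).shift A

/-- Extension of a well-typed substitution. -/
def Sub.cons {σ : ℕ → Tm} {Γ Γ' : List VType} (h : Sub σ Γ Γ') {A : VType} {u : Tm}
    (d : Deriv Γ' none u A) : Sub (Tm.cons u σ) (A :: Γ) Γ'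
  | 0, _, hn => (Option.some.inj hn) ▸ d
  | n + 1, B, hn => h n B hn

/-- Typing of the identity substitution. -/
def Sub.id (Γ : List VType) : Sub .var Γ Γ := fun n A h => .var _ n A h

namespace Deriv

/-- Typing is preserved by substitution for value variables. -/
def psubst {Γ : List VType} {Δ : Option CType} {t : Tm} {A : VType} (d : Deriv Γ Δ t A)
    {Γ' : List VType} {σ : ℕ → Tm} (h : Sub σ Γ Γ') : Deriv Γ' Δ (Tm.psubst σ t) A :=
  match d with
  | var _ n A hn => h n A hn
  | svar _ A => .svar _ A
  | unit _ => .unit _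
  | vpair _ _ _ _ _ d e => .vpair _ _ _ _ _ (d.psubst h) (e.psubst h)
  | vfst _ _ _ _ d => .vfst _ _ _ _ (d.psubst h)
  | vsnd _ _ _ _ d => .vsnd _ _ _ _ (d.psubst h)
  | vlam _ _ A _ d => .vlam _ _ _ _ (d.psubst (h.lift A))
  | vapp _ _ _ _ _ d e => .vapp _ _ _ _ _ (d.psubst h) (e.psubst h)
  | cunit _ _ => .cunit _ _
  | cpair _ _ _ _ _ _ d e => .cpair _ _ _ _ _ _ (d.psubst h) (e.psubst h)
  | cfst _ _ _ _ _ d => .cfst _ _ _ _ _ (d.psubst h)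
  | csnd _ _ _ _ _ d => .csnd _ _ _ _ _ (d.psubst h)
  | clam _ _ _ A _ d => .clam _ _ _ _ _ (d.psubst (h.lift A))
  | capp _ _ _ _ _ _ d e => .capp _ _ _ _ _ _ (d.psubst h) (e.psubst h)
  | top _ => .top _
  | ilet _ _ _ _ _ d e => .ilet _ _ _ _ _ (d.psubst h) (e.psubst h)
  | bang _ _ _ d => .bang _ _ _ (d.psubst h)
  | banglet _ _ _ _ A _ d e => .banglet _ _ _ _ _ _ (d.psubst h) (e.psubst (h.lift A))
  | copow _ _ _ _ _ _ d e => .copow _ _ _ _ _ _ (d.psubst h) (e.psubst h)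
  | copowlet _ _ _ _ A _ _ d e => .copowlet _ _ _ _ _ _ _ (d.psubst h) (e.psubst (h.lift A))
  | cimage _ _ _ _ d => .cimage _ _ _ _ (d.psubst h)
  | cinl _ _ _ _ _ d => .cinl _ _ _ _ _ (d.psubst h)
  | cinr _ _ _ _ _ d => .cinr _ _ _ _ _ (d.psubst h)
  | ccase _ _ _ _ _ _ _ _ d e e' =>
      .ccase _ _ _ _ _ _ _ _ (d.psubst h) (e.psubst h) (e'.psubst h)
  | llam _ _ _ _ d => .llam _ _ _ _ (d.psubst h)
  | lapp _ _ _ _ _ _ d e => .lapp _ _ _ _ _ _ (d.psubst h) (e.psubst h)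

/-- Typing is preserved by substitution for the innermost variable. -/
def subst0 {Γ : List VType} {Δ : Option CType} {t u : Tm} {A B : VType}
    (d : Deriv (A :: Γ) Δ t B) (e : Deriv Γ none u A) : Deriv Γ Δ (Tm.subst0 u t) B :=
  Tm.subst0_eq u t ▸ d.psubst ((Sub.id Γ).cons e)

/-- A term typed with an empty stoup does not contain the stoup variable. -/
theorem ssubst_eq {Γ : List VType} {E : Option CType} {t : Tm} {A : VType}
    (d : Deriv Γ E t A) : E = none → ∀ u : Tm, Tm.ssubst u t = t := by
  induction d <;> simp_all [Tm.ssubst]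

/-- Typing is preserved by substitution for the stoup variable. -/
theorem ssubst {Γ : List VType} {E : Option CType} {t : Tm} {B : VType}
    (d : Deriv Γ E t B) : ∀ {A : CType} {Δ : Option CType} {u : Tm}, E = some A →
      Deriv Γ Δ u (.comp A) → Nonempty (Deriv Γ Δ (Tm.ssubst u t) B) := by
  induction d with
  | svar => intro A Δ u h e; cases h; exact ⟨e⟩
  | cunit => intro A Δ u h e; exact ⟨.cunit _ _⟩
  | cpair _ _ _ _ _ _ _ _ i j =>
    intro A Δ u h e; exact ⟨.cpair _ _ _ _ _ _ (i h e).some (j h e).some⟩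
  | cfst _ _ _ _ _ _ i => intro A Δ u h e; exact ⟨.cfst _ _ _ _ _ (i h e).some⟩
  | csnd _ _ _ _ _ _ i => intro A Δ u h e; exact ⟨.csnd _ _ _ _ _ (i h e).some⟩
  | clam _ _ _ A _ _ i => intro _ Δ u h e; exact ⟨.clam _ _ _ _ _ (i h (e.shift A)).some⟩
  | capp _ _ _ _ _ _ _ d' i =>
    intro A Δ u h e
    exact ⟨.capp _ _ _ _ _ _ (i h e).some ((d'.ssubst_eq rfl u).symm ▸ d')⟩
  | ilet _ _ _ _ _ _ d' i =>
    intro A Δ u h e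
    exact ⟨.ilet _ _ _ _ _ (i h e).some ((d'.ssubst_eq rfl u).symm ▸ d')⟩
  | banglet _ _ _ _ A _ _ d' i =>
    intro _ Δ u h e
    exact ⟨.banglet _ _ _ _ _ _ (i h e).some ((d'.ssubst_eq rfl (Tm.shift u)).symm ▸ d')⟩
  | copow _ _ _ _ _ _ d' _ _ i =>
    intro A Δ u h e
    exact ⟨.copow _ _ _ _ _ _ ((d'.ssubst_eq rfl u).symm ▸ d') (i h e).some⟩
  | copowlet _ _ _ _ _ _ _ _ d' i =>
    intro _ Δ u h e
    exact ⟨.copowlet _ _ _ _ _ _ _ (i h e).some d'⟩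
  | cimage _ _ _ _ _ i => intro _ Δ u h e; exact ⟨.cimage _ _ _ _ (i h e).some⟩
  | cinl _ _ _ _ _ _ i => intro _ Δ u h e; exact ⟨.cinl _ _ _ _ _ (i h e).some⟩
  | cinr _ _ _ _ _ _ i => intro _ Δ u h e; exact ⟨.cinr _ _ _ _ _ (i h e).some⟩
  | ccase _ _ _ _ _ _ _ _ _ d' d'' i =>
    intro _ Δ u h e; exact ⟨.ccase _ _ _ _ _ _ _ _ (i h e).some d' d''⟩
  | lapp _ _ _ _ _ _ d' _ _ i =>
    intro A Δ u h e
    exact ⟨.lapp _ _ _ _ _ _ ((d'.ssubst_eq rfl u).symm ▸ d') (i h e).some⟩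
  | _ => intro A Δ u h; cases h

/-- Substitutions fixing the variables of the context act trivially. -/
theorem psubst_eq {Γ : List VType} {Δ : Option CType} {t : Tm} {A : VType}
    (d : Deriv Γ Δ t A) : ∀ {σ : ℕ → Tm}, (∀ n < Γ.length, σ n = .var n) →
      Tm.psubst σ t = t := by
  have lift : ∀ {Γ : List VType} {B : VType} {σ : ℕ → Tm},
      (∀ n < Γ.length, σ n = .var n) → ∀ n < (B :: Γ).length, Tm.liftS σ n = .var n := by
    intro Γ B σ h n hn
    cases n with
    | zero => rfl
    | succ n => simp [Tm.liftS, h n (by simpa using hn), Tm.shift, Tm.rename]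
  induction d with
  | var _ n _ hn =>
    intro σ h
    exact h n (List.getElem?_eq_some_iff.mp hn).1
  | vlam _ _ _ _ _ i => intro σ h; simp [Tm.psubst, i (lift h)]
  | clam _ _ _ _ _ _ i => intro σ h; simp [Tm.psubst, i (lift h)]
  | banglet _ _ _ _ _ _ _ _ i j => intro σ h; simp [Tm.psubst, i h, j (lift h)]
  | copowlet _ _ _ _ _ _ _ _ _ i j => intro σ h; simp [Tm.psubst, i h, j (lift h)]
  | _ => intro σ h; simp_all [Tm.psubst]

end Deriv

/-- Provably equal terms are well-typed. -/
theorem EEq.wt {Γ : List VType} {Δ : Option CType} {t u : Tm} {A : VType}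
    (h : EEq Γ Δ t u A) : Nonempty (Deriv Γ Δ t A) ∧ Nonempty (Deriv Γ Δ u A) := by
  induction h with
  | refl d => exact ⟨⟨d⟩, ⟨d⟩⟩
  | symm _ i => exact ⟨i.2, i.1⟩
  | trans _ _ i j => exact ⟨i.1, j.2⟩
  | vpair_cong _ _ i j =>
    exact ⟨⟨.vpair _ _ _ _ _ i.1.some j.1.some⟩, ⟨.vpair _ _ _ _ _ i.2.some j.2.some⟩⟩
  | vfst_cong _ i => exact ⟨⟨.vfst _ _ _ _ i.1.some⟩, ⟨.vfst _ _ _ _ i.2.some⟩⟩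
  | vsnd_cong _ i => exact ⟨⟨.vsnd _ _ _ _ i.1.some⟩, ⟨.vsnd _ _ _ _ i.2.some⟩⟩
  | vlam_cong _ i => exact ⟨⟨.vlam _ _ _ _ i.1.some⟩, ⟨.vlam _ _ _ _ i.2.some⟩⟩
  | vapp_cong _ _ i j =>
    exact ⟨⟨.vapp _ _ _ _ _ i.1.some j.1.some⟩, ⟨.vapp _ _ _ _ _ i.2.some j.2.some⟩⟩
  | cpair_cong _ _ i j =>
    exact ⟨⟨.cpair _ _ _ _ _ _ i.1.some j.1.some⟩, ⟨.cpair _ _ _ _ _ _ i.2.some j.2.some⟩⟩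
  | cfst_cong _ i => exact ⟨⟨.cfst _ _ _ _ _ i.1.some⟩, ⟨.cfst _ _ _ _ _ i.2.some⟩⟩
  | csnd_cong _ i => exact ⟨⟨.csnd _ _ _ _ _ i.1.some⟩, ⟨.csnd _ _ _ _ _ i.2.some⟩⟩
  | clam_cong _ i => exact ⟨⟨.clam _ _ _ _ _ i.1.some⟩, ⟨.clam _ _ _ _ _ i.2.some⟩⟩
  | capp_cong _ _ i j =>
    exact ⟨⟨.capp _ _ _ _ _ _ i.1.some j.1.some⟩, ⟨.capp _ _ _ _ _ _ i.2.some j.2.some⟩⟩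
  | ilet_cong _ _ i j =>
    exact ⟨⟨.ilet _ _ _ _ _ i.1.some j.1.some⟩, ⟨.ilet _ _ _ _ _ i.2.some j.2.some⟩⟩
  | bang_cong _ i => exact ⟨⟨.bang _ _ _ i.1.some⟩, ⟨.bang _ _ _ i.2.some⟩⟩
  | banglet_cong _ _ i j =>
    exact ⟨⟨.banglet _ _ _ _ _ _ i.1.some j.1.some⟩,
      ⟨.banglet _ _ _ _ _ _ i.2.some j.2.some⟩⟩
  | copow_cong _ _ i j =>
    exact ⟨⟨.copow _ _ _ _ _ _ i.1.some j.1.some⟩, ⟨.copow _ _ _ _ _ _ i.2.some j.2.some⟩⟩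
  | copowlet_cong _ _ i j =>
    exact ⟨⟨.copowlet _ _ _ _ _ _ _ i.1.some j.1.some⟩,
      ⟨.copowlet _ _ _ _ _ _ _ i.2.some j.2.some⟩⟩
  | cimage_cong _ i => exact ⟨⟨.cimage _ _ _ _ i.1.some⟩, ⟨.cimage _ _ _ _ i.2.some⟩⟩
  | cinl_cong _ i => exact ⟨⟨.cinl _ _ _ _ _ i.1.some⟩, ⟨.cinl _ _ _ _ _ i.2.some⟩⟩
  | cinr_cong _ i => exact ⟨⟨.cinr _ _ _ _ _ i.1.some⟩, ⟨.cinr _ _ _ _ _ i.2.some⟩⟩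
  | ccase_cong _ _ _ i j k =>
    exact ⟨⟨.ccase _ _ _ _ _ _ _ _ i.1.some j.1.some k.1.some⟩,
      ⟨.ccase _ _ _ _ _ _ _ _ i.2.some j.2.some k.2.some⟩⟩
  | llam_cong _ i => exact ⟨⟨.llam _ _ _ _ i.1.some⟩, ⟨.llam _ _ _ _ i.2.some⟩⟩
  | lapp_cong _ _ i j =>
    exact ⟨⟨.lapp _ _ _ _ _ _ i.1.some j.1.some⟩, ⟨.lapp _ _ _ _ _ _ i.2.some j.2.some⟩⟩
  | unit_eta d => exact ⟨⟨d⟩, ⟨.unit _⟩⟩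
  | vfst_beta d e => exact ⟨⟨.vfst _ _ _ _ (.vpair _ _ _ _ _ d e)⟩, ⟨d⟩⟩
  | vsnd_beta d e => exact ⟨⟨.vsnd _ _ _ _ (.vpair _ _ _ _ _ d e)⟩, ⟨e⟩⟩
  | vpair_eta d => exact ⟨⟨.vpair _ _ _ _ _ (.vfst _ _ _ _ d) (.vsnd _ _ _ _ d)⟩, ⟨d⟩⟩
  | vlam_beta d e => exact ⟨⟨.vapp _ _ _ _ _ (.vlam _ _ _ _ d) e⟩, ⟨d.subst0 e⟩⟩
  | vlam_eta d =>
    exact ⟨⟨.vlam _ _ _ _ (.vapp _ _ _ _ _ (d.shift _) (.var0 _ _))⟩, ⟨d⟩⟩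
  | cunit_eta d => exact ⟨⟨d⟩, ⟨.cunit _ _⟩⟩
  | cfst_beta d e => exact ⟨⟨.cfst _ _ _ _ _ (.cpair _ _ _ _ _ _ d e)⟩, ⟨d⟩⟩
  | csnd_beta d e => exact ⟨⟨.csnd _ _ _ _ _ (.cpair _ _ _ _ _ _ d e)⟩, ⟨e⟩⟩
  | cpair_eta d =>
    exact ⟨⟨.cpair _ _ _ _ _ _ (.cfst _ _ _ _ _ d) (.csnd _ _ _ _ _ d)⟩, ⟨d⟩⟩
  | clam_beta d e => exact ⟨⟨.capp _ _ _ _ _ _ (.clam _ _ _ _ _ d) e⟩, ⟨d.subst0 e⟩⟩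
  | clam_eta d =>
    exact ⟨⟨.clam _ _ _ _ _ (.capp _ _ _ _ _ _ (d.shift _) (.var0 _ _))⟩, ⟨d⟩⟩
  | ilet_beta d => exact ⟨⟨.ilet _ _ _ _ _ (.top _) d⟩, ⟨d⟩⟩
  | ilet_eta d e =>
    exact ⟨⟨.ilet _ _ _ _ _ d (e.ssubst rfl (.top _)).some⟩, e.ssubst rfl d⟩
  | bang_beta d e => exact ⟨⟨.banglet _ _ _ _ _ _ (.bang _ _ _ d) e⟩, ⟨e.subst0 d⟩⟩
  | bang_eta d e =>
    exact ⟨⟨.banglet _ _ _ _ _ _ d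
      ((e.shift _).ssubst rfl (.bang _ _ _ (.var0 _ _))).some⟩, e.ssubst rfl d⟩
  | copow_beta d e e' =>
    exact ⟨⟨.copowlet _ _ _ _ _ _ _ (.copow _ _ _ _ _ _ d e) e'⟩,
      (e'.subst0 d).ssubst rfl e⟩
  | copow_eta d e =>
    exact ⟨⟨.copowlet _ _ _ _ _ _ _ d
      ((e.shift _).ssubst rfl (.copow _ _ _ _ _ _ (.var0 _ _) (.svar _ _))).some⟩,
      e.ssubst rfl d⟩
  | czero_eta d e => exact ⟨⟨.cimage _ _ _ _ d⟩, e.ssubst rfl d⟩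
  | csum_beta_inl d d' e =>
    exact ⟨⟨.ccase _ _ _ _ _ _ _ _ (.cinl _ _ _ _ _ e) d d'⟩, d.ssubst rfl e⟩
  | csum_beta_inr d d' e =>
    exact ⟨⟨.ccase _ _ _ _ _ _ _ _ (.cinr _ _ _ _ _ e) d d'⟩, d'.ssubst rfl e⟩
  | csum_eta d e =>
    exact ⟨⟨.ccase _ _ _ _ _ _ _ _ d (e.ssubst rfl (.cinl _ _ _ _ _ (.svar _ _))).some
      (e.ssubst rfl (.cinr _ _ _ _ _ (.svar _ _))).some⟩, e.ssubst rfl d⟩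
  | llam_beta d e => exact ⟨⟨.lapp _ _ _ _ _ _ (.llam _ _ _ _ d) e⟩, d.ssubst rfl e⟩
  | llam_eta d => exact ⟨⟨.llam _ _ _ _ (.lapp _ _ _ _ _ _ d (.svar _ _))⟩, ⟨d⟩⟩

/-- Provable equality is preserved by renaming. -/
theorem EEq.rename {Γ : List VType} {Δ : Option CType} {t u : Tm} {A : VType}
    (h : EEq Γ Δ t u A) : ∀ {Γ' : List VType} {f : ℕ → ℕ}, Ren f Γ Γ' →
      EEq Γ' Δ (Tm.rename f t) (Tm.rename f u) A := by
  induction h with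
  | refl d => intro Γ' f r; exact .refl (d.rename r)
  | symm _ i => intro Γ' f r; exact (i r).symm
  | trans _ _ i j => intro Γ' f r; exact (i r).trans (j r)
  | vpair_cong _ _ i j => intro Γ' f r; exact .vpair_cong (i r) (j r)
  | vfst_cong _ i => intro Γ' f r; exact .vfst_cong (i r)
  | vsnd_cong _ i => intro Γ' f r; exact .vsnd_cong (i r)
  | vlam_cong _ i => intro Γ' f r; exact .vlam_cong (i (r.lift _))
  | vapp_cong _ _ i j => intro Γ' f r; exact .vapp_cong (i r) (j r)
  | cpair_cong _ _ i j => intro Γ' f r; exact .cpair_cong (i r) (j r)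
  | cfst_cong _ i => intro Γ' f r; exact .cfst_cong (i r)
  | csnd_cong _ i => intro Γ' f r; exact .csnd_cong (i r)
  | clam_cong _ i => intro Γ' f r; exact .clam_cong (i (r.lift _))
  | capp_cong _ _ i j => intro Γ' f r; exact .capp_cong (i r) (j r)
  | ilet_cong _ _ i j => intro Γ' f r; exact .ilet_cong (i r) (j r)
  | bang_cong _ i => intro Γ' f r; exact .bang_cong (i r)
  | banglet_cong _ _ i j => intro Γ' f r; exact .banglet_cong (i r) (j (r.lift _))
  | copow_cong _ _ i j => intro Γ' f r; exact .copow_cong (i r) (j r)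
  | copowlet_cong _ _ i j => intro Γ' f r; exact .copowlet_cong (i r) (j (r.lift _))
  | cimage_cong _ i => intro Γ' f r; exact .cimage_cong (i r)
  | cinl_cong _ i => intro Γ' f r; exact .cinl_cong (i r)
  | cinr_cong _ i => intro Γ' f r; exact .cinr_cong (i r)
  | ccase_cong _ _ _ i j k => intro Γ' f r; exact .ccase_cong (i r) (j r) (k r)
  | llam_cong _ i => intro Γ' f r; exact .llam_cong (i r)
  | lapp_cong _ _ i j => intro Γ' f r; exact .lapp_cong (i r) (j r)
  | unit_eta d => intro Γ' f r; exact .unit_eta (d.rename r)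
  | vfst_beta d e => intro Γ' f r; exact .vfst_beta (d.rename r) (e.rename r)
  | vsnd_beta d e => intro Γ' f r; exact .vsnd_beta (d.rename r) (e.rename r)
  | vpair_eta d => intro Γ' f r; exact .vpair_eta (d.rename r)
  | vlam_beta d e =>
    intro Γ' f r
    rw [Tm.rename_subst0]
    exact .vlam_beta (d.rename (r.lift _)) (e.rename r)
  | vlam_eta d =>
    intro Γ' f r
    simp only [Tm.rename, Tm.rename_liftN_shift]
    exact .vlam_eta (d.rename r)
  | cunit_eta d => intro Γ' f r; exact .cunit_eta (d.rename r)
  | cfst_beta d e => intro Γ' f r; exact .cfst_beta (d.rename r) (e.rename r)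
  | csnd_beta d e => intro Γ' f r; exact .csnd_beta (d.rename r) (e.rename r)
  | cpair_eta d => intro Γ' f r; exact .cpair_eta (d.rename r)
  | clam_beta d e =>
    intro Γ' f r
    rw [Tm.rename_subst0]
    exact .clam_beta (d.rename (r.lift _)) (e.rename r)
  | clam_eta d =>
    intro Γ' f r
    simp only [Tm.rename, Tm.rename_liftN_shift]
    exact .clam_eta (d.rename r)
  | ilet_beta d => intro Γ' f r; exact .ilet_beta (d.rename r)
  | ilet_eta d e =>
    intro Γ' f r
    simp only [Tm.rename, Tm.rename_ssubst]
    exact .ilet_eta (d.rename r) (e.rename r)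
  | bang_beta d e =>
    intro Γ' f r
    rw [Tm.rename_subst0]
    exact .bang_beta (d.rename r) (e.rename (r.lift _))
  | bang_eta d e =>
    intro Γ' f r
    simp only [Tm.rename, Tm.rename_ssubst, Tm.rename_liftN_shift]
    exact .bang_eta (d.rename r) (e.rename r)
  | copow_beta d e e' =>
    intro Γ' f r
    rw [Tm.rename_ssubst, Tm.rename_subst0]
    exact .copow_beta (d.rename r) (e.rename r) (e'.rename (r.lift _))
  | copow_eta d e =>
    intro Γ' f r
    simp only [Tm.rename, Tm.rename_ssubst, Tm.rename_liftN_shift]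
    exact .copow_eta (d.rename r) (e.rename r)
  | czero_eta d e =>
    intro Γ' f r
    rw [Tm.rename_ssubst]
    exact .czero_eta (d.rename r) (e.rename r)
  | csum_beta_inl d d' e =>
    intro Γ' f r
    rw [Tm.rename_ssubst]
    exact .csum_beta_inl (d.rename r) (d'.rename r) (e.rename r)
  | csum_beta_inr d d' e =>
    intro Γ' f r
    rw [Tm.rename_ssubst]
    exact .csum_beta_inr (d.rename r) (d'.rename r) (e.rename r)
  | csum_eta d e =>
    intro Γ' f r
    simp only [Tm.rename, Tm.rename_ssubst]
    exact .csum_eta (d.rename r) (e.rename r)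
  | llam_beta d e =>
    intro Γ' f r
    rw [Tm.rename_ssubst]
    exact .llam_beta (d.rename r) (e.rename r)
  | llam_eta d => intro Γ' f r; exact .llam_eta (d.rename r)

/-- Provable equality is preserved by weakening. -/
theorem EEq.shift {Γ : List VType} {Δ : Option CType} {t u : Tm} {A : VType}
    (h : EEq Γ Δ t u A) (B : VType) : EEq (B :: Γ) Δ (Tm.shift t) (Tm.shift u) A :=
  h.rename (Ren.succ Γ B)

/-- Provable equality is a congruence for substitution for the stoup variable. -/
theorem EEq.ssubst {Γ : List VType} {Δ : Option CType} {t t' u u' : Tm} {A B : CType}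
    (h : EEq Γ (some A) t t' (.comp B)) (k : EEq Γ Δ u u' (.comp A)) :
    EEq Γ Δ (Tm.ssubst u t) (Tm.ssubst u' t') (.comp B) :=
  (EEq.llam_beta h.wt.1.some k.wt.1.some).symm.trans
    ((EEq.lapp_cong (.llam_cong h) k).trans (.llam_beta h.wt.2.some k.wt.2.some))

theorem Tm.ssubst_svar (t : Tm) : Tm.ssubst .svar t = t := by
  have h : Tm.shift .svar = .svar := rfl
  induction t <;> simp_all [Tm.ssubst]

/-- The codomain of the translation of a computation judgement: `R̲` for an empty stoup, the
translation of the stoup type otherwise. -/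
def stoupC (R : CType) : Option CType → CType
  | none => R
  | some D => cpsC R D

/-- The type of the translation of a judgement by a term with an empty stoup. -/
def closedType (R : CType) : Option CType → VType → VType
  | some D, .comp B => .lin (cpsC R B) (cpsC R D)
  | _, A => cpsV R A

theorem closedType_none (R : CType) (A : VType) : closedType R none A = cpsV R A := by
  cases A <;> rfl

theorem closedType_comp (R : CType) (Δ : Option CType) (B : CType) :
    closedType R Δ (.comp B) = .lin (cpsC R B) (stoupC R Δ) := by
  cases Δ <;> simp [closedType, stoupC, cpsV]

/-- A variant of the self-translation in which stoup judgements are sent to linear functions,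
so that computation judgements are treated uniformly in the stoup. -/
def closedCps (R : CType) : {Γ : List VType} → {Δ : Option CType} → {t : Tm} → {A : VType} →
    Deriv Γ Δ t A → Tm
  | _, _, _, _, .var _ n _ _ => .var n
  | _, _, _, _, .svar _ A => .llam (cpsC R A) .svar
  | _, _, _, _, .unit _ => .unit
  | _, _, _, _, .vpair _ _ _ _ _ d1 d2 => .vpair (closedCps R d1) (closedCps R d2)
  | _, _, _, _, .vfst _ _ _ _ d => .vfst (closedCps R d)
  | _, _, _, _, .vsnd _ _ _ _ d => .vsnd (closedCps R d)
  | _, _, _, _, .vlam _ _ A _ d => .vlam (cpsV R A) (closedCps R d)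
  | _, _, _, _, .vapp _ _ _ _ _ d1 d2 => .vapp (closedCps R d1) (closedCps R d2)
  | _, _, _, _, .cunit _ Δ => .llam .czero (.cimage (stoupC R Δ) .svar)
  | _, _, _, _, .cpair _ _ _ _ A B d1 d2 =>
      .llam (.csum (cpsC R A) (cpsC R B))
        (.ccase .svar (.lapp (closedCps R d1) .svar) (.lapp (closedCps R d2) .svar))
  | _, _, _, _, .cfst _ _ _ A _ d =>
      .llam (cpsC R A) (.lapp (closedCps R d) (.cinl .svar))
  | _, _, _, _, .csnd _ _ _ _ B d =>
      .llam (cpsC R B) (.lapp (closedCps R d) (.cinr .svar))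
  | _, _, _, _, .clam _ _ _ A B d =>
      .llam (.copow (cpsV R A) (cpsC R B)) (.copowlet .svar (.lapp (closedCps R d) .svar))
  | _, _, _, _, .capp _ _ _ _ _ B d1 d2 =>
      .llam (cpsC R B) (.lapp (closedCps R d1) (.copow (closedCps R d2) .svar))
  | _, _, _, _, .top _ => .llam R .svar
  | _, _, _, _, .ilet _ _ _ _ A d1 d2 =>
      .llam (cpsC R A) (.lapp (closedCps R d1) (.lapp (closedCps R d2) .svar))
  | _, _, _, _, .bang _ _ A d => .llam (.carr (cpsV R A) R) (.capp .svar (closedCps R d))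
  | _, _, _, _, .banglet _ _ _ _ A B d1 d2 =>
      .llam (cpsC R B)
        (.lapp (closedCps R d1) (.clam (cpsV R A) (.lapp (closedCps R d2) .svar)))
  | _, _, _, _, .copow _ _ _ _ A B d1 d2 =>
      .llam (.carr (cpsV R A) (cpsC R B))
        (.lapp (closedCps R d2) (.capp .svar (closedCps R d1)))
  | _, _, _, _, .copowlet _ _ _ _ A _ C d1 d2 =>
      .llam (cpsC R C)
        (.lapp (closedCps R d1) (.clam (cpsV R A) (.lapp (closedCps R d2) .svar)))
  | _, _, _, _, .cimage _ _ _ A d => .llam (cpsC R A) (.lapp (closedCps R d) .cunit)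
  | _, _, _, _, .cinl _ _ _ A B d =>
      .llam (.cand (cpsC R A) (cpsC R B)) (.lapp (closedCps R d) (.cfst .svar))
  | _, _, _, _, .cinr _ _ _ A B d =>
      .llam (.cand (cpsC R A) (cpsC R B)) (.lapp (closedCps R d) (.csnd .svar))
  | _, _, _, _, .ccase _ _ _ _ _ _ _ C d1 d2 d3 =>
      .llam (cpsC R C) (.lapp (closedCps R d1)
        (.cpair (.lapp (closedCps R d2) .svar) (.lapp (closedCps R d3) .svar)))
  | _, _, _, _, .llam _ _ _ _ d => closedCps R d
  | _, _, _, _, .lapp _ _ _ _ _ B d1 d2 =>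
      .llam (cpsC R B) (.lapp (closedCps R d2) (.lapp (closedCps R d1) .svar))

theorem closedCps_rename (R : CType) {Γ : List VType} {Δ : Option CType} {t : Tm} {A : VType}
    (d : Deriv Γ Δ t A) : ∀ {Γ' : List VType} {f : ℕ → ℕ} (h : Ren f Γ Γ'),
      closedCps R (d.rename h) = Tm.rename f (closedCps R d) := by
  induction d <;> intros <;> simp_all [closedCps, Deriv.rename, Tm.rename]

theorem closedCps_shift (R : CType) {Γ : List VType} {Δ : Option CType} {t : Tm} {A : VType}
    (d : Deriv Γ Δ t A) (B : VType) :
    closedCps R (d.shift B) = Tm.shift (closedCps R d) :=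
  closedCps_rename R d _

theorem cpsCtx_getElem? (R : CType) (Γ : List VType) (n : ℕ) :
    (cpsCtx R Γ)[n]? = Γ[n]?.map (cpsV R) := by
  simp [cpsCtx]

/-- The closed translation is well-typed. -/
theorem closedCps_wt (R : CType) {Γ : List VType} {Δ : Option CType} {t : Tm} {A : VType}
    (d : Deriv Γ Δ t A) :
    Nonempty (Deriv (cpsCtx R Γ) none (closedCps R d) (closedType R Δ A)) := by
  induction d with
  | var _ n A h =>
    rw [closedType_none]
    exact ⟨.var _ _ _ (by simp [cpsCtx_getElem?, h])⟩
  | svar => exact ⟨.llam _ _ _ _ (.svar _ _)⟩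
  | unit => exact ⟨.unit _⟩
  | vpair _ _ _ _ _ _ _ i j =>
    simp only [closedType_none] at i j ⊢
    exact ⟨.vpair _ _ _ _ _ i.some j.some⟩
  | vfst _ _ _ _ _ i =>
    simp only [closedType_none] at i ⊢
    exact ⟨.vfst _ _ _ _ i.some⟩
  | vsnd _ _ _ _ _ i =>
    simp only [closedType_none] at i ⊢
    exact ⟨.vsnd _ _ _ _ i.some⟩
  | vlam _ _ _ _ _ i =>
    simp only [closedType_none] at i ⊢
    exact ⟨.vlam _ _ _ _ i.some⟩
  | vapp _ _ _ _ _ _ _ i j =>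
    simp only [closedType_none] at i j ⊢
    exact ⟨.vapp _ _ _ _ _ i.some j.some⟩
  | cunit =>
    rw [closedType_comp]
    exact ⟨.llam _ _ _ _ (.cimage _ _ _ _ (.svar _ _))⟩
  | cpair _ _ _ _ _ _ _ _ i j =>
    simp only [closedType_comp] at i j ⊢
    exact ⟨.llam _ _ _ _ (.ccase _ _ _ _ _ _ _ _ (.svar _ _)
      (.lapp _ _ _ _ _ _ i.some (.svar _ _)) (.lapp _ _ _ _ _ _ j.some (.svar _ _)))⟩
  | cfst _ _ _ _ _ _ i =>
    simp only [closedType_comp] at i ⊢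
    exact ⟨.llam _ _ _ _ (.lapp _ _ _ _ _ _ i.some (.cinl _ _ _ _ _ (.svar _ _)))⟩
  | csnd _ _ _ _ _ _ i =>
    simp only [closedType_comp] at i ⊢
    exact ⟨.llam _ _ _ _ (.lapp _ _ _ _ _ _ i.some (.cinr _ _ _ _ _ (.svar _ _)))⟩
  | clam _ _ _ _ _ _ i =>
    simp only [closedType_comp] at i ⊢
    exact ⟨.llam _ _ _ _ (.copowlet _ _ _ _ _ _ _ (.svar _ _)
      (.lapp _ _ _ _ _ _ i.some (.svar _ _)))⟩
  | capp _ _ _ _ _ _ _ _ i j =>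
    simp only [closedType_comp, closedType_none] at i j ⊢
    exact ⟨.llam _ _ _ _ (.lapp _ _ _ _ _ _ i.some (.copow _ _ _ _ _ _ j.some (.svar _ _)))⟩
  | top => exact ⟨.llam _ _ _ _ (.svar _ _)⟩
  | ilet _ _ _ _ _ _ _ i j =>
    simp only [closedType_comp] at i j ⊢
    exact ⟨.llam _ _ _ _ (.lapp _ _ _ _ _ _ i.some (.lapp _ _ _ _ _ _ j.some (.svar _ _)))⟩
  | bang _ _ _ _ i =>
    simp only [closedType_comp, closedType_none] at i ⊢
    exact ⟨.llam _ _ _ _ (.capp _ _ _ _ _ _ (.svar _ _) i.some)⟩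
  | banglet _ _ _ _ _ _ _ _ i j =>
    simp only [closedType_comp] at i j ⊢
    exact ⟨.llam _ _ _ _ (.lapp _ _ _ _ _ _ i.some
      (.clam _ _ _ _ _ (.lapp _ _ _ _ _ _ j.some (.svar _ _))))⟩
  | copow _ _ _ _ _ _ _ _ i j =>
    simp only [closedType_comp, closedType_none] at i j ⊢
    exact ⟨.llam _ _ _ _ (.lapp _ _ _ _ _ _ j.some (.capp _ _ _ _ _ _ (.svar _ _) i.some))⟩
  | copowlet _ _ _ _ _ _ _ _ _ i j =>
    simp only [closedType_comp] at i j ⊢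
    exact ⟨.llam _ _ _ _ (.lapp _ _ _ _ _ _ i.some
      (.clam _ _ _ _ _ (.lapp _ _ _ _ _ _ j.some (.svar _ _))))⟩
  | cimage _ _ _ _ _ i =>
    simp only [closedType_comp] at i ⊢
    exact ⟨.llam _ _ _ _ (.lapp _ _ _ _ _ _ i.some (.cunit _ _))⟩
  | cinl _ _ _ _ _ _ i =>
    simp only [closedType_comp] at i ⊢
    exact ⟨.llam _ _ _ _ (.lapp _ _ _ _ _ _ i.some (.cfst _ _ _ _ _ (.svar _ _)))⟩
  | cinr _ _ _ _ _ _ i =>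
    simp only [closedType_comp] at i ⊢
    exact ⟨.llam _ _ _ _ (.lapp _ _ _ _ _ _ i.some (.csnd _ _ _ _ _ (.svar _ _)))⟩
  | ccase _ _ _ _ _ _ _ _ _ _ _ i j k =>
    simp only [closedType_comp] at i j k ⊢
    exact ⟨.llam _ _ _ _ (.lapp _ _ _ _ _ _ i.some (.cpair _ _ _ _ _ _
      (.lapp _ _ _ _ _ _ j.some (.svar _ _)) (.lapp _ _ _ _ _ _ k.some (.svar _ _))))⟩
  | llam _ _ _ _ _ i =>
    rw [closedType_comp] at i
    exact i
  | lapp _ _ _ _ _ _ _ _ i j =>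
    simp only [closedType_comp, closedType_none] at i j ⊢
    exact ⟨.llam _ _ _ _ (.lapp _ _ _ _ _ _ j.some (.lapp _ _ _ _ _ _ i.some (.svar _ _)))⟩

/-- The linear abstraction of the translation of a stoup judgement. -/
def closeTm (R : CType) : Option CType → VType → Tm → Tm
  | some _, .comp B, t => .llam (cpsC R B) t
  | _, _, t => t

theorem closeTm_none (R : CType) (A : VType) (t : Tm) : closeTm R none A t = t := by
  cases A <;> rfl

theorem EEq.unllam {Γ : List VType} {Δ : Option CType} {b f x x' : Tm} {A B : CType}
    (h : EEq Γ none (.llam A b) f (.lin A B)) (k : EEq Γ Δ x x' (.comp A)) :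
    EEq Γ Δ (Tm.ssubst x b) (.lapp f x') (.comp B) := by
  obtain ⟨⟨d⟩, -⟩ := h.wt
  cases d with
  | llam _ _ _ _ d => exact (EEq.llam_beta d k.wt.1.some).symm.trans (.lapp_cong h k)

theorem EEq.svar {Γ : List VType} {A : CType} : EEq Γ (some A) .svar .svar (.comp A) :=
  .refl (.svar _ _)

theorem EEq.body {Γ : List VType} {b f : Tm} {A B : CType}
    (h : EEq Γ none (.llam A b) f (.lin A B)) :
    EEq Γ (some A) b (.lapp f .svar) (.comp B) := by
  have := h.unllam EEq.svar
  rwa [Tm.ssubst_svar] at this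

/-- The closed translation agrees with the self-translation. -/
theorem cps_eq_closedCps (R : CType) {Γ : List VType} {Δ : Option CType} {t : Tm} {A : VType}
    (d : Deriv Γ Δ t A) :
    EEq (cpsCtx R Γ) none (closeTm R Δ A (cps R d)) (closedCps R d) (closedType R Δ A) := by
  induction d with
  | var _ n A h => exact closeTm_none R A _ ▸ .refl (closedCps_wt R (.var _ n A h)).some
  | svar _ A => exact .refl (closedCps_wt R (.svar _ A)).some
  | unit => exact .refl (.unit _)
  | vpair _ _ _ _ _ _ _ i j =>
    simp only [closedType_none, closeTm_none] at i j ⊢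
    exact .vpair_cong i j
  | vfst _ _ _ _ _ i =>
    simp only [closedType_none, closeTm_none] at i ⊢
    exact .vfst_cong i
  | vsnd _ _ _ _ _ i =>
    simp only [closedType_none, closeTm_none] at i ⊢
    exact .vsnd_cong i
  | vlam _ _ _ _ _ i =>
    simp only [closedType_none, closeTm_none] at i ⊢
    exact .vlam_cong i
  | vapp _ _ _ _ _ _ _ i j =>
    simp only [closedType_none, closeTm_none] at i j ⊢
    exact .vapp_cong i j
  | cunit _ Δ =>
    cases Δ with
    | none => exact .refl (closedCps_wt R (.cunit _ none)).some
    | some D => exact .refl (closedCps_wt R (.cunit _ (some D))).some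
  | cpair _ Δ _ _ _ _ _ _ i j =>
    cases Δ with
    | none => exact .llam_cong (.ccase_cong .svar (.lapp_cong i .svar) (.lapp_cong j .svar))
    | some D => exact .llam_cong (.ccase_cong .svar (EEq.body i) (EEq.body j))
  | cfst _ Δ _ _ _ _ i =>
    cases Δ with
    | none => exact .llam_cong (.lapp_cong i (.cinl_cong .svar))
    | some D => exact .llam_cong (EEq.unllam i (.cinl_cong .svar))
  | csnd _ Δ _ _ _ _ i =>
    cases Δ with
    | none => exact .llam_cong (.lapp_cong i (.cinr_cong .svar))
    | some D => exact .llam_cong (EEq.unllam i (.cinr_cong .svar))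
  | clam _ Δ _ _ _ _ i =>
    cases Δ with
    | none => exact .llam_cong (.copowlet_cong .svar (.lapp_cong i .svar))
    | some D => exact .llam_cong (.copowlet_cong .svar (EEq.body i))
  | capp _ Δ _ _ _ _ _ _ i j =>
    simp only [closedType_none, closeTm_none] at j
    cases Δ with
    | none => exact .llam_cong (.lapp_cong i (.copow_cong j .svar))
    | some D => exact .llam_cong (EEq.unllam i (.copow_cong j .svar))
  | top _ => exact .refl (closedCps_wt R (.top _)).some
  | ilet _ Δ _ _ _ _ _ i j =>
    cases Δ with
    | none => exact .llam_cong (.lapp_cong i (.lapp_cong j .svar))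
    | some D => exact .llam_cong (EEq.unllam i (.lapp_cong j .svar))
  | bang _ _ _ _ i =>
    simp only [closedType_none, closeTm_none] at i
    exact .llam_cong (.capp_cong .svar i)
  | banglet _ Δ _ _ _ _ _ _ i j =>
    cases Δ with
    | none => exact .llam_cong (.lapp_cong i (.clam_cong (.lapp_cong j .svar)))
    | some D => exact .llam_cong (EEq.unllam i (.clam_cong (.lapp_cong j .svar)))
  | copow _ Δ _ _ _ _ _ _ i j =>
    simp only [closedType_none, closeTm_none] at i
    cases Δ with
    | none => exact .llam_cong (.lapp_cong j (.capp_cong .svar i))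
    | some D => exact .llam_cong (EEq.unllam j (.capp_cong .svar i))
  | copowlet _ Δ _ _ _ _ _ _ _ i j =>
    cases Δ with
    | none => exact .llam_cong (.lapp_cong i (.clam_cong (EEq.body j)))
    | some D => exact .llam_cong (EEq.unllam i (.clam_cong (EEq.body j)))
  | cimage _ Δ _ _ _ i =>
    cases Δ with
    | none => exact .llam_cong (.lapp_cong i (.refl (.cunit _ _)))
    | some D => exact .llam_cong (EEq.unllam i (.refl (.cunit _ _)))
  | cinl _ Δ _ _ _ _ i =>
    cases Δ with
    | none => exact .llam_cong (.lapp_cong i (.cfst_cong .svar))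
    | some D => exact .llam_cong (EEq.unllam i (.cfst_cong .svar))
  | cinr _ Δ _ _ _ _ i =>
    cases Δ with
    | none => exact .llam_cong (.lapp_cong i (.csnd_cong .svar))
    | some D => exact .llam_cong (EEq.unllam i (.csnd_cong .svar))
  | ccase _ Δ _ _ _ _ _ _ _ _ _ i j k =>
    cases Δ with
    | none => exact .llam_cong (.lapp_cong i (.cpair_cong (EEq.body j) (EEq.body k)))
    | some D => exact .llam_cong (EEq.unllam i (.cpair_cong (EEq.body j) (EEq.body k)))
  | llam _ _ _ _ _ i => exact i
  | lapp _ Δ _ _ _ _ _ _ i j =>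
    simp only [closedType_none, closeTm_none] at i
    cases Δ with
    | none => exact .llam_cong (.lapp_cong j (.lapp_cong i .svar))
    | some D => exact .llam_cong (EEq.unllam j (.lapp_cong i .svar))

theorem EEq.ap {Γ : List VType} {Δ : Option CType} {f X Y : Tm} {A B : CType}
    (df : Deriv Γ none f (.lin A B)) (h : EEq Γ Δ X Y (.comp A)) :
    EEq Γ Δ (.lapp f X) (.lapp f Y) (.comp B) :=
  .lapp_cong (.refl df) h

theorem EEq.llam_svar {Γ : List VType} {X : Tm} {A B : CType}
    (d : Deriv Γ (some A) X (.comp B)) :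
    EEq Γ (some A) (.lapp (.llam A X) .svar) X (.comp B) := by
  have := EEq.llam_beta d (.svar Γ A)
  rwa [Tm.ssubst_svar] at this

theorem EEq.llam_id {Γ : List VType} {Δ : Option CType} {X : Tm} {A : CType}
    (d : Deriv Γ Δ X (.comp A)) :
    EEq Γ Δ (.lapp (.llam A .svar) X) X (.comp A) :=
  .llam_beta (.svar _ _) d

theorem EEq.czero_ext {Γ : List VType} {U V : Tm} {C : CType}
    (dU : Deriv Γ (some .czero) U (.comp C)) (dV : Deriv Γ (some .czero) V (.comp C)) :
    EEq Γ (some .czero) U V (.comp C) := by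
  have h := (EEq.czero_eta (.svar _ _) dU).symm.trans (.czero_eta (.svar _ _) dV)
  rwa [Tm.ssubst_svar, Tm.ssubst_svar] at h

theorem EEq.csum_ext {Γ : List VType} {U V : Tm} {A B C : CType}
    (dU : Deriv Γ (some (.csum A B)) U (.comp C)) (dV : Deriv Γ (some (.csum A B)) V (.comp C))
    (h : EEq Γ (some A) (Tm.ssubst (.cinl .svar) U) (Tm.ssubst (.cinl .svar) V) (.comp C))
    (k : EEq Γ (some B) (Tm.ssubst (.cinr .svar) U) (Tm.ssubst (.cinr .svar) V) (.comp C)) :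
    EEq Γ (some (.csum A B)) U V (.comp C) := by
  have h := (EEq.csum_eta (.svar _ _) dU).symm.trans
    ((EEq.ccase_cong .svar h k).trans (.csum_eta (.svar _ _) dV))
  rwa [Tm.ssubst_svar, Tm.ssubst_svar] at h

theorem EEq.copow_ext {Γ : List VType} {U V : Tm} {A : VType} {B C : CType}
    (dU : Deriv Γ (some (.copow A B)) U (.comp C))
    (dV : Deriv Γ (some (.copow A B)) V (.comp C))
    (h : EEq (A :: Γ) (some B) (Tm.ssubst (.copow (.var 0) .svar) (Tm.shift U))
      (Tm.ssubst (.copow (.var 0) .svar) (Tm.shift V)) (.comp C)) :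
    EEq Γ (some (.copow A B)) U V (.comp C) := by
  have h := (EEq.copow_eta (.svar _ _) dU).symm.trans
    ((EEq.copowlet_cong .svar h).trans (.copow_eta (.svar _ _) dV))
  rwa [Tm.ssubst_svar, Tm.ssubst_svar] at h

/-- Commutative squares `e ∘ s = s₀ ∘ c` of linear maps out of `B`. -/
structure Sq (Γ : List VType) (B B' B₀ Q : CType) (e s s₀ c : Tm) : Prop where
  e_wt : Nonempty (Deriv Γ none e (.lin B' Q))
  s_wt : Nonempty (Deriv Γ none s (.lin B B'))
  s₀_wt : Nonempty (Deriv Γ none s₀ (.lin B₀ Q))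
  c_wt : Nonempty (Deriv Γ none c (.lin B B₀))
  comm : EEq Γ (some B) (.lapp e (.lapp s .svar)) (.lapp s₀ (.lapp c .svar)) (.comp Q)

section Squares

variable {Γ : List VType} {B B' B₀ C C₀ Q : CType} {e s s₀ c : Tm}

theorem Sq.app (h : Sq Γ B B' B₀ Q e s s₀ c) {Δ : Option CType} {Y : Tm}
    (k : Deriv Γ Δ Y (.comp B)) :
    EEq Γ Δ (.lapp e (.lapp s Y)) (.lapp s₀ (.lapp c Y)) (.comp Q) := by
  have := h.comm.ssubst (EEq.refl k)
  simpa [Tm.ssubst, h.e_wt.some.ssubst_eq rfl, h.s_wt.some.ssubst_eq rfl,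
    h.s₀_wt.some.ssubst_eq rfl, h.c_wt.some.ssubst_eq rfl] using this

/-- Precomposition of the horizontal maps of a square. -/
theorem Sq.precomp {f f₀ cB cC X X₀ : Tm} (h : Sq Γ C B' C₀ Q e f f₀ cC)
    (dX : Deriv Γ (some B) X (.comp C)) (dX₀ : Deriv Γ (some B₀) X₀ (.comp C₀))
    (dc : Deriv Γ none cB (.lin B B₀))
    (k : EEq Γ (some B) (.lapp cC X) (Tm.ssubst (.lapp cB .svar) X₀) (.comp C₀)) :
    Sq Γ B B' B₀ Q e (.llam B (.lapp f X)) (.llam B₀ (.lapp f₀ X₀)) cB := by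
  obtain ⟨⟨de⟩, ⟨df⟩, ⟨df₀⟩, ⟨dcC⟩, -⟩ := id h
  have dF := Deriv.lapp _ _ _ _ _ _ df dX
  have dF₀ := Deriv.lapp _ _ _ _ _ _ df₀ dX₀
  refine ⟨⟨de⟩, ⟨.llam _ _ _ _ dF⟩, ⟨.llam _ _ _ _ dF₀⟩, ⟨dc⟩, ?_⟩
  refine (EEq.ap de (EEq.llam_svar dF)).trans ((h.app dX).trans ((EEq.ap df₀ k).trans ?_))
  have := EEq.llam_beta dF₀ (.lapp _ _ _ _ _ _ dc (.svar _ _))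
  rw [Tm.ssubst, df₀.ssubst_eq rfl] at this
  exact this.symm

/-- Squares out of the initial computation type. -/
theorem Sq.czero (de : Deriv Γ none e (.lin B' Q)) (ds : Deriv Γ none s (.lin .czero B'))
    (ds₀ : Deriv Γ none s₀ (.lin B₀ Q)) (dc : Deriv Γ none c (.lin .czero B₀)) :
    Sq Γ .czero B' B₀ Q e s s₀ c :=
  ⟨⟨de⟩, ⟨ds⟩, ⟨ds₀⟩, ⟨dc⟩, .czero_ext (.lapp _ _ _ _ _ _ de (.lapp _ _ _ _ _ _ ds (.svar _ _)))
    (.lapp _ _ _ _ _ _ ds₀ (.lapp _ _ _ _ _ _ dc (.svar _ _)))⟩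

/-- Copairing of squares. -/
theorem Sq.csum {B₁ B₂ C₁ C₂ : CType} {f g f₀ g₀ c₁ c₂ : Tm}
    (h : Sq Γ B₁ B' C₁ Q e f f₀ c₁) (k : Sq Γ B₂ B' C₂ Q e g g₀ c₂)
    (dc : Deriv Γ none c (.lin (.csum B₁ B₂) (.csum C₁ C₂)))
    (hl : EEq Γ (some B₁) (.lapp c (.cinl .svar)) (.cinl (.lapp c₁ .svar)) (.comp (.csum C₁ C₂)))
    (hr : EEq Γ (some B₂) (.lapp c (.cinr .svar)) (.cinr (.lapp c₂ .svar)) (.comp (.csum C₁ C₂))) :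
    Sq Γ (.csum B₁ B₂) B' (.csum C₁ C₂) Q e
      (.llam (.csum B₁ B₂) (.ccase .svar (.lapp f .svar) (.lapp g .svar)))
      (.llam (.csum C₁ C₂) (.ccase .svar (.lapp f₀ .svar) (.lapp g₀ .svar))) c := by
  obtain ⟨⟨de⟩, ⟨df⟩, ⟨df₀⟩, ⟨dc₁⟩, h⟩ := h
  obtain ⟨-, ⟨dg⟩, ⟨dg₀⟩, ⟨dc₂⟩, k⟩ := k
  have ap : ∀ {A D : CType} {f : Tm}, Deriv Γ none f (.lin A D) →
      Deriv Γ (some A) (.lapp f .svar) (.comp D) := fun d => .lapp _ _ _ _ _ _ d (.svar _ _)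
  have dF := Deriv.ccase _ _ _ _ _ _ _ _ (.svar _ _) (ap df) (ap dg)
  have dF₀ := Deriv.ccase _ _ _ _ _ _ _ _ (.svar _ _) (ap df₀) (ap dg₀)
  have bl : ∀ {Δ : Option CType} {Y : Tm}, Deriv Γ Δ Y (.comp C₁) →
      EEq Γ Δ (.lapp (.llam (.csum C₁ C₂) (.ccase .svar (.lapp f₀ .svar) (.lapp g₀ .svar)))
        (.cinl Y)) (.lapp f₀ Y) (.comp Q) := by
    intro Δ Y dY
    refine (EEq.llam_beta dF₀ (.cinl _ _ _ _ _ dY)).trans ?_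
    have := EEq.csum_beta_inl (ap df₀) (ap dg₀) dY
    simpa [Tm.ssubst, df₀.ssubst_eq rfl, dg₀.ssubst_eq rfl] using this
  have br : ∀ {Δ : Option CType} {Y : Tm}, Deriv Γ Δ Y (.comp C₂) →
      EEq Γ Δ (.lapp (.llam (.csum C₁ C₂) (.ccase .svar (.lapp f₀ .svar) (.lapp g₀ .svar)))
        (.cinr Y)) (.lapp g₀ Y) (.comp Q) := by
    intro Δ Y dY
    refine (EEq.llam_beta dF₀ (.cinr _ _ _ _ _ dY)).trans ?_
    have := EEq.csum_beta_inr (ap df₀) (ap dg₀) dY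
    simpa [Tm.ssubst, df₀.ssubst_eq rfl, dg₀.ssubst_eq rfl] using this
  refine ⟨⟨de⟩, ⟨.llam _ _ _ _ dF⟩, ⟨.llam _ _ _ _ dF₀⟩, ⟨dc⟩, ?_⟩
  refine (EEq.ap de (EEq.llam_svar dF)).trans ?_
  apply EEq.csum_ext
  · exact .lapp _ _ _ _ _ _ de dF
  · exact .lapp _ _ _ _ _ _ (.llam _ _ _ _ dF₀) (ap dc)
  · simp only [Tm.ssubst, de.ssubst_eq rfl, dc.ssubst_eq rfl]
    refine (EEq.ap de (EEq.csum_beta_inl (ap df) (ap dg) (.svar _ _))).trans ?_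
    rw [Tm.ssubst_svar]
    exact h.trans ((EEq.ap (.llam _ _ _ _ dF₀) hl).trans (bl (ap dc₁))).symm
  · simp only [Tm.ssubst, de.ssubst_eq rfl, dc.ssubst_eq rfl]
    refine (EEq.ap de (EEq.csum_beta_inr (ap df) (ap dg) (.svar _ _))).trans ?_
    rw [Tm.ssubst_svar]
    exact k.trans ((EEq.ap (.llam _ _ _ _ dF₀) hr).trans (br (ap dc₂))).symm

theorem subst0_var0_rename_liftN_succ (t : Tm) :
    Tm.subst0 (.var 0) (Tm.rename (Tm.liftN Nat.succ) t) = t := by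
  rw [Tm.subst0_eq, Tm.psubst_rename]
  refine Eq.trans ?_ (Tm.psubst_var t)
  congr 1
  funext n; cases n <;> rfl

theorem EEq.copow_beta_var0 {A : VType} {Δ : Option CType} {X Y : Tm}
    (dX : Deriv (A :: Γ) (some B) X (.comp C))
    (dY : Deriv (A :: Γ) Δ Y (.comp B)) :
    EEq (A :: Γ) Δ (.copowlet (.copow (.var 0) Y) (Tm.rename (Tm.liftN Nat.succ) X))
      (Tm.ssubst Y X) (.comp C) := by
  have := EEq.copow_beta (.var0 A Γ) dY (dX.rename ((Ren.succ Γ A).lift A))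
  rwa [subst0_var0_rename_liftN_succ] at this

/-- The extension of a family of squares to a copower. -/
theorem Sq.copow {A : VType} {f f₀ c' : Tm}
    (h : Sq (A :: Γ) B B' B₀ Q (Tm.shift e) f f₀ c')
    (de : Deriv Γ none e (.lin B' Q))
    (dc : Deriv Γ none c (.lin (.copow A B) (.copow A B₀)))
    (hc : EEq (A :: Γ) (some B) (.lapp (Tm.shift c) (.copow (.var 0) .svar))
      (.copow (.var 0) (.lapp c' .svar)) (.comp (.copow A B₀))) :
    Sq Γ (.copow A B) B' (.copow A B₀) Q e
      (.llam (.copow A B) (.copowlet .svar (.lapp f .svar)))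
      (.llam (.copow A B₀) (.copowlet .svar (.lapp f₀ .svar))) c := by
  obtain ⟨-, ⟨df⟩, ⟨df₀⟩, ⟨dc'⟩, h⟩ := h
  have ap : ∀ {Γ : List VType} {A D : CType} {f : Tm}, Deriv Γ none f (.lin A D) →
      Deriv Γ (some A) (.lapp f .svar) (.comp D) := fun d => .lapp _ _ _ _ _ _ d (.svar _ _)
  have dF := Deriv.copowlet _ _ _ _ _ _ _ (.svar Γ (.copow A B)) (ap df)
  have dF₀ := Deriv.copowlet _ _ _ _ _ _ _ (.svar Γ (.copow A B₀)) (ap df₀)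
  refine ⟨⟨de⟩, ⟨.llam _ _ _ _ dF⟩, ⟨.llam _ _ _ _ dF₀⟩, ⟨dc⟩, ?_⟩
  refine (EEq.ap de (EEq.llam_svar dF)).trans ?_
  apply EEq.copow_ext
  · exact .lapp _ _ _ _ _ _ de dF
  · exact .lapp _ _ _ _ _ _ (.llam _ _ _ _ dF₀) (ap dc)
  · have b := EEq.copow_beta_var0 (ap df) (.svar _ _)
    rw [Tm.ssubst_svar] at b
    have b₀ := EEq.copow_beta_var0 (ap df₀) (ap dc')
    simp only [Tm.ssubst, df₀.ssubst_eq rfl] at b₀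
    have hl := (EEq.ap ((Deriv.llam _ _ _ _ dF₀).shift A) hc).trans
      (EEq.llam_beta (dF₀.shift A) (.copow _ _ _ _ _ _ (.var0 A Γ) (ap dc')))
    have := (EEq.ap (de.shift A) b).trans (h.trans (hl.trans b₀).symm)
    have he := (de.shift A).ssubst_eq rfl (.copow (.var 0) .svar)
    have hc := (dc.shift A).ssubst_eq rfl (.copow (.var 0) .svar)
    simp only [Tm.shift] at he hc
    simpa only [Tm.shift, Tm.rename, Tm.ssubst, he, hc] using this

end Squares

theorem Sq.precomp_id {Γ : List VType} {B B' C Q : CType} {e f f₀ X : Tm}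
    (h : Sq Γ C B' C Q e f f₀ (.llam C .svar)) (dX : Deriv Γ (some B) X (.comp C)) :
    Sq Γ B B' B Q e (.llam B (.lapp f X)) (.llam B (.lapp f₀ X)) (.llam B .svar) := by
  refine h.precomp dX dX (.llam _ _ _ _ (.svar _ _)) ((EEq.llam_id dX).trans ?_)
  have := (EEq.refl dX).ssubst (EEq.llam_id (.svar Γ B)).symm
  rwa [Tm.ssubst_svar] at this

theorem exists_closedCps_eq (R : CType) {Γ : List VType} {Δ : Option CType} {t t' : Tm} {A : VType}
    (d : Deriv Γ Δ t A) (h : t' = t) :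
    ∃ d' : Deriv Γ Δ t' A, closedCps R d' = closedCps R d := by
  subst h
  exact ⟨d, rfl⟩

/-- The closed translation sends substitution for the stoup variable to composition, for a
suitable derivation of the substituted term. -/
theorem closedCps_ssubst (R : CType) {Γ : List VType} {E : Option CType} {t : Tm} {T : VType}
    (d : Deriv Γ E t T) : ∀ {A B : CType} {u : Tm}, E = some A → T = .comp B →
      ∀ du : Deriv Γ none u (.comp A), ∃ dtu : Deriv Γ none (Tm.ssubst u t) (.comp B),
        Sq (cpsCtx R Γ) (cpsC R B) (cpsC R A) (cpsC R B) R (closedCps R du) (closedCps R d)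
          (closedCps R dtu) (.llam (cpsC R B) .svar) := by
  have wtC : ∀ {Γ : List VType} {Δ : Option CType} {t : Tm} {B : CType}
      (d : Deriv Γ Δ t (.comp B)),
      Nonempty (Deriv (cpsCtx R Γ) none (closedCps R d) (.lin (cpsC R B) (stoupC R Δ))) := by
    intro Γ Δ t B d
    exact closedType_comp R Δ B ▸ closedCps_wt R d
  have wtV : ∀ {Γ : List VType} {t : Tm} {A : VType} (d : Deriv Γ none t A),
      Nonempty (Deriv (cpsCtx R Γ) none (closedCps R d) (cpsV R A)) := by
    intro Γ t A d
    exact closedType_none R A ▸ closedCps_wt R d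
  have id_wt : ∀ (Γ : List VType) (B : CType), Deriv Γ none (.llam B .svar) (.lin B B) :=
    fun Γ B => .llam _ _ _ _ (.svar _ _)
  induction d with
  | svar Γ A' =>
    intro A B u hE hT du
    obtain rfl := Option.some.inj hE; cases hT
    have hu : Nonempty (Deriv (cpsCtx R Γ) none (closedCps R du) (.lin (cpsC R A') R)) := wtC du
    exact ⟨du, hu, ⟨id_wt _ _⟩, hu, ⟨id_wt _ _⟩,
      .refl (.lapp _ _ _ _ _ _ hu.some (.lapp _ _ _ _ _ _ (id_wt _ _) (.svar _ _)))⟩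
  | cunit Γ Δ =>
    intro A B u hE hT du
    cases hT; subst hE
    refine ⟨.cunit _ _, ?_⟩
    exact .czero (wtC du).some (wtC (.cunit Γ (some A))).some (wtC (.cunit Γ none)).some
      (id_wt _ _)
  | cpair Γ Δ t₁ t₂ A₁ A₂ d e i j =>
    intro A B u hE hT du
    cases hT
    obtain ⟨d', hd⟩ := i hE rfl du
    obtain ⟨e', he⟩ := j hE rfl du
    subst hE
    refine ⟨.cpair _ _ _ _ _ _ d' e', hd.csum he (id_wt _ _) ?_ ?_⟩
    · exact (EEq.llam_id (.cinl _ _ _ _ _ (.svar _ _))).trans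
        (.cinl_cong (EEq.llam_id (.svar _ _)).symm)
    · exact (EEq.llam_id (.cinr _ _ _ _ _ (.svar _ _))).trans
        (.cinr_cong (EEq.llam_id (.svar _ _)).symm)
  | cfst Γ Δ t A₁ A₂ d i =>
    intro A B u hE hT du
    cases hT
    obtain ⟨d', hd⟩ := i hE rfl du
    exact ⟨.cfst _ _ _ _ _ d', hd.precomp_id (.cinl _ _ _ _ _ (.svar _ _))⟩
  | csnd Γ Δ t A₁ A₂ d i =>
    intro A B u hE hT du
    cases hT
    obtain ⟨d', hd⟩ := i hE rfl du
    exact ⟨.csnd _ _ _ _ _ d', hd.precomp_id (.cinr _ _ _ _ _ (.svar _ _))⟩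
  | clam Γ Δ t A₁ A₂ d i =>
    intro A B u hE hT du
    cases hT
    obtain ⟨d', hd⟩ := i hE rfl (du.shift A₁)
    subst hE
    rw [closedCps_shift] at hd
    refine ⟨.clam _ _ _ _ _ d', hd.copow (wtC du).some (id_wt _ _) ?_⟩
    exact (EEq.llam_id (.copow _ _ _ _ _ _ (.var0 _ _) (.svar _ _))).trans
      (.copow_cong (.refl (.var0 _ _)) (EEq.llam_id (.svar _ _)).symm)
  | capp Γ Δ s t A₁ A₂ d e i _ =>
    intro A B u hE hT du
    cases hT
    obtain ⟨d', hd⟩ := i hE rfl du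
    obtain ⟨e', he⟩ := exists_closedCps_eq R e (e.ssubst_eq rfl u)
    refine ⟨.capp _ _ _ _ _ _ d' e', ?_⟩
    simp only [closedCps, he]
    exact hd.precomp_id (.copow _ _ _ _ _ _ (wtV e).some (.svar _ _))
  | ilet Γ Δ t₁ t₂ A₁ d e i _ =>
    intro A B u hE hT du
    cases hT
    obtain ⟨d', hd⟩ := i hE rfl du
    obtain ⟨e', he⟩ := exists_closedCps_eq R e (e.ssubst_eq rfl u)
    refine ⟨.ilet _ _ _ _ _ d' e', ?_⟩
    simp only [closedCps, he]
    exact hd.precomp_id (.lapp _ _ _ _ _ _ (wtC e).some (.svar _ _))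
  | banglet Γ Δ t₁ t₂ A₁ A₂ d e i _ =>
    intro A B u hE hT du
    cases hT
    obtain ⟨d', hd⟩ := i hE rfl du
    obtain ⟨e', he⟩ := exists_closedCps_eq R e (e.ssubst_eq rfl (Tm.shift u))
    refine ⟨.banglet _ _ _ _ _ _ d' e', ?_⟩
    simp only [closedCps, he]
    exact hd.precomp_id (.clam _ _ _ _ _ (.lapp _ _ _ _ _ _ (wtC e).some (.svar _ _)))
  | copow Γ Δ t₁ t₂ A₁ A₂ d e _ i =>
    intro A B u hE hT du
    cases hT
    obtain ⟨e', he⟩ := i hE rfl du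
    obtain ⟨d', hd⟩ := exists_closedCps_eq R d (d.ssubst_eq rfl u)
    refine ⟨.copow _ _ _ _ _ _ d' e', ?_⟩
    simp only [closedCps, hd]
    exact he.precomp_id (.capp _ _ _ _ _ _ (.svar _ _) (wtV d).some)
  | copowlet Γ Δ t₁ t₂ A₁ A₂ A₃ d e i _ =>
    intro A B u hE hT du
    cases hT
    obtain ⟨d', hd⟩ := i hE rfl du
    exact ⟨.copowlet _ _ _ _ _ _ _ d' e,
      hd.precomp_id (.clam _ _ _ _ _ (.lapp _ _ _ _ _ _ (wtC e).some (.svar _ _)))⟩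
  | cimage Γ Δ t A₁ d i =>
    intro A B u hE hT du
    cases hT
    obtain ⟨d', hd⟩ := i hE rfl du
    exact ⟨.cimage _ _ _ _ d', hd.precomp_id (.cunit _ _)⟩
  | cinl Γ Δ t A₁ A₂ d i =>
    intro A B u hE hT du
    cases hT
    obtain ⟨d', hd⟩ := i hE rfl du
    exact ⟨.cinl _ _ _ _ _ d', hd.precomp_id (.cfst _ _ _ _ _ (.svar _ _))⟩
  | cinr Γ Δ t A₁ A₂ d i =>
    intro A B u hE hT du
    cases hT
    obtain ⟨d', hd⟩ := i hE rfl du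
    exact ⟨.cinr _ _ _ _ _ d', hd.precomp_id (.csnd _ _ _ _ _ (.svar _ _))⟩
  | ccase Γ Δ t t₁ t₂ A₁ A₂ A₃ d e₁ e₂ i _ _ =>
    intro A B u hE hT du
    cases hT
    obtain ⟨d', hd⟩ := i hE rfl du
    exact ⟨.ccase _ _ _ _ _ _ _ _ d' e₁ e₂, hd.precomp_id (.cpair _ _ _ _ _ _
      (.lapp _ _ _ _ _ _ (wtC e₁).some (.svar _ _)) (.lapp _ _ _ _ _ _ (wtC e₂).some (.svar _ _)))⟩
  | lapp Γ Δ s t A₁ A₂ d e _ i =>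
    intro A B u hE hT du
    cases hT
    obtain ⟨e', he⟩ := i hE rfl du
    obtain ⟨d', hd⟩ := exists_closedCps_eq R d (d.ssubst_eq rfl u)
    refine ⟨.lapp _ _ _ _ _ _ d' e', ?_⟩
    simp only [closedCps, hd]
    exact he.precomp_id (.lapp _ _ _ _ _ _ (wtV d).some (.svar _ _))
  | _ => intro A B u hE; cases hE

/-! ### Closed terms -/

theorem Tm.rename_eq_psubst (f : ℕ → ℕ) (t : Tm) : rename f t = psubst (fun n => .var (f n)) t := by
  rw [← psubst_var (rename f t), psubst_rename]
  rfl

section Closed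

variable {c : Tm} {T : VType}

theorem Deriv.psubst_closed (d : Deriv [] none c T) (σ : ℕ → Tm) : Tm.psubst σ c = c :=
  d.psubst_eq (by simp)

theorem Deriv.rename_closed (d : Deriv [] none c T) (f : ℕ → ℕ) : Tm.rename f c = c := by
  rw [Tm.rename_eq_psubst, d.psubst_closed]

theorem Deriv.shift_closed (d : Deriv [] none c T) : Tm.shift c = c :=
  d.rename_closed _

/-- Closed terms are typed in every context. -/
def Deriv.weaken_closed (d : Deriv [] none c T) (Γ : List VType) : Deriv Γ none c T :=
  d.rename_closed id ▸ d.rename (f := id) (by intro n A h; simp at h)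

end Closed

/-! ### Approximation of types and the induced coercions -/

mutual
  /-- Approximation of value types: a component in covariant computation position may be
  replaced by the initial computation type. -/
  inductive LeV : VType → VType → Prop
    | base (a : ℕ) : LeV (.base a) (.base a)
    | unit : LeV .unit .unit
    | prod {A₀ A B₀ B : VType} : LeV A₀ A → LeV B₀ B → LeV (.prod A₀ B₀) (.prod A B)
    | arr (A : VType) {B₀ B : VType} : LeV B₀ B → LeV (.arr A B₀) (.arr A B)
    | comp {A₀ A : CType} : LeC A₀ A → LeV (.comp A₀) (.comp A)
    | lin (A : CType) {B₀ B : CType} : LeC B₀ B → LeV (.lin A B₀) (.lin A B)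
  /-- Approximation of computation types. -/
  inductive LeC : CType → CType → Prop
    | czero (A : CType) : LeC .czero A
    | base (a : ℕ) : LeC (.base a) (.base a)
    | cunit : LeC .cunit .cunit
    | cand {A₀ A B₀ B : CType} : LeC A₀ A → LeC B₀ B → LeC (.cand A₀ B₀) (.cand A B)
    | carr (A : VType) {B₀ B : CType} : LeC B₀ B → LeC (.carr A B₀) (.carr A B)
    | iunit : LeC .iunit .iunit
    | bang {A₀ A : VType} : LeV A₀ A → LeC (.bang A₀) (.bang A)
    | copow {A₀ A : VType} {B₀ B : CType} : LeV A₀ A → LeC B₀ B →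
        LeC (.copow A₀ B₀) (.copow A B)
    | csum {A₀ A B₀ B : CType} : LeC A₀ A → LeC B₀ B → LeC (.csum A₀ B₀) (.csum A B)
end

mutual
  theorem LeV.refl : ∀ A : VType, LeV A A
    | .base a => .base a
    | .unit => .unit
    | .prod A B => .prod (LeV.refl A) (LeV.refl B)
    | .arr A B => .arr A (LeV.refl B)
    | .comp A => .comp (LeC.refl A)
    | .lin A B => .lin A (LeC.refl B)
  theorem LeC.refl : ∀ A : CType, LeC A A
    | .base a => .base a
    | .cunit => .cunit
    | .cand A B => .cand (LeC.refl A) (LeC.refl B)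
    | .carr A B => .carr A (LeC.refl B)
    | .iunit => .iunit
    | .bang A => .bang (LeV.refl A)
    | .copow A B => .copow (LeV.refl A) (LeC.refl B)
    | .czero => .czero _
    | .csum A B => .csum (LeC.refl A) (LeC.refl B)
end

/-- The action of a coercion `v` from `A₀` to `A` and a linear coercion `c` out of `C` on
linear powers. -/
def powCo (v c : Tm) (A₀ A : VType) (C : CType) : Tm :=
  .llam (.carr A C) (.clam A₀ (.lapp c (.capp .svar (.vapp v (.var 0)))))

mutual
  /-- The coercion from `A₀ᶜ` to `Aᶜ` when `A₀` approximates `A`. -/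
  def coV (R : CType) : VType → VType → Tm
    | .base a, _ => .vlam (.base a) (.var 0)
    | .unit, _ => .vlam .unit (.var 0)
    | .prod A₀ B₀, .prod A B => .vlam (.prod (cpsV R A₀) (cpsV R B₀))
        (.vpair (.vapp (coV R A₀ A) (.vfst (.var 0))) (.vapp (coV R B₀ B) (.vsnd (.var 0))))
    | .arr _ B₀, .arr A B => .vlam (.arr (cpsV R A) (cpsV R B₀))
        (.vlam (cpsV R A) (.vapp (coV R B₀ B) (.vapp (.var 1) (.var 0))))
    | .comp A₀, .comp A => .vlam (.lin (cpsC R A₀) R)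
        (.llam (cpsC R A) (.lapp (.var 0) (.lapp (coC R A₀ A) .svar)))
    | .lin _ B₀, .lin A B => .vlam (.lin (cpsC R B₀) (cpsC R A))
        (.llam (cpsC R B) (.lapp (.var 0) (.lapp (coC R B₀ B) .svar)))
    | _, _ => .unit
  /-- The linear coercion from `A̲ᶜ` to `A̲₀ᶜ` when `A̲₀` approximates `A̲`. -/
  def coC (R : CType) : CType → CType → Tm
    | .czero, A => .llam (cpsC R A) .cunit
    | .base a, _ => .llam (cpsC R (.base a)) .svar
    | .cunit, _ => .llam .czero .svar
    | .cand A₀ B₀, .cand A B => .llam (.csum (cpsC R A) (cpsC R B))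
        (.ccase .svar (.cinl (.lapp (coC R A₀ A) .svar)) (.cinr (.lapp (coC R B₀ B) .svar)))
    | .carr _ B₀, .carr A B => .llam (.copow (cpsV R A) (cpsC R B))
        (.copowlet .svar (.copow (.var 0) (.lapp (coC R B₀ B) .svar)))
    | .iunit, _ => .llam R .svar
    | .bang A₀, .bang A => powCo (coV R A₀ A) (.llam R .svar) (cpsV R A₀) (cpsV R A) R
    | .copow A₀ B₀, .copow A B =>
        powCo (coV R A₀ A) (coC R B₀ B) (cpsV R A₀) (cpsV R A) (cpsC R B)
    | .csum A₀ B₀, .csum A B => .llam (.cand (cpsC R A) (cpsC R B))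
        (.cpair (.lapp (coC R A₀ A) (.cfst .svar)) (.lapp (coC R B₀ B) (.csnd .svar)))
    | _, _ => .unit
end

theorem llam_svar_wt (Γ : List VType) (A : CType) :
    Nonempty (Deriv Γ none (.llam A .svar) (.lin A A)) :=
  ⟨.llam _ _ _ _ (.svar _ _)⟩

theorem powCo_wt {v c : Tm} {A₀ A : VType} {C C₀ : CType}
    (hv : Nonempty (Deriv [] none v (.arr A₀ A))) (hc : Nonempty (Deriv [] none c (.lin C C₀))) :
    Nonempty (Deriv [] none (powCo v c A₀ A C) (.lin (.carr A C) (.carr A₀ C₀))) :=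
  ⟨.llam _ _ _ _ (.clam _ _ _ _ _ (.lapp _ _ _ _ _ _ (hc.some.weaken_closed _)
    (.capp _ _ _ _ _ _ (.svar _ _) (.vapp _ _ _ _ _ (hv.some.weaken_closed _) (.var0 _ _)))))⟩

mutual
  theorem LeV.wt (R : CType) : ∀ {A₀ A : VType}, LeV A₀ A →
      Nonempty (Deriv [] none (coV R A₀ A) (.arr (cpsV R A₀) (cpsV R A)))
    | _, _, .base a => ⟨by simp only [coV, cpsV]; exact .vlam _ _ _ _ (.var0 _ _)⟩
    | _, _, .unit => ⟨by simp only [coV, cpsV]; exact .vlam _ _ _ _ (.var0 _ _)⟩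
    | _, _, .prod h k => ⟨by
        simp only [coV, cpsV]
        exact .vlam _ _ _ _ (.vpair _ _ _ _ _
          (.vapp _ _ _ _ _ ((h.wt R).some.weaken_closed _) (.vfst _ _ _ _ (.var0 _ _)))
          (.vapp _ _ _ _ _ ((k.wt R).some.weaken_closed _) (.vsnd _ _ _ _ (.var0 _ _))))⟩
    | _, _, .arr A k => ⟨by
        simp only [coV, cpsV]
        exact .vlam _ _ _ _ (.vlam _ _ _ _ (.vapp _ _ _ _ _ ((k.wt R).some.weaken_closed _)
          (.vapp _ _ _ _ _ (.var _ 1 _ rfl) (.var0 _ _))))⟩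
    | _, _, .comp h => ⟨by
        simp only [coV, cpsV]
        exact .vlam _ _ _ _ (.llam _ _ _ _ (.lapp _ _ _ _ _ _ (.var0 _ _)
          (.lapp _ _ _ _ _ _ ((h.wt R).some.weaken_closed _) (.svar _ _))))⟩
    | _, _, .lin A h => ⟨by
        simp only [coV, cpsV]
        exact .vlam _ _ _ _ (.llam _ _ _ _ (.lapp _ _ _ _ _ _ (.var0 _ _)
          (.lapp _ _ _ _ _ _ ((h.wt R).some.weaken_closed _) (.svar _ _))))⟩
  theorem LeC.wt (R : CType) : ∀ {A₀ A : CType}, LeC A₀ A →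
      Nonempty (Deriv [] none (coC R A₀ A) (.lin (cpsC R A) (cpsC R A₀)))
    | _, _, .czero A => ⟨by simp only [coC, cpsC]; exact .llam _ _ _ _ (.cunit _ _)⟩
    | _, _, .base a => ⟨by simp only [coC]; exact .llam _ _ _ _ (.svar _ _)⟩
    | _, _, .cunit => ⟨by simp only [coC, cpsC]; exact .llam _ _ _ _ (.svar _ _)⟩
    | _, _, .cand h k => ⟨by
        simp only [coC, cpsC]
        exact .llam _ _ _ _ (.ccase _ _ _ _ _ _ _ _ (.svar _ _)
          (.cinl _ _ _ _ _ (.lapp _ _ _ _ _ _ (h.wt R).some (.svar _ _)))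
          (.cinr _ _ _ _ _ (.lapp _ _ _ _ _ _ (k.wt R).some (.svar _ _))))⟩
    | _, _, .carr A k => ⟨by
        simp only [coC, cpsC]
        exact .llam _ _ _ _ (.copowlet _ _ _ _ _ _ _ (.svar _ _)
          (.copow _ _ _ _ _ _ (.var0 _ _)
            (.lapp _ _ _ _ _ _ ((k.wt R).some.weaken_closed _) (.svar _ _))))⟩
    | _, _, .iunit => ⟨by simp only [coC, cpsC]; exact .llam _ _ _ _ (.svar _ _)⟩
    | _, _, .bang h => by
        simp only [coC, cpsC]
        exact powCo_wt (h.wt R) (llam_svar_wt _ _)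
    | _, _, .copow h k => by
        simp only [coC, cpsC]
        exact powCo_wt (h.wt R) (k.wt R)
    | _, _, .csum h k => ⟨by
        simp only [coC, cpsC]
        exact .llam _ _ _ _ (.cpair _ _ _ _ _ _
          (.lapp _ _ _ _ _ _ (h.wt R).some (.cfst _ _ _ _ _ (.svar _ _)))
          (.lapp _ _ _ _ _ _ (k.wt R).some (.csnd _ _ _ _ _ (.svar _ _))))⟩
end

/-- Typing of value coercions in arbitrary contexts. -/
theorem LeV.wtIn (R : CType) {A₀ A : VType} (h : LeV A₀ A) (Γ : List VType) :
    Nonempty (Deriv Γ none (coV R A₀ A) (.arr (cpsV R A₀) (cpsV R A))) :=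
  ⟨(h.wt R).some.weaken_closed Γ⟩

/-- Typing of linear coercions in arbitrary contexts. -/
theorem LeC.wtIn (R : CType) {A₀ A : CType} (h : LeC A₀ A) (Γ : List VType) :
    Nonempty (Deriv Γ none (coC R A₀ A) (.lin (cpsC R A) (cpsC R A₀))) :=
  ⟨(h.wt R).some.weaken_closed Γ⟩

section Beta

variable {R : CType} {Γ : List VType} {Δ : Option CType}

theorem coV_prod_app {A₀ A B₀ B : VType} (h : LeV A₀ A) (k : LeV B₀ B) {x : Tm}
    (d : Deriv Γ none x (.prod (cpsV R A₀) (cpsV R B₀))) :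
    EEq Γ none (.vapp (coV R (.prod A₀ B₀) (.prod A B)) x)
      (.vpair (.vapp (coV R A₀ A) (.vfst x)) (.vapp (coV R B₀ B) (.vsnd x)))
      (.prod (cpsV R A) (cpsV R B)) := by
  obtain ⟨dp⟩ := (h.prod k).wtIn R Γ
  simp only [coV, cpsV] at dp ⊢
  cases dp with
  | vlam _ _ _ _ dp =>
    have := EEq.vlam_beta dp d
    simpa only [Tm.subst0_eq, Tm.psubst, Tm.cons, (h.wt R).some.psubst_closed,
      (k.wt R).some.psubst_closed] using this

theorem coV_arr_app (A : VType) {B₀ B : VType} (k : LeV B₀ B) {x : Tm}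
    (d : Deriv Γ none x (.arr (cpsV R A) (cpsV R B₀))) :
    EEq Γ none (.vapp (coV R (.arr A B₀) (.arr A B)) x)
      (.vlam (cpsV R A) (.vapp (coV R B₀ B) (.vapp (Tm.shift x) (.var 0))))
      (.arr (cpsV R A) (cpsV R B)) := by
  obtain ⟨dp⟩ := (k.arr A).wtIn R Γ
  simp only [coV, cpsV] at dp ⊢
  cases dp with
  | vlam _ _ _ _ dp =>
    have := EEq.vlam_beta dp d
    simpa only [Tm.subst0_eq, Tm.psubst, Tm.cons, Tm.liftS,
      (k.wt R).some.psubst_closed] using this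

theorem coV_comp_app {A₀ A : CType} (h : LeC A₀ A) {x : Tm}
    (d : Deriv Γ none x (.lin (cpsC R A₀) R)) :
    EEq Γ none (.vapp (coV R (.comp A₀) (.comp A)) x)
      (.llam (cpsC R A) (.lapp x (.lapp (coC R A₀ A) .svar))) (.lin (cpsC R A) R) := by
  obtain ⟨dp⟩ := (LeV.comp h).wtIn R Γ
  simp only [coV, cpsV] at dp ⊢
  cases dp with
  | vlam _ _ _ _ dp =>
    have := EEq.vlam_beta dp d
    simpa only [Tm.subst0_eq, Tm.psubst, Tm.cons, (h.wt R).some.psubst_closed] using this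

theorem coV_lin_app (A : CType) {B₀ B : CType} (h : LeC B₀ B) {x : Tm}
    (d : Deriv Γ none x (.lin (cpsC R B₀) (cpsC R A))) :
    EEq Γ none (.vapp (coV R (.lin A B₀) (.lin A B)) x)
      (.llam (cpsC R B) (.lapp x (.lapp (coC R B₀ B) .svar))) (.lin (cpsC R B) (cpsC R A)) := by
  obtain ⟨dp⟩ := (LeV.lin A h).wtIn R Γ
  simp only [coV, cpsV] at dp ⊢
  cases dp with
  | vlam _ _ _ _ dp =>
    have := EEq.vlam_beta dp d
    simpa only [Tm.subst0_eq, Tm.psubst, Tm.cons, (h.wt R).some.psubst_closed] using this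

theorem coC_cand_inl {A₀ A B₀ B : CType} (h : LeC A₀ A) (k : LeC B₀ B) :
    EEq Γ (some (cpsC R A)) (.lapp (coC R (.cand A₀ B₀) (.cand A B)) (.cinl .svar))
      (.cinl (.lapp (coC R A₀ A) .svar)) (.comp (.csum (cpsC R A₀) (cpsC R B₀))) := by
  obtain ⟨dh⟩ := h.wtIn R Γ
  obtain ⟨dk⟩ := k.wtIn R Γ
  have d₁ := Deriv.cinl _ _ _ _ (cpsC R B₀) (.lapp _ _ _ _ _ _ dh (.svar _ _))
  have d₂ := Deriv.cinr _ _ _ (cpsC R A₀) _ (.lapp _ _ _ _ _ _ dk (.svar _ _))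
  simp only [coC]
  refine (EEq.llam_beta (.ccase _ _ _ _ _ _ _ _ (.svar _ _) d₁ d₂)
    (.cinl _ _ _ _ _ (.svar _ _))).trans ?_
  have := EEq.csum_beta_inl d₁ d₂ (.svar _ _)
  rwa [Tm.ssubst_svar] at this

theorem coC_cand_inr {A₀ A B₀ B : CType} (h : LeC A₀ A) (k : LeC B₀ B) :
    EEq Γ (some (cpsC R B)) (.lapp (coC R (.cand A₀ B₀) (.cand A B)) (.cinr .svar))
      (.cinr (.lapp (coC R B₀ B) .svar)) (.comp (.csum (cpsC R A₀) (cpsC R B₀))) := by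
  obtain ⟨dh⟩ := h.wtIn R Γ
  obtain ⟨dk⟩ := k.wtIn R Γ
  have d₁ := Deriv.cinl _ _ _ _ (cpsC R B₀) (.lapp _ _ _ _ _ _ dh (.svar _ _))
  have d₂ := Deriv.cinr _ _ _ (cpsC R A₀) _ (.lapp _ _ _ _ _ _ dk (.svar _ _))
  simp only [coC]
  refine (EEq.llam_beta (.ccase _ _ _ _ _ _ _ _ (.svar _ _) d₁ d₂)
    (.cinr _ _ _ _ _ (.svar _ _))).trans ?_
  have := EEq.csum_beta_inr d₁ d₂ (.svar _ _)
  rwa [Tm.ssubst_svar] at this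

theorem coC_carr_copow (A : VType) {B₀ B : CType} (k : LeC B₀ B) :
    EEq (cpsV R A :: Γ) (some (cpsC R B))
      (.lapp (coC R (.carr A B₀) (.carr A B)) (.copow (.var 0) .svar))
      (.copow (.var 0) (.lapp (coC R B₀ B) .svar)) (.comp (.copow (cpsV R A) (cpsC R B₀))) := by
  obtain ⟨dk⟩ := k.wtIn R (cpsV R A :: Γ)
  have d₁ := Deriv.copow _ _ _ _ _ _ (.var0 (cpsV R A) Γ) (.lapp _ _ _ _ _ _ dk (.svar _ _))
  have dc := Deriv.copow _ _ _ _ _ _ (.var0 (cpsV R A) Γ) (.svar _ (cpsC R B))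
  have hr : Tm.rename (Tm.liftN Nat.succ) (.copow (.var 0) (.lapp (coC R B₀ B) .svar))
      = .copow (.var 0) (.lapp (coC R B₀ B) .svar) := by
    simp only [Tm.rename, Tm.liftN, (k.wt R).some.rename_closed]
  have b := EEq.copow_beta_var0 d₁ (.svar _ _)
  have d₁' := d₁.rename ((Ren.succ Γ (cpsV R A)).lift _)
  rw [hr] at b d₁'
  rw [Tm.ssubst_svar] at b
  simp only [coC]
  exact (EEq.llam_beta (.copowlet _ _ _ _ _ _ _ (.svar _ _) d₁') dc).trans b

theorem coC_csum_cpair {A₀ A B₀ B : CType} (h : LeC A₀ A) (k : LeC B₀ B) {X Y : Tm}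
    (dX : Deriv Γ Δ X (.comp (cpsC R A))) (dY : Deriv Γ Δ Y (.comp (cpsC R B))) :
    EEq Γ Δ (.lapp (coC R (.csum A₀ B₀) (.csum A B)) (.cpair X Y))
      (.cpair (.lapp (coC R A₀ A) X) (.lapp (coC R B₀ B) Y))
      (.comp (.cand (cpsC R A₀) (cpsC R B₀))) := by
  obtain ⟨dh⟩ := h.wtIn R Γ
  obtain ⟨dk⟩ := k.wtIn R Γ
  simp only [coC]
  have := EEq.llam_beta (.cpair _ _ _ _ _ _
    (.lapp _ _ _ _ _ _ dh (.cfst _ _ _ _ _ (.svar _ _)))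
    (.lapp _ _ _ _ _ _ dk (.csnd _ _ _ _ _ (.svar _ _)))) (.cpair _ _ _ _ _ _ dX dY)
  simp only [Tm.ssubst, dh.ssubst_eq rfl, dk.ssubst_eq rfl] at this
  exact this.trans (.cpair_cong (.ap dh (.cfst_beta dX dY)) (.ap dk (.csnd_beta dX dY)))

theorem coC_csum_app {A₀ A B₀ B : CType} (h : LeC A₀ A) (k : LeC B₀ B) :
    EEq Γ (some (.cand (cpsC R A) (cpsC R B))) (.lapp (coC R (.csum A₀ B₀) (.csum A B)) .svar)
      (.cpair (.lapp (coC R A₀ A) (.cfst .svar)) (.lapp (coC R B₀ B) (.csnd .svar)))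
      (.comp (.cand (cpsC R A₀) (cpsC R B₀))) := by
  obtain ⟨dh⟩ := h.wtIn R Γ
  obtain ⟨dk⟩ := k.wtIn R Γ
  simp only [coC]
  exact EEq.llam_svar (.cpair _ _ _ _ _ _
    (.lapp _ _ _ _ _ _ dh (.cfst _ _ _ _ _ (.svar _ _)))
    (.lapp _ _ _ _ _ _ dk (.csnd _ _ _ _ _ (.svar _ _))))

theorem coC_csum_cfst {A₀ A B₀ B : CType} (h : LeC A₀ A) (k : LeC B₀ B) :
    EEq Γ (some (.cand (cpsC R A) (cpsC R B))) (.lapp (coC R A₀ A) (.cfst .svar))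
      (.cfst (.lapp (coC R (.csum A₀ B₀) (.csum A B)) .svar)) (.comp (cpsC R A₀)) := by
  have b := coC_csum_app (R := R) (Γ := Γ) h k
  obtain ⟨d⟩ := b.wt.2
  cases d with
  | cpair _ _ _ _ _ _ d₁ d₂ => exact ((EEq.cfst_cong b).trans (.cfst_beta d₁ d₂)).symm

theorem coC_csum_csnd {A₀ A B₀ B : CType} (h : LeC A₀ A) (k : LeC B₀ B) :
    EEq Γ (some (.cand (cpsC R A) (cpsC R B))) (.lapp (coC R B₀ B) (.csnd .svar))
      (.csnd (.lapp (coC R (.csum A₀ B₀) (.csum A B)) .svar)) (.comp (cpsC R B₀)) := by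
  have b := coC_csum_app (R := R) (Γ := Γ) h k
  obtain ⟨d⟩ := b.wt.2
  cases d with
  | cpair _ _ _ _ _ _ d₁ d₂ => exact ((EEq.csnd_cong b).trans (.csnd_beta d₁ d₂)).symm

variable {v c : Tm} {A₀ A : VType} {C C₀ : CType}

theorem powCo_app (hv : Nonempty (Deriv [] none v (.arr A₀ A)))
    (hc : Nonempty (Deriv [] none c (.lin C C₀))) {X : Tm}
    (d : Deriv Γ Δ X (.comp (.carr A C))) :
    EEq Γ Δ (.lapp (powCo v c A₀ A C) X)
      (.clam A₀ (.lapp c (.capp (Tm.shift X) (.vapp v (.var 0))))) (.comp (.carr A₀ C₀)) := by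
  have dp := (powCo_wt hv hc).some.weaken_closed Γ
  unfold powCo at dp ⊢
  cases dp with
  | llam _ _ _ _ dp =>
    have := EEq.llam_beta dp d
    simpa only [Tm.ssubst, hv.some.ssubst_eq rfl, hc.some.ssubst_eq rfl] using this

theorem powCo_capp (hv : Nonempty (Deriv [] none v (.arr A₀ A)))
    (hc : Nonempty (Deriv [] none c (.lin C C₀))) {w₀ X : Tm} (dw : Deriv Γ none w₀ A₀)
    (dX : Deriv Γ Δ X (.comp (.carr A C))) :
    EEq Γ Δ (.lapp c (.capp X (.vapp v w₀)))
      (.capp (.lapp (powCo v c A₀ A C) X) w₀) (.comp C₀) := by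
  have h := powCo_app hv hc dX
  have d : Deriv (A₀ :: Γ) Δ (.lapp c (.capp (Tm.shift X) (.vapp v (.var 0)))) (.comp C₀) :=
    .lapp _ _ _ _ _ _ (hc.some.weaken_closed _) (.capp _ _ _ _ _ _ (dX.shift A₀)
      (.vapp _ _ _ _ _ (hv.some.weaken_closed _) (.var0 _ _)))
  have b := EEq.clam_beta d dw
  have hs := Tm.subst0_shift X w₀
  simp only [Tm.subst0_eq] at b hs
  simp only [Tm.psubst, Tm.cons, hv.some.psubst_closed, hc.some.psubst_closed, hs] at b
  exact ((EEq.capp_cong h (.refl dw)).trans b).symm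

end Beta

mutual
  /-- The coercion from a value type to itself is the identity. -/
  theorem coV_self (R : CType) : ∀ (A : VType) {Γ : List VType} {x : Tm},
      Deriv Γ none x (cpsV R A) → EEq Γ none (.vapp (coV R A A) x) x (cpsV R A)
    | .base a, _, _, d => by
      simp only [coV, cpsV] at d ⊢
      exact EEq.vlam_beta (.var0 _ _) d
    | .unit, _, _, d => by
      simp only [coV, cpsV] at d ⊢
      exact EEq.vlam_beta (.var0 _ _) d
    | .prod A B, _, _, d =>
      (coV_prod_app (.refl A) (.refl B) d).trans ((EEq.vpair_cong
        (coV_self R A (.vfst _ _ _ _ d)) (coV_self R B (.vsnd _ _ _ _ d))).trans (.vpair_eta d))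
    | .arr A B, _, _, d =>
      (coV_arr_app A (.refl B) d).trans ((EEq.vlam_cong
        (coV_self R B (.vapp _ _ _ _ _ (d.shift _) (.var0 _ _)))).trans (.vlam_eta d))
    | .comp A, _, _, d => by
      simp only [cpsV] at d ⊢
      exact (coV_comp_app (.refl A) d).trans
        ((EEq.llam_cong (.ap d (coC_self R A))).trans (.llam_eta d))
    | .lin A B, _, _, d => by
      simp only [cpsV] at d ⊢
      exact (coV_lin_app A (.refl B) d).trans
        ((EEq.llam_cong (.ap d (coC_self R B))).trans (.llam_eta d))
  /-- The coercion from a computation type to itself is the identity. -/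
  theorem coC_self (R : CType) : ∀ (A : CType) {Γ : List VType},
      EEq Γ (some (cpsC R A)) (.lapp (coC R A A) .svar) .svar (.comp (cpsC R A))
    | .czero, Γ => by
      simp only [coC, cpsC]
      exact (EEq.llam_svar (.cunit _ _)).trans (EEq.cunit_eta (.svar _ _)).symm
    | .base a, _ => by
      simp only [coC]
      exact EEq.llam_id (.svar _ _)
    | .cunit, _ => by
      simp only [coC]
      exact EEq.llam_id (.svar _ _)
    | .iunit, _ => by
      simp only [coC, cpsC]
      exact EEq.llam_id (.svar _ _)
    | .cand A B, Γ => by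
      have d := Deriv.lapp _ _ _ _ _ _ (((LeC.refl A).cand (.refl B)).wtIn R Γ).some (.svar _ _)
      refine EEq.csum_ext d (.svar _ _) ?_ ?_ <;>
        simp only [Tm.ssubst, (((LeC.refl A).cand (.refl B)).wtIn R Γ).some.ssubst_eq rfl]
      · exact (coC_cand_inl (.refl A) (.refl B)).trans (.cinl_cong (coC_self R A))
      · exact (coC_cand_inr (.refl A) (.refl B)).trans (.cinr_cong (coC_self R B))
    | .carr A B, Γ => by
      have d := Deriv.lapp _ _ _ _ _ _ (((LeC.refl B).carr A).wtIn R Γ).some (.svar _ _)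
      refine EEq.copow_ext d (.svar _ _) ?_
      simp only [Tm.shift, Tm.rename, Tm.ssubst, (((LeC.refl B).carr A).wt R).some.rename_closed,
        (((LeC.refl B).carr A).wtIn R Γ).some.ssubst_eq rfl]
      exact (coC_carr_copow A (.refl B)).trans (.copow_cong (.refl (.var0 _ _)) (coC_self R B))
    | .bang A, Γ => by
      have d := Deriv.svar Γ (cpsC R (.bang A))
      simp only [coC, cpsC] at d ⊢
      refine (powCo_app ((LeV.refl A).wt R) (llam_svar_wt _ _) d).trans
        (EEq.trans (.clam_cong ?_) (.clam_eta d))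
      have dv := coV_self R A (.var0 (cpsV R A) Γ)
      have hc := EEq.capp_cong (.refl (d.shift _)) dv
      exact (EEq.llam_id hc.wt.1.some).trans hc
    | .copow A B, Γ => by
      have d := Deriv.svar Γ (cpsC R (.copow A B))
      simp only [coC, cpsC] at d ⊢
      refine (powCo_app ((LeV.refl A).wt R) ((LeC.refl B).wt R) d).trans
        (EEq.trans (.clam_cong ?_) (.clam_eta d))
      have dv := coV_self R A (.var0 (cpsV R A) Γ)
      have hc := EEq.capp_cong (.refl (d.shift _)) dv
      have := (coC_self R B (Γ := cpsV R A :: Γ)).ssubst hc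
      simpa only [Tm.ssubst, ((LeC.refl B).wt R).some.ssubst_eq rfl] using this
    | .csum A B, Γ => by
      refine (coC_csum_app (.refl A) (.refl B)).trans
        (EEq.trans (.cpair_cong ?_ ?_) (.cpair_eta (.svar _ _)))
      · have := (coC_self R A (Γ := Γ)).ssubst (.refl (.cfst _ _ _ _ (cpsC R B) (.svar _ _)))
        simpa only [Tm.ssubst, ((LeC.refl A).wt R).some.ssubst_eq rfl] using this
      · have := (coC_self R B (Γ := Γ)).ssubst (.refl (.csnd _ _ _ (cpsC R A) _ (.svar _ _)))
        simpa only [Tm.ssubst, ((LeC.refl B).wt R).some.ssubst_eq rfl] using this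
end

mutual
  theorem LeV.trans : ∀ {A B C : VType}, LeV A B → LeV B C → LeV A C
    | _, _, _, .base a, .base _ => .base a
    | _, _, _, .unit, .unit => .unit
    | _, _, _, .prod h k, .prod h' k' => .prod (h.trans h') (k.trans k')
    | _, _, _, .arr A k, .arr _ k' => .arr A (k.trans k')
    | _, _, _, .comp h, .comp h' => .comp (h.trans h')
    | _, _, _, .lin A h, .lin _ h' => .lin A (h.trans h')
  theorem LeC.trans : ∀ {A B C : CType}, LeC A B → LeC B C → LeC A C
    | _, _, _, .czero _, _ => .czero _
    | _, _, _, .base a, .base _ => .base a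
    | _, _, _, .cunit, .cunit => .cunit
    | _, _, _, .cand h k, .cand h' k' => .cand (h.trans h') (k.trans k')
    | _, _, _, .carr A k, .carr _ k' => .carr A (k.trans k')
    | _, _, _, .iunit, .iunit => .iunit
    | _, _, _, .bang h, .bang h' => .bang (h.trans h')
    | _, _, _, .copow h k, .copow h' k' => .copow (h.trans h') (k.trans k')
    | _, _, _, .csum h k, .csum h' k' => .csum (h.trans h') (k.trans k')
end

mutual
  /-- Common approximations of two value types are directed. -/
  theorem LeV.directed : ∀ {A₀ B₀ A B : VType}, LeV A₀ A → LeV A₀ B → LeV B₀ A → LeV B₀ B →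
      ∃ C, LeV A₀ C ∧ LeV B₀ C ∧ LeV C A ∧ LeV C B
    | _, _, _, _, .base a, .base _, .base _, .base _ => ⟨_, .base a, .base a, .base a, .base a⟩
    | _, _, _, _, .unit, .unit, .unit, .unit => ⟨_, .unit, .unit, .unit, .unit⟩
    | _, _, _, _, .prod h₁ k₁, .prod h₂ k₂, .prod h₃ k₃, .prod h₄ k₄ =>
      let ⟨_, a, b, c, d⟩ := LeV.directed h₁ h₂ h₃ h₄
      let ⟨_, a', b', c', d'⟩ := LeV.directed k₁ k₂ k₃ k₄
      ⟨_, .prod a a', .prod b b', .prod c c', .prod d d'⟩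
    | _, _, _, _, .arr A h₁, .arr _ h₂, .arr _ h₃, .arr _ h₄ =>
      let ⟨_, a, b, c, d⟩ := LeV.directed h₁ h₂ h₃ h₄
      ⟨_, .arr A a, .arr A b, .arr A c, .arr A d⟩
    | _, _, _, _, .comp h₁, .comp h₂, .comp h₃, .comp h₄ =>
      let ⟨_, a, b, c, d⟩ := LeC.directed h₁ h₂ h₃ h₄
      ⟨_, .comp a, .comp b, .comp c, .comp d⟩
    | _, _, _, _, .lin A h₁, .lin _ h₂, .lin _ h₃, .lin _ h₄ =>
      let ⟨_, a, b, c, d⟩ := LeC.directed h₁ h₂ h₃ h₄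
      ⟨_, .lin A a, .lin A b, .lin A c, .lin A d⟩
  /-- Common approximations of two computation types are directed. -/
  theorem LeC.directed : ∀ {A₀ B₀ A B : CType}, LeC A₀ A → LeC A₀ B → LeC B₀ A → LeC B₀ B →
      ∃ C, LeC A₀ C ∧ LeC B₀ C ∧ LeC C A ∧ LeC C B
    | _, B₀, _, _, .czero _, _, h₃, h₄ => ⟨B₀, .czero _, .refl _, h₃, h₄⟩
    | A₀, _, _, _, h₁, h₂, .czero _, _ => ⟨A₀, .refl _, .czero _, h₁, h₂⟩
    | _, _, _, _, .base a, .base _, .base _, .base _ => ⟨_, .base a, .base a, .base a, .base a⟩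
    | _, _, _, _, .cunit, .cunit, .cunit, .cunit => ⟨_, .cunit, .cunit, .cunit, .cunit⟩
    | _, _, _, _, .cand h₁ k₁, .cand h₂ k₂, .cand h₃ k₃, .cand h₄ k₄ =>
      let ⟨_, a, b, c, d⟩ := LeC.directed h₁ h₂ h₃ h₄
      let ⟨_, a', b', c', d'⟩ := LeC.directed k₁ k₂ k₃ k₄
      ⟨_, .cand a a', .cand b b', .cand c c', .cand d d'⟩
    | _, _, _, _, .carr A h₁, .carr _ h₂, .carr _ h₃, .carr _ h₄ =>
      let ⟨_, a, b, c, d⟩ := LeC.directed h₁ h₂ h₃ h₄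
      ⟨_, .carr A a, .carr A b, .carr A c, .carr A d⟩
    | _, _, _, _, .iunit, .iunit, .iunit, .iunit => ⟨_, .iunit, .iunit, .iunit, .iunit⟩
    | _, _, _, _, .bang h₁, .bang h₂, .bang h₃, .bang h₄ =>
      let ⟨_, a, b, c, d⟩ := LeV.directed h₁ h₂ h₃ h₄
      ⟨_, .bang a, .bang b, .bang c, .bang d⟩
    | _, _, _, _, .copow h₁ k₁, .copow h₂ k₂, .copow h₃ k₃, .copow h₄ k₄ =>
      let ⟨_, a, b, c, d⟩ := LeV.directed h₁ h₂ h₃ h₄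
      let ⟨_, a', b', c', d'⟩ := LeC.directed k₁ k₂ k₃ k₄
      ⟨_, .copow a a', .copow b b', .copow c c', .copow d d'⟩
    | _, _, _, _, .csum h₁ k₁, .csum h₂ k₂, .csum h₃ k₃, .csum h₄ k₄ =>
      let ⟨_, a, b, c, d⟩ := LeC.directed h₁ h₂ h₃ h₄
      let ⟨_, a', b', c', d'⟩ := LeC.directed k₁ k₂ k₃ k₄
      ⟨_, .csum a a', .csum b b', .csum c c', .csum d d'⟩
end

/-- Linear coercions compose on arbitrary arguments once they compose on the stoup variable. -/
theorem EEq.comp_app {Γ : List VType} {Δ : Option CType} {f g h X : Tm} {A B C : CType}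
    (k : EEq Γ (some A) (.lapp f (.lapp g .svar)) (.lapp h .svar) (.comp C))
    (df : Nonempty (Deriv Γ none f (.lin B C))) (dg : Nonempty (Deriv Γ none g (.lin A B)))
    (dh : Nonempty (Deriv Γ none h (.lin A C))) (dX : Deriv Γ Δ X (.comp A)) :
    EEq Γ Δ (.lapp f (.lapp g X)) (.lapp h X) (.comp C) := by
  have := k.ssubst (EEq.refl dX)
  simpa only [Tm.ssubst, df.some.ssubst_eq rfl, dg.some.ssubst_eq rfl,
    dh.some.ssubst_eq rfl] using this

theorem powCo_comp {Γ : List VType} {v v' v'' c c' c'' : Tm} {A B D : VType} {C C' C'' : CType}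
    (hv : Nonempty (Deriv [] none v (.arr A B))) (hv' : Nonempty (Deriv [] none v' (.arr B D)))
    (hv'' : Nonempty (Deriv [] none v'' (.arr A D)))
    (hc : Nonempty (Deriv [] none c (.lin C' C))) (hc' : Nonempty (Deriv [] none c' (.lin C'' C')))
    (hc'' : Nonempty (Deriv [] none c'' (.lin C'' C)))
    (kv : EEq (A :: Γ) none (.vapp v' (.vapp v (.var 0))) (.vapp v'' (.var 0)) D)
    (kc : EEq (A :: Γ) (some C'') (.lapp c (.lapp c' .svar)) (.lapp c'' .svar) (.comp C)) :
    EEq Γ (some (.carr D C'')) (.lapp (powCo v c A B C') (.lapp (powCo v' c' B D C'') .svar))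
      (.lapp (powCo v'' c'' A D C'') .svar) (.comp (.carr A C)) := by
  have wk : ∀ {t : Tm} {T : VType} (Γ : List VType), Nonempty (Deriv [] none t T) →
      Nonempty (Deriv Γ none t T) := fun Γ h => ⟨h.some.weaken_closed Γ⟩
  have hp := powCo_wt hv' hc'
  refine (powCo_app hv hc (.lapp _ _ _ _ _ _ (wk Γ hp).some (.svar _ _))).trans
    (EEq.trans (.clam_cong ?_) (powCo_app hv'' hc'' (.svar _ _)).symm)
  have hs : Tm.shift (.lapp (powCo v' c' B D C'') .svar) = .lapp (powCo v' c' B D C'') .svar := by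
    simp only [Tm.shift, Tm.rename, hp.some.rename_closed]
  have dv := Deriv.vapp _ _ _ _ _ (wk (A :: Γ) hv).some (.var0 A Γ)
  rw [hs]
  have kv' := EEq.capp_cong (.svar (A := .carr D C'')) kv
  exact (EEq.ap (wk _ hc).some ((powCo_capp hv' hc' dv (.svar _ _)).symm.trans
    (EEq.ap (wk _ hc').some kv'))).trans
      (kc.comp_app (wk _ hc) (wk _ hc') (wk _ hc'') kv'.wt.2.some)

mutual
  /-- Value coercions compose. -/
  theorem coV_comp (R : CType) : ∀ {A B C : VType} (_ : LeV A B) (_ : LeV B C)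
      {Γ : List VType} {x : Tm}, Deriv Γ none x (cpsV R A) →
      EEq Γ none (.vapp (coV R B C) (.vapp (coV R A B) x)) (.vapp (coV R A C) x) (cpsV R C)
    | _, _, _, .base a, .base _, _, _, d =>
      coV_self R (.base a) (.vapp _ _ _ _ _ ((LeV.base a).wtIn R _).some d)
    | _, _, _, .unit, .unit, _, _, d =>
      coV_self R .unit (.vapp _ _ _ _ _ (LeV.unit.wtIn R _).some d)
    | _, _, _, .prod h k, .prod h' k', _, _, d => by
      have b := coV_prod_app h k d
      refine (EEq.vapp_cong (.refl ((h'.prod k').wtIn R _).some) b).trans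
        ((coV_prod_app h' k' b.wt.2.some).trans
          (EEq.trans (.vpair_cong ?_ ?_) (coV_prod_app (h.trans h') (k.trans k') d).symm))
      · have d₁ := Deriv.vapp _ _ _ _ _ (h.wtIn R _).some (.vfst _ _ _ _ d)
        have d₂ := Deriv.vapp _ _ _ _ _ (k.wtIn R _).some (.vsnd _ _ _ _ d)
        exact (EEq.vapp_cong (.refl (h'.wtIn R _).some) (.vfst_beta d₁ d₂)).trans
          (coV_comp R h h' (.vfst _ _ _ _ d))
      · have d₁ := Deriv.vapp _ _ _ _ _ (h.wtIn R _).some (.vfst _ _ _ _ d)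
        have d₂ := Deriv.vapp _ _ _ _ _ (k.wtIn R _).some (.vsnd _ _ _ _ d)
        exact (EEq.vapp_cong (.refl (k'.wtIn R _).some) (.vsnd_beta d₁ d₂)).trans
          (coV_comp R k k' (.vsnd _ _ _ _ d))
    | _, _, _, .arr A k, .arr _ k', Γ, x, d => by
      have b := coV_arr_app A k d
      refine (EEq.vapp_cong (.refl ((k'.arr A).wtIn R _).some) b).trans
        ((coV_arr_app A k' b.wt.2.some).trans
          (EEq.trans (.vlam_cong ?_) (coV_arr_app A (k.trans k') d).symm))
      have d₁ := Deriv.vapp _ _ _ _ _ (d.shift (cpsV R A)) (.var0 _ _)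
      have d₂ := Deriv.vapp _ _ _ _ _ (k.wtIn R _).some d₁
      have b₂ := EEq.vlam_beta (d₂.rename ((Ren.succ Γ (cpsV R A)).lift _)) (.var0 _ _)
      rw [subst0_var0_rename_liftN_succ] at b₂
      exact (EEq.vapp_cong (.refl (k'.wtIn R _).some) b₂).trans (coV_comp R k k' d₁)
    | _, _, _, .comp h, .comp h', _, x, d => by
      simp only [cpsV] at d ⊢
      have b := coV_comp_app h d
      refine (EEq.vapp_cong (.refl ((LeV.comp h').wtIn R _).some) b).trans
        ((coV_comp_app h' b.wt.2.some).trans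
          (EEq.trans (.llam_cong ?_) (coV_comp_app (h.trans h') d).symm))
      have b₂ := EEq.llam_beta (.lapp _ _ _ _ _ _ d (.lapp _ _ _ _ _ _ (h.wtIn R _).some
        (.svar _ _))) (.lapp _ _ _ _ _ _ (h'.wtIn R _).some (.svar _ _))
      simp only [Tm.ssubst, d.ssubst_eq rfl, (h.wt R).some.ssubst_eq rfl] at b₂
      exact b₂.trans (.ap d (coC_comp R h h'))
    | _, _, _, .lin A h, .lin _ h', _, x, d => by
      simp only [cpsV] at d ⊢
      have b := coV_lin_app A h d
      refine (EEq.vapp_cong (.refl ((LeV.lin A h').wtIn R _).some) b).trans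
        ((coV_lin_app A h' b.wt.2.some).trans
          (EEq.trans (.llam_cong ?_) (coV_lin_app A (h.trans h') d).symm))
      have b₂ := EEq.llam_beta (.lapp _ _ _ _ _ _ d (.lapp _ _ _ _ _ _ (h.wtIn R _).some
        (.svar _ _))) (.lapp _ _ _ _ _ _ (h'.wtIn R _).some (.svar _ _))
      simp only [Tm.ssubst, d.ssubst_eq rfl, (h.wt R).some.ssubst_eq rfl] at b₂
      exact b₂.trans (.ap d (coC_comp R h h'))
  /-- Linear coercions compose. -/
  theorem coC_comp (R : CType) : ∀ {A B C : CType} (_ : LeC A B) (_ : LeC B C) {Γ : List VType},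
      EEq Γ (some (cpsC R C)) (.lapp (coC R A B) (.lapp (coC R B C) .svar))
        (.lapp (coC R A C) .svar) (.comp (cpsC R A))
    | _, _, _, .czero B, k, Γ => by
      have d₁ := Deriv.lapp _ _ _ _ _ _ (k.wtIn R Γ).some (.svar _ _)
      have d₂ := Deriv.lapp _ _ _ _ _ _ ((LeC.czero B).wtIn R Γ).some d₁
      exact (EEq.cunit_eta d₂).trans
        (EEq.cunit_eta (.lapp _ _ _ _ _ _ ((LeC.czero _).wtIn R Γ).some (.svar _ _))).symm
    | _, _, _, .base a, .base _, Γ => .ap ((LeC.base a).wtIn R Γ).some (coC_self R (.base a))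
    | _, _, _, .cunit, .cunit, Γ => .ap (LeC.cunit.wtIn R Γ).some (coC_self R .cunit)
    | _, _, _, .iunit, .iunit, Γ => .ap (LeC.iunit.wtIn R Γ).some (coC_self R .iunit)
    | _, _, _, .cand h k, .cand h' k', Γ => by
      have dh := ((h.cand k).wtIn R Γ).some
      have dh' := ((h'.cand k').wtIn R Γ).some
      have dh'' := (((h.trans h').cand (k.trans k')).wtIn R Γ).some
      refine EEq.csum_ext (.lapp _ _ _ _ _ _ dh (.lapp _ _ _ _ _ _ dh' (.svar _ _)))
        (.lapp _ _ _ _ _ _ dh'' (.svar _ _)) ?_ ?_ <;>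
        simp only [Tm.ssubst, dh.ssubst_eq rfl, dh'.ssubst_eq rfl, dh''.ssubst_eq rfl]
      · have b := (coC_cand_inl h k (R := R)).ssubst (EEq.refl (.lapp _ _ _ _ _ _
          (h'.wtIn R Γ).some (.svar _ _)))
        simp only [Tm.ssubst, dh.ssubst_eq rfl, (h.wt R).some.ssubst_eq rfl] at b
        exact (EEq.ap dh (coC_cand_inl h' k')).trans (b.trans ((EEq.cinl_cong
          (coC_comp R h h')).trans (coC_cand_inl (h.trans h') (k.trans k')).symm))
      · have b := (coC_cand_inr h k (R := R)).ssubst (EEq.refl (.lapp _ _ _ _ _ _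
          (k'.wtIn R Γ).some (.svar _ _)))
        simp only [Tm.ssubst, dh.ssubst_eq rfl, (k.wt R).some.ssubst_eq rfl] at b
        exact (EEq.ap dh (coC_cand_inr h' k')).trans (b.trans ((EEq.cinr_cong
          (coC_comp R k k')).trans (coC_cand_inr (h.trans h') (k.trans k')).symm))
    | _, _, _, .carr A k, .carr _ k', Γ => by
      have dh := ((k.carr A).wtIn R Γ).some
      have dh' := ((k'.carr A).wtIn R Γ).some
      have dh'' := (((k.trans k').carr A).wtIn R Γ).some
      refine EEq.copow_ext (.lapp _ _ _ _ _ _ dh (.lapp _ _ _ _ _ _ dh' (.svar _ _)))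
        (.lapp _ _ _ _ _ _ dh'' (.svar _ _)) ?_
      simp only [Tm.shift, Tm.rename, Tm.ssubst, dh.ssubst_eq rfl, dh'.ssubst_eq rfl,
        dh''.ssubst_eq rfl, ((k.carr A).wt R).some.rename_closed,
        ((k'.carr A).wt R).some.rename_closed, (((k.trans k').carr A).wt R).some.rename_closed]
      have b := (coC_carr_copow A k (R := R)).ssubst (EEq.refl (.lapp _ _ _ _ _ _
        (k'.wtIn R (cpsV R A :: Γ)).some (.svar _ _)))
      simp only [Tm.ssubst, dh.ssubst_eq rfl, (k.wt R).some.ssubst_eq rfl] at b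
      exact (EEq.ap ((k.carr A).wtIn R _).some (coC_carr_copow A k')).trans
        (b.trans ((EEq.copow_cong (.refl (.var0 _ _)) (coC_comp R k k')).trans
          (coC_carr_copow A (k.trans k')).symm))
    | _, _, _, .bang h, .bang h', Γ => by
      simp only [coC, cpsC]
      exact powCo_comp (h.wt R) (h'.wt R) ((h.trans h').wt R) (llam_svar_wt _ _)
        (llam_svar_wt _ _) (llam_svar_wt _ _) (coV_comp R h h' (.var0 _ _))
        (.llam_id (.lapp _ _ _ _ _ _ (llam_svar_wt _ _).some (.svar _ _)))
    | _, _, _, .copow h k, .copow h' k', Γ => by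
      simp only [coC, cpsC]
      exact powCo_comp (h.wt R) (h'.wt R) ((h.trans h').wt R) (k.wt R) (k'.wt R)
        ((k.trans k').wt R) (coV_comp R h h' (.var0 _ _)) (coC_comp R k k')
    | _, _, .csum A B, .csum h k, .csum h' k', Γ => by
      have b := coC_csum_app (R := R) (Γ := Γ) h' k'
      have d₁ := Deriv.cfst _ _ _ _ _ (.svar Γ (.cand (cpsC R A) (cpsC R B)))
      have d₂ := Deriv.csnd _ _ _ _ _ (.svar Γ (.cand (cpsC R A) (cpsC R B)))
      refine (EEq.ap ((h.csum k).wtIn R Γ).some b).trans ((coC_csum_cpair h k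
        (.lapp _ _ _ _ _ _ (h'.wtIn R Γ).some d₁) (.lapp _ _ _ _ _ _ (k'.wtIn R Γ).some d₂)).trans
          (EEq.trans (.cpair_cong ?_ ?_) (coC_csum_app (h.trans h') (k.trans k')).symm))
      · exact (coC_comp R h h').comp_app (h.wtIn R Γ) (h'.wtIn R Γ) ((h.trans h').wtIn R Γ) d₁
      · exact (coC_comp R k k').comp_app (k.wtIn R Γ) (k'.wtIn R Γ) ((k.trans k').wtIn R Γ) d₂
end

/-! ### The approximation relations -/

/-- Approximation of stoups. -/
inductive LeS : Option CType → Option CType → Prop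
  | empty : LeS none none
  | stoup {A₀ A : CType} : LeC A₀ A → LeS (some A₀) (some A)

/-- The linear coercion between the translations of stoups. -/
def coS (R : CType) : Option CType → Option CType → Tm
  | some A₀, some A => coC R A₀ A
  | _, _ => .llam R .svar

theorem LeS.wt (R : CType) {Δ₀ Δ : Option CType} (h : LeS Δ₀ Δ) :
    Nonempty (Deriv [] none (coS R Δ₀ Δ) (.lin (stoupC R Δ) (stoupC R Δ₀))) := by
  cases h with
  | empty => exact llam_svar_wt _ _
  | stoup h => exact h.wt R

theorem LeS.wtIn (R : CType) {Δ₀ Δ : Option CType} (h : LeS Δ₀ Δ) (Γ : List VType) :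
    Nonempty (Deriv Γ none (coS R Δ₀ Δ) (.lin (stoupC R Δ) (stoupC R Δ₀))) :=
  ⟨(h.wt R).some.weaken_closed Γ⟩

/-- The value `s₀` at the translation of `A₀` approximates `s` at the translation of `A`. -/
def ApproxV (R : CType) (Γ : List VType) (A₀ A : VType) (s₀ s : Tm) : Prop :=
  LeV A₀ A ∧ Nonempty (Deriv Γ none s₀ (cpsV R A₀)) ∧
    EEq Γ none s (.vapp (coV R A₀ A) s₀) (cpsV R A)

/-- The linear map `s₀` out of the translation of `B₀` approximates `s` out of the translation
of `B`. -/
def ApproxC (R : CType) (Γ : List VType) (Δ₀ Δ : Option CType) (B₀ B : CType) (s₀ s : Tm) : Prop :=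
  LeC B₀ B ∧ Sq Γ (cpsC R B) (stoupC R Δ) (cpsC R B₀) (stoupC R Δ₀) (coS R Δ₀ Δ) s s₀ (coC R B₀ B)

/-- Values with a common approximation. -/
def RelV (R : CType) (Γ : List VType) (A₁ A₂ : VType) (s₁ s₂ : Tm) : Prop :=
  ∃ A₀ s₀, ApproxV R Γ A₀ A₁ s₀ s₁ ∧ ApproxV R Γ A₀ A₂ s₀ s₂

/-- Linear maps with a common approximation. -/
def RelC (R : CType) (Γ : List VType) (Δ₀ Δ₁ Δ₂ : Option CType) (B₁ B₂ : CType) (s₁ s₂ : Tm) :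
    Prop :=
  ∃ B₀ s₀, ApproxC R Γ Δ₀ Δ₁ B₀ B₁ s₀ s₁ ∧ ApproxC R Γ Δ₀ Δ₂ B₀ B₂ s₀ s₂

section Approx

variable {R : CType} {Γ : List VType} {Δ₀ Δ : Option CType} {s₀ s : Tm}

theorem ApproxV.shift {A₀ A : VType} (h : ApproxV R Γ A₀ A s₀ s) (C : VType) :
    ApproxV R (C :: Γ) A₀ A (Tm.shift s₀) (Tm.shift s) := by
  refine ⟨h.1, ⟨h.2.1.some.shift C⟩, ?_⟩
  have := h.2.2.shift C
  simpa only [Tm.shift, Tm.rename, (h.1.wt R).some.rename_closed] using this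

theorem ApproxV.toC {B₀ B : CType} (h : ApproxV R Γ (.comp B₀) (.comp B) s₀ s) :
    ApproxC R Γ none none B₀ B s₀ s := by
  obtain ⟨l, ⟨d⟩, k⟩ := h
  cases l with
  | comp l =>
    simp only [cpsV] at d k
    have k' := k.trans (coV_comp_app l d)
    have dB := Deriv.lapp _ _ _ _ _ _ (l.wtIn R Γ).some (.svar _ _)
    have hs := (EEq.lapp_cong k' .svar).trans (EEq.llam_svar (.lapp _ _ _ _ _ _ d dB))
    exact ⟨l, llam_svar_wt _ _, k.wt.1, ⟨d⟩, l.wtIn R Γ, (EEq.llam_id hs.wt.1.some).trans hs⟩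

theorem ApproxC.toV {B₀ B : CType} (h : ApproxC R Γ none none B₀ B s₀ s) :
    ApproxV R Γ (.comp B₀) (.comp B) s₀ s := by
  obtain ⟨l, -, ⟨ds⟩, ⟨d⟩, -, k⟩ := h
  have k' := (EEq.llam_id (.lapp _ _ _ _ _ _ ds (.svar _ _))).symm.trans k
  exact ⟨.comp l, ⟨d⟩, (EEq.llam_eta ds).symm.trans
    ((EEq.llam_cong k').trans (coV_comp_app l d).symm)⟩

/-- Raising the type of an approximation. -/
theorem ApproxC.raise {B₀ B C : CType} (h : ApproxC R Γ Δ₀ Δ B₀ B s₀ s) (l : LeC B₀ C)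
    (k : LeC C B) :
    ApproxC R Γ Δ₀ Δ C B (.llam (cpsC R C) (.lapp s₀ (.lapp (coC R B₀ C) .svar))) s := by
  obtain ⟨-, ⟨de⟩, ⟨ds⟩, ⟨d⟩, ⟨dc⟩, q⟩ := h
  have dl := (l.wtIn R Γ).some
  have dk := (k.wtIn R Γ).some
  have d₀ := Deriv.lapp _ _ _ _ _ _ d (.lapp _ _ _ _ _ _ dl (.svar _ _))
  refine ⟨k, ⟨de⟩, ⟨ds⟩, ⟨.llam _ _ _ _ d₀⟩, ⟨dk⟩, q.trans ?_⟩
  have b := EEq.llam_beta d₀ (.lapp _ _ _ _ _ _ dk (.svar _ _))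
  simp only [Tm.ssubst, d.ssubst_eq rfl, dl.ssubst_eq rfl] at b
  exact (EEq.ap d (coC_comp R l k)).symm.trans b.symm

theorem ApproxC.precomp {B₀ B C₀ C : CType} {X X₀ : Tm} (h : ApproxC R Γ Δ₀ Δ C₀ C s₀ s)
    (l : LeC B₀ B) (dX₀ : Deriv Γ (some (cpsC R B₀)) X₀ (.comp (cpsC R C₀)))
    (k : EEq Γ (some (cpsC R B)) (.lapp (coC R C₀ C) X)
      (Tm.ssubst (.lapp (coC R B₀ B) .svar) X₀) (.comp (cpsC R C₀)))
    (dX : Deriv Γ (some (cpsC R B)) X (.comp (cpsC R C))) :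
    ApproxC R Γ Δ₀ Δ B₀ B (.llam (cpsC R B₀) (.lapp s₀ X₀)) (.llam (cpsC R B) (.lapp s X)) :=
  ⟨l, h.2.precomp dX dX₀ (l.wtIn R Γ).some k⟩

/-- Approximations at the initial type are stable under arbitrary precomposition. -/
theorem ApproxC.bot {B C : CType} {X : Tm} (h : ApproxC R Γ Δ₀ Δ .czero C s₀ s)
    (dX : Deriv Γ (some (cpsC R B)) X (.comp (cpsC R C))) :
    ApproxC R Γ Δ₀ Δ .czero B (.llam .cunit (.lapp s₀ .svar)) (.llam (cpsC R B) (.lapp s X)) :=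
  h.precomp (.czero B) (.svar _ _)
    ((EEq.cunit_eta (.lapp _ _ _ _ _ _ ((LeC.czero C).wtIn R Γ).some dX)).trans
      (EEq.cunit_eta (.lapp _ _ _ _ _ _ ((LeC.czero B).wtIn R Γ).some (.svar _ _))).symm) dX

theorem ApproxC.cfst {A₀ A B₀ B : CType}
    (h : ApproxC R Γ Δ₀ Δ (.cand A₀ B₀) (.cand A B) s₀ s) :
    ApproxC R Γ Δ₀ Δ A₀ A (.llam (cpsC R A₀) (.lapp s₀ (.cinl .svar)))
      (.llam (cpsC R A) (.lapp s (.cinl .svar))) := by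
  have l := h.1
  cases l with
  | cand l m =>
    exact h.precomp l (.cinl _ _ _ _ _ (.svar _ _)) (coC_cand_inl l m)
      (.cinl _ _ _ _ _ (.svar _ _))

theorem ApproxC.csnd {A₀ A B₀ B : CType}
    (h : ApproxC R Γ Δ₀ Δ (.cand A₀ B₀) (.cand A B) s₀ s) :
    ApproxC R Γ Δ₀ Δ B₀ B (.llam (cpsC R B₀) (.lapp s₀ (.cinr .svar)))
      (.llam (cpsC R B) (.lapp s (.cinr .svar))) := by
  have l := h.1
  cases l with
  | cand l m =>
    exact h.precomp m (.cinr _ _ _ _ _ (.svar _ _)) (coC_cand_inr l m)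
      (.cinr _ _ _ _ _ (.svar _ _))

theorem ApproxC.cpair {A₀ A B₀ B : CType} {r₀ r : Tm} (h : ApproxC R Γ Δ₀ Δ A₀ A s₀ s)
    (k : ApproxC R Γ Δ₀ Δ B₀ B r₀ r) :
    ApproxC R Γ Δ₀ Δ (.cand A₀ B₀) (.cand A B)
      (.llam (.csum (cpsC R A₀) (cpsC R B₀)) (.ccase .svar (.lapp s₀ .svar) (.lapp r₀ .svar)))
      (.llam (.csum (cpsC R A) (cpsC R B)) (.ccase .svar (.lapp s .svar) (.lapp r .svar))) :=
  ⟨h.1.cand k.1, h.2.csum k.2 ((h.1.cand k.1).wtIn R Γ).some (coC_cand_inl h.1 k.1)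
    (coC_cand_inr h.1 k.1)⟩

theorem ApproxC.clam {A : VType} {B₀ B : CType} (hs : LeS Δ₀ Δ)
    (h : ApproxC R (cpsV R A :: Γ) Δ₀ Δ B₀ B s₀ s) :
    ApproxC R Γ Δ₀ Δ (.carr A B₀) (.carr A B)
      (.llam (.copow (cpsV R A) (cpsC R B₀)) (.copowlet .svar (.lapp s₀ .svar)))
      (.llam (.copow (cpsV R A) (cpsC R B)) (.copowlet .svar (.lapp s .svar))) := by
  refine ⟨h.1.carr A, Sq.copow (c' := coC R B₀ B) ?_ (hs.wtIn R Γ).some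
    ((h.1.carr A).wtIn R Γ).some ?_⟩
  · rw [(hs.wt R).some.shift_closed]
    exact h.2
  · rw [((h.1.carr A).wt R).some.shift_closed]
    exact coC_carr_copow A h.1

theorem ApproxC.capp {A : VType} {B₀ B : CType} {x₀ x : Tm}
    (h : ApproxC R Γ Δ₀ Δ (.carr A B₀) (.carr A B) s₀ s)
    (k : EEq Γ none x x₀ (cpsV R A)) :
    ApproxC R Γ Δ₀ Δ B₀ B (.llam (cpsC R B₀) (.lapp s₀ (.copow x₀ .svar)))
      (.llam (cpsC R B) (.lapp s (.copow x .svar))) := by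
  have l := h.1
  cases l with
  | carr _ l =>
    refine h.precomp l (.copow _ _ _ _ _ _ k.wt.2.some (.svar _ _)) ?_
      (.copow _ _ _ _ _ _ k.wt.1.some (.svar _ _))
    have dl := (l.wtIn R (cpsV R A :: Γ)).some
    have d := (((l.carr A).wtIn R Γ).some)
    have c := EEq.llam_beta (.copowlet _ _ _ _ _ _ _ (.svar _ _)
      ((Deriv.copow _ _ _ _ _ _ (.var0 (cpsV R A) _)
        (.lapp _ _ _ _ _ _ dl (.svar _ _))))) (.copow _ _ _ _ _ _ k.wt.1.some (.svar Γ (cpsC R B)))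
    have b := EEq.copow_beta k.wt.1.some (.svar Γ (cpsC R B))
      (Deriv.copow _ _ _ _ _ _ (.var0 (cpsV R A) _) (.lapp _ _ _ _ _ _ dl (.svar _ _)))
    simp only [Tm.subst0_eq, Tm.psubst, Tm.cons, (l.wt R).some.psubst_closed, Tm.ssubst,
      k.wt.1.some.ssubst_eq rfl, (l.wt R).some.ssubst_eq rfl] at b
    simp only [Tm.ssubst, k.wt.2.some.ssubst_eq rfl]
    simp only [coC]
    exact c.trans (b.trans (.copow_cong k (.refl (.lapp _ _ _ _ _ _ (l.wtIn R Γ).some (.svar _ _)))))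

theorem ApproxC.ilet {A₀ A : CType} {r₀ r : Tm} (h : ApproxC R Γ Δ₀ Δ .iunit .iunit s₀ s)
    (k : ApproxC R Γ none none A₀ A r₀ r) :
    ApproxC R Γ Δ₀ Δ A₀ A (.llam (cpsC R A₀) (.lapp s₀ (.lapp r₀ .svar)))
      (.llam (cpsC R A) (.lapp s (.lapp r .svar))) := by
  obtain ⟨l, -, ⟨dr⟩, ⟨dr₀⟩, -, q⟩ := k
  refine h.precomp l (.lapp _ _ _ _ _ _ dr₀ (.svar _ _)) ?_ (.lapp _ _ _ _ _ _ dr (.svar _ _))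
  simp only [Tm.ssubst, dr₀.ssubst_eq rfl, coC]
  exact q

theorem ApproxV.bang {A₀ A : VType} (h : ApproxV R Γ A₀ A s₀ s) :
    ApproxC R Γ none none (.bang A₀) (.bang A) (.llam (.carr (cpsV R A₀) R) (.capp .svar s₀))
      (.llam (.carr (cpsV R A) R) (.capp .svar s)) := by
  obtain ⟨l, ⟨d₀⟩, k⟩ := h
  have l' := (LeC.bang l).wtIn R Γ
  have d₁ := Deriv.capp _ _ _ _ _ _ (.svar Γ (.carr (cpsV R A₀) R)) d₀
  have d := Deriv.capp _ _ _ _ _ _ (.svar Γ (.carr (cpsV R A) R)) k.wt.1.some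
  refine ⟨.bang l, llam_svar_wt _ _, ⟨.llam _ _ _ _ d⟩, ⟨.llam _ _ _ _ d₁⟩, l', ?_⟩
  have b := EEq.llam_beta d₁ (.lapp _ _ _ _ _ _ l'.some (.svar _ _))
  simp only [Tm.ssubst, d₀.ssubst_eq rfl] at b
  refine (EEq.ap (llam_svar_wt _ _).some ((EEq.llam_svar d).trans (.capp_cong .svar k))).trans
    (EEq.trans ?_ b.symm)
  simp only [coC]
  exact powCo_capp (l.wt R) (llam_svar_wt _ _) d₀ (.svar _ _)

theorem ApproxC.copow {A₀ A : VType} {B₀ B : CType} {r₀ r : Tm} (h : ApproxV R Γ A₀ A r₀ r)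
    (k : ApproxC R Γ Δ₀ Δ B₀ B s₀ s) :
    ApproxC R Γ Δ₀ Δ (.copow A₀ B₀) (.copow A B)
      (.llam (.carr (cpsV R A₀) (cpsC R B₀)) (.lapp s₀ (.capp .svar r₀)))
      (.llam (.carr (cpsV R A) (cpsC R B)) (.lapp s (.capp .svar r))) := by
  obtain ⟨l, ⟨d₀⟩, q⟩ := h
  refine k.precomp (.copow l k.1) (.capp _ _ _ _ _ _ (.svar _ _) d₀) ?_
    (.capp _ _ _ _ _ _ (.svar _ _) q.wt.1.some)
  refine (EEq.ap (k.1.wtIn R Γ).some (.capp_cong .svar q)).trans ?_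
  simp only [Tm.ssubst, d₀.ssubst_eq rfl, coC]
  exact powCo_capp (l.wt R) (k.1.wt R) d₀ (.svar _ _)

theorem ApproxC.cinl {A₀ A B₀ B : CType} (h : ApproxC R Γ Δ₀ Δ A₀ A s₀ s) (k : LeC B₀ B) :
    ApproxC R Γ Δ₀ Δ (.csum A₀ B₀) (.csum A B)
      (.llam (.cand (cpsC R A₀) (cpsC R B₀)) (.lapp s₀ (.cfst .svar)))
      (.llam (.cand (cpsC R A) (cpsC R B)) (.lapp s (.cfst .svar))) :=
  h.precomp (h.1.csum k) (.cfst _ _ _ _ _ (.svar _ _)) (coC_csum_cfst h.1 k)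
    (.cfst _ _ _ _ _ (.svar _ _))

theorem ApproxC.cinr {A₀ A B₀ B : CType} (h : LeC A₀ A) (k : ApproxC R Γ Δ₀ Δ B₀ B s₀ s) :
    ApproxC R Γ Δ₀ Δ (.csum A₀ B₀) (.csum A B)
      (.llam (.cand (cpsC R A₀) (cpsC R B₀)) (.lapp s₀ (.csnd .svar)))
      (.llam (.cand (cpsC R A) (cpsC R B)) (.lapp s (.csnd .svar))) :=
  k.precomp (h.csum k.1) (.csnd _ _ _ _ _ (.svar _ _)) (coC_csum_csnd h k.1)
    (.csnd _ _ _ _ _ (.svar _ _))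

theorem ApproxC.ccase {A₀ A B₀ B C₀ C : CType} {r₀ r u₀ u : Tm}
    (h : ApproxC R Γ Δ₀ Δ (.csum A₀ B₀) (.csum A B) s₀ s)
    (k : ApproxC R Γ (some A₀) (some A) C₀ C r₀ r) (m : ApproxC R Γ (some B₀) (some B) C₀ C u₀ u) :
    ApproxC R Γ Δ₀ Δ C₀ C
      (.llam (cpsC R C₀) (.lapp s₀ (.cpair (.lapp r₀ .svar) (.lapp u₀ .svar))))
      (.llam (cpsC R C) (.lapp s (.cpair (.lapp r .svar) (.lapp u .svar)))) := by
  have l := h.1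
  cases l with
  | csum l l' =>
    obtain ⟨lC, -, ⟨dr⟩, ⟨dr₀⟩, -, q⟩ := k
    obtain ⟨-, -, ⟨du⟩, ⟨du₀⟩, -, p⟩ := m
    have dr := Deriv.lapp _ _ _ _ _ _ dr (.svar _ _)
    have du := Deriv.lapp _ _ _ _ _ _ du (.svar _ _)
    refine h.precomp lC (.cpair _ _ _ _ _ _ (.lapp _ _ _ _ _ _ dr₀ (.svar _ _))
      (.lapp _ _ _ _ _ _ du₀ (.svar _ _))) ?_ (.cpair _ _ _ _ _ _ dr du)
    simp only [Tm.ssubst, dr₀.ssubst_eq rfl, du₀.ssubst_eq rfl]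
    exact (coC_csum_cpair l l' dr du).trans (.cpair_cong q p)

theorem ApproxC.lapp {A A₀ B₀ B : CType} {r₀ r : Tm} (h : ApproxV R Γ (.lin A B₀) (.lin A B) r₀ r)
    (k : ApproxC R Γ Δ₀ Δ A₀ A s₀ s) :
    ApproxC R Γ Δ₀ Δ B₀ B
      (.llam (cpsC R B₀) (.lapp s₀ (.lapp (coC R A₀ A) (.lapp r₀ .svar))))
      (.llam (cpsC R B) (.lapp s (.lapp r .svar))) := by
  obtain ⟨l, ⟨d₀⟩, q⟩ := h
  cases l with
  | lin _ l =>
    simp only [cpsV] at d₀ q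
    have q' := q.trans (coV_lin_app A l d₀)
    have dc := (k.1.wtIn R Γ).some
    have dB := Deriv.lapp _ _ _ _ _ _ (l.wtIn R Γ).some (.svar _ _)
    have hr := (EEq.lapp_cong q' .svar).trans (EEq.llam_svar (.lapp _ _ _ _ _ _ d₀ dB))
    refine k.precomp l (.lapp _ _ _ _ _ _ dc (.lapp _ _ _ _ _ _ d₀ (.svar _ _))) ?_ hr.wt.1.some
    simp only [Tm.ssubst, d₀.ssubst_eq rfl, dc.ssubst_eq rfl]
    exact .ap dc hr

theorem ApproxC.llam {A B₀ B : CType} (h : ApproxC R Γ (some A) (some A) B₀ B s₀ s) :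
    ApproxV R Γ (.lin A B₀) (.lin A B) s₀ s := by
  obtain ⟨l, -, ⟨ds⟩, ⟨d⟩, -, k⟩ := h
  have h := (coC_self R A (Γ := Γ)).ssubst (EEq.refl (.lapp _ _ _ _ _ _ ds (.svar _ _)))
  simp only [Tm.ssubst, ((LeC.refl A).wt R).some.ssubst_eq rfl] at h
  exact ⟨.lin A l, ⟨d⟩, (EEq.llam_eta ds).symm.trans
    ((EEq.llam_cong (h.symm.trans k)).trans (coV_lin_app A l d).symm)⟩

theorem ApproxV.eq_of_self {A A₀ : VType} {s' : Tm} (h : ApproxV R Γ A₀ A s₀ s)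
    (k : ApproxV R Γ A₀ A s₀ s') : EEq Γ none s s' (cpsV R A) :=
  h.2.2.trans k.2.2.symm

theorem ApproxV.prod {A₀ A B₀ B : VType} {r₀ r : Tm} (h : ApproxV R Γ A₀ A s₀ s)
    (k : ApproxV R Γ B₀ B r₀ r) :
    ApproxV R Γ (.prod A₀ B₀) (.prod A B) (.vpair s₀ r₀) (.vpair s r) := by
  obtain ⟨l, ⟨d⟩, q⟩ := h
  obtain ⟨m, ⟨e⟩, p⟩ := k
  refine ⟨l.prod m, ⟨.vpair _ _ _ _ _ d e⟩, EEq.trans ?_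
    (coV_prod_app l m (.vpair _ _ _ _ _ d e)).symm⟩
  exact .vpair_cong (q.trans (.vapp_cong (.refl (l.wtIn R Γ).some) (.symm (.vfst_beta d e))))
    (p.trans (.vapp_cong (.refl (m.wtIn R Γ).some) (.symm (.vsnd_beta d e))))

theorem ApproxV.vfst {A₀ A B₀ B : VType} (h : ApproxV R Γ (.prod A₀ B₀) (.prod A B) s₀ s) :
    ApproxV R Γ A₀ A (.vfst s₀) (.vfst s) := by
  obtain ⟨l, ⟨d⟩, q⟩ := h
  cases l with
  | prod l m =>
    simp only [cpsV] at d q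
    exact ⟨l, ⟨.vfst _ _ _ _ d⟩, (EEq.vfst_cong (q.trans (coV_prod_app l m d))).trans
      (.vfst_beta (.vapp _ _ _ _ _ (l.wtIn R Γ).some (.vfst _ _ _ _ d))
        (.vapp _ _ _ _ _ (m.wtIn R Γ).some (.vsnd _ _ _ _ d)))⟩

theorem ApproxV.vsnd {A₀ A B₀ B : VType} (h : ApproxV R Γ (.prod A₀ B₀) (.prod A B) s₀ s) :
    ApproxV R Γ B₀ B (.vsnd s₀) (.vsnd s) := by
  obtain ⟨l, ⟨d⟩, q⟩ := h
  cases l with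
  | prod l m =>
    simp only [cpsV] at d q
    exact ⟨m, ⟨.vsnd _ _ _ _ d⟩, (EEq.vsnd_cong (q.trans (coV_prod_app l m d))).trans
      (.vsnd_beta (.vapp _ _ _ _ _ (l.wtIn R Γ).some (.vfst _ _ _ _ d))
        (.vapp _ _ _ _ _ (m.wtIn R Γ).some (.vsnd _ _ _ _ d)))⟩

theorem ApproxV.vlam {A B₀ B : VType} (h : ApproxV R (cpsV R A :: Γ) B₀ B s₀ s) :
    ApproxV R Γ (.arr A B₀) (.arr A B) (.vlam (cpsV R A) s₀) (.vlam (cpsV R A) s) := by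
  obtain ⟨l, ⟨d⟩, q⟩ := h
  refine ⟨.arr A l, ⟨.vlam _ _ _ _ d⟩, EEq.trans (.vlam_cong (q.trans ?_))
    (coV_arr_app A l (.vlam _ _ _ _ d)).symm⟩
  have b := EEq.vlam_beta (d.rename ((Ren.succ Γ (cpsV R A)).lift _)) (.var0 _ _)
  rw [subst0_var0_rename_liftN_succ] at b
  exact .vapp_cong (.refl (l.wtIn R _).some) b.symm

theorem ApproxV.vapp {A B₀ B : VType} {x₀ x : Tm} (h : ApproxV R Γ (.arr A B₀) (.arr A B) s₀ s)
    (k : EEq Γ none x x₀ (cpsV R A)) : ApproxV R Γ B₀ B (.vapp s₀ x₀) (.vapp s x) := by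
  obtain ⟨l, ⟨d⟩, q⟩ := h
  cases l with
  | arr _ l =>
    simp only [cpsV] at d q
    refine ⟨l, ⟨.vapp _ _ _ _ _ d k.wt.2.some⟩,
      (EEq.vapp_cong (q.trans (coV_arr_app A l d)) k).trans ?_⟩
    have dl := (l.wt R).some
    have b := EEq.vlam_beta (.vapp _ _ _ _ _ (l.wtIn R _).some
      (.vapp _ _ _ _ _ (d.shift (cpsV R A)) (.var0 _ _))) k.wt.2.some
    have hs := Tm.subst0_shift s₀ x₀
    simp only [Tm.subst0_eq] at b hs
    simpa only [Tm.psubst, Tm.cons, dl.psubst_closed, hs] using b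

end Approx

/-! ### Coherence of the translation -/

theorem Tm.subst0_rename_liftN_psubst_liftS (v g : Tm) (σ : ℕ → Tm) :
    subst0 v (rename (liftN Nat.succ) (psubst (liftS σ) g)) =
      psubst (cons v (shift ∘ σ)) g := by
  rw [rename_psubst, rename_liftN_comp_liftS, subst0_psubst_liftS]
  rfl

theorem ApproxC.powlet {R : CType} {Γ : List VType} {Δ₀ Δ Λ₀ Λ : Option CType} {s₀ s u₀ g : Tm}
    {A₀ A : VType} {D₀ D : CType} (hA : LeV A₀ A) (hΛ : LeS Λ₀ Λ)
    (h : Sq Γ (.carr (cpsV R A) (stoupC R Λ)) (stoupC R Δ)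
      (.carr (cpsV R A₀) (stoupC R Λ₀)) (stoupC R Δ₀) (coS R Δ₀ Δ) s s₀
      (powCo (coV R A₀ A) (coS R Λ₀ Λ) (cpsV R A₀) (cpsV R A) (stoupC R Λ)))
    (k : ApproxC R (cpsV R A₀ :: Γ) Λ₀ Λ D₀ D u₀
      (Tm.subst0 (.vapp (coV R A₀ A) (.var 0)) (Tm.rename (Tm.liftN Nat.succ) g)))
    (dg : Deriv (cpsV R A :: Γ) none g (.lin (cpsC R D) (stoupC R Λ))) :
    ApproxC R Γ Δ₀ Δ D₀ D
      (.llam (cpsC R D₀) (.lapp s₀ (.clam (cpsV R A₀) (.lapp u₀ .svar))))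
      (.llam (cpsC R D) (.lapp s (.clam (cpsV R A) (.lapp g .svar)))) := by
  obtain ⟨l, -, -, ⟨d⟩, -, q⟩ := k
  have dX := Deriv.clam _ _ _ _ _ (.lapp _ _ _ _ _ _ dg (.svar _ _))
  refine ⟨l, h.precomp dX (.clam _ _ _ _ _ (.lapp _ _ _ _ _ _ d (.svar _ _)))
    (l.wtIn R Γ).some ((powCo_app (hA.wt R) (hΛ.wt R) dX).trans ?_)⟩
  have b := EEq.clam_beta
    ((Deriv.lapp _ _ _ _ _ _ dg (.svar _ _)).rename ((Ren.succ Γ (cpsV R A₀)).lift (cpsV R A)))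
    (.vapp _ _ _ _ _ (hA.wtIn R (cpsV R A₀ :: Γ)).some (.var0 _ _))
  simp only [Tm.ssubst, d.ssubst_eq rfl, Tm.shift, Tm.rename, (l.wt R).some.rename_closed]
  exact .clam_cong ((EEq.ap (hΛ.wtIn R _).some b).trans q)

/-- Translated derivations with a common approximation. -/
structure Rel (R : CType) (Γ : List VType) (Δ₀ Δ₁ Δ₂ : Option CType) (A₁ A₂ : VType)
    (s₁ s₂ : Tm) : Prop where
  val : Δ₁ = none → Δ₂ = none → RelV R Γ A₁ A₂ s₁ s₂
  comp : ∀ B₁ B₂, A₁ = .comp B₁ → A₂ = .comp B₂ → RelC R Γ Δ₀ Δ₁ Δ₂ B₁ B₂ s₁ s₂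

section

variable {R : CType} {Γ : List VType} {Δ₀ Δ₁ Δ₂ : Option CType} {s₁ s₂ : Tm}

theorem RelC.rel {B₁ B₂ : CType} (h : RelC R Γ Δ₀ Δ₁ Δ₂ B₁ B₂ s₁ s₂) (k : LeS Δ₀ Δ₁) :
    Rel R Γ Δ₀ Δ₁ Δ₂ (.comp B₁) (.comp B₂) s₁ s₂ := by
  refine ⟨?_, ?_⟩
  · rintro rfl rfl
    cases k
    obtain ⟨B₀, s₀, h₁, h₂⟩ := h
    exact ⟨_, _, h₁.toV, h₂.toV⟩
  · rintro _ _ ⟨⟩ ⟨⟩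
    exact h

theorem RelV.rel {A₁ A₂ : VType} (h : RelV R Γ A₁ A₂ s₁ s₂) (k : LeS Δ₀ none) :
    Rel R Γ Δ₀ none none A₁ A₂ s₁ s₂ := by
  refine ⟨fun _ _ => h, ?_⟩
  rintro B₁ B₂ rfl rfl
  cases k
  obtain ⟨A₀, s₀, h₁, h₂⟩ := h
  have l := h₁.1
  cases l
  exact ⟨_, _, h₁.toC, h₂.toC⟩

theorem RelC.of_czero {B₁ B₂ C₁ C₂ : CType} {X₁ X₂ s₀ : Tm}
    (h₁ : ApproxC R Γ Δ₀ Δ₁ .czero C₁ s₀ s₁) (h₂ : ApproxC R Γ Δ₀ Δ₂ .czero C₂ s₀ s₂)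
    (d₁ : Nonempty (Deriv Γ (some (cpsC R B₁)) X₁ (.comp (cpsC R C₁))))
    (d₂ : Nonempty (Deriv Γ (some (cpsC R B₂)) X₂ (.comp (cpsC R C₂)))) :
    RelC R Γ Δ₀ Δ₁ Δ₂ B₁ B₂ (.llam (cpsC R B₁) (.lapp s₁ X₁)) (.llam (cpsC R B₂) (.lapp s₂ X₂)) :=
  ⟨_, _, h₁.bot d₁.some, h₂.bot d₂.some⟩

theorem RelV.eq {A : VType} (h : RelV R Γ A A s₁ s₂) : EEq Γ none s₁ s₂ (cpsV R A) := by
  obtain ⟨A₀, s₀, h₁, h₂⟩ := h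
  exact h₁.eq_of_self h₂

theorem RelV.refl {A : VType} {s : Tm} (d : Deriv Γ none s (cpsV R A)) : RelV R Γ A A s s :=
  have h : ApproxV R Γ A A s s := ⟨LeV.refl A, ⟨d⟩, (coV_self R A d).symm⟩
  ⟨A, s, h, h⟩

theorem RelV.shift {A₁ A₂ : VType} (h : RelV R Γ A₁ A₂ s₁ s₂) (C : VType) :
    RelV R (C :: Γ) A₁ A₂ (Tm.shift s₁) (Tm.shift s₂) := by
  obtain ⟨A₀, s₀, h₁, h₂⟩ := h
  exact ⟨_, _, h₁.shift C, h₂.shift C⟩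

/-- Substitutions with pointwise common approximations. -/
def CtxRel (R : CType) (Γ Γ₁ Γ₂ : List VType) (σ₁ σ₂ : ℕ → Tm) : Prop :=
  ∀ n A₁ A₂, Γ₁[n]? = some A₁ → Γ₂[n]? = some A₂ → RelV R Γ A₁ A₂ (σ₁ n) (σ₂ n)

theorem CtxRel.cons {Γ₁ Γ₂ : List VType} {σ₁ σ₂ : ℕ → Tm} (h : CtxRel R Γ Γ₁ Γ₂ σ₁ σ₂)
    {A₁ A₂ : VType} (k : RelV R Γ A₁ A₂ s₁ s₂) :
    CtxRel R Γ (A₁ :: Γ₁) (A₂ :: Γ₂) (Tm.cons s₁ σ₁) (Tm.cons s₂ σ₂)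
  | 0, _, _, e₁, e₂ => by
    simp only [List.getElem?_cons_zero, Option.some.injEq] at e₁ e₂
    subst e₁ e₂
    exact k
  | n + 1, A₁, A₂, e₁, e₂ => h n A₁ A₂ (by simpa using e₁) (by simpa using e₂)

theorem CtxRel.shift {Γ₁ Γ₂ : List VType} {σ₁ σ₂ : ℕ → Tm} (h : CtxRel R Γ Γ₁ Γ₂ σ₁ σ₂)
    (C : VType) : CtxRel R (C :: Γ) Γ₁ Γ₂ (Tm.shift ∘ σ₁) (Tm.shift ∘ σ₂) :=
  fun n _ _ e₁ e₂ => (h n _ _ e₁ e₂).shift C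

theorem Tm.liftS_eq_cons (σ : ℕ → Tm) : liftS σ = cons (.var 0) (shift ∘ σ) := by
  funext n
  cases n <;> rfl

theorem CtxRel.lift {Γ₁ Γ₂ : List VType} {σ₁ σ₂ : ℕ → Tm} (h : CtxRel R Γ Γ₁ Γ₂ σ₁ σ₂)
    (A : VType) :
    CtxRel R (cpsV R A :: Γ) (A :: Γ₁) (A :: Γ₂) (Tm.liftS σ₁) (Tm.liftS σ₂) := by
  rw [Tm.liftS_eq_cons, Tm.liftS_eq_cons]
  exact (h.shift _).cons (.refl (.var0 _ _))

/-- Shifting the values of a substitution. -/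
def Sub.shift {σ : ℕ → Tm} {Γ Γ' : List VType} (h : Sub σ Γ Γ') (A : VType) :
    Sub (Tm.shift ∘ σ) Γ (A :: Γ') :=
  fun n B e => (h n B e).shift A

variable {Γ' : List VType} {σ : ℕ → Tm} {t : Tm}

theorem closedCps_psubst_val {A : VType} (d : Deriv Γ none t A) (h : Sub σ (cpsCtx R Γ) Γ') :
    Nonempty (Deriv Γ' none (Tm.psubst σ (closedCps R d)) (cpsV R A)) := by
  have := closedCps_wt R d
  rw [closedType_none] at this
  exact ⟨this.some.psubst h⟩

theorem closedCps_psubst_comp {Δ : Option CType} {B : CType} (d : Deriv Γ Δ t (.comp B))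
    (h : Sub σ (cpsCtx R Γ) Γ') :
    Nonempty (Deriv Γ' none (Tm.psubst σ (closedCps R d)) (.lin (cpsC R B) (stoupC R Δ))) := by
  have := closedCps_wt R d
  rw [closedType_comp] at this
  exact ⟨this.some.psubst h⟩

/-- Two variables of the approximated types, coerced from a common variable. -/
theorem RelV.coerced_var {A₀ A₁ A₂ : VType} (h₁ : LeV A₀ A₁) (h₂ : LeV A₀ A₂) :
    RelV R (cpsV R A₀ :: Γ) A₁ A₂ (.vapp (coV R A₀ A₁) (.var 0)) (.vapp (coV R A₀ A₂) (.var 0)) :=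
  ⟨A₀, .var 0,
    ⟨h₁, ⟨.var0 _ _⟩, .refl (.vapp _ _ _ _ _ (h₁.wtIn R _).some (.var0 _ _))⟩,
    ⟨h₂, ⟨.var0 _ _⟩, .refl (.vapp _ _ _ _ _ (h₂.wtIn R _).some (.var0 _ _))⟩⟩

end

theorem ApproxC.svar {R : CType} {Γ : List VType} {A₀ A : CType} (l : LeC A₀ A) :
    ApproxC R Γ (some A₀) (some A) A₀ A (.llam (cpsC R A₀) .svar) (.llam (cpsC R A) .svar) :=
  ⟨l, l.wtIn R Γ, llam_svar_wt _ _, llam_svar_wt _ _, l.wtIn R Γ,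
    (EEq.ap (l.wtIn R Γ).some (EEq.llam_id (.svar _ _))).trans
      (EEq.llam_id (.lapp _ _ _ _ _ _ (l.wtIn R Γ).some (.svar _ _))).symm⟩

theorem ApproxC.cunit {R : CType} {Γ : List VType} {Δ₀ Δ : Option CType} (l : LeS Δ₀ Δ) :
    ApproxC R Γ Δ₀ Δ .cunit .cunit (.llam .czero (.cimage (stoupC R Δ₀) .svar))
      (.llam .czero (.cimage (stoupC R Δ) .svar)) :=
  ⟨.cunit, Sq.czero (l.wtIn R _).some (.llam _ _ _ _ (.cimage _ _ _ _ (.svar _ _)))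
    (.llam _ _ _ _ (.cimage _ _ _ _ (.svar _ _))) (LeC.cunit.wtIn R _).some⟩

/-- Translations of two derivations of a term have a common approximation. -/
theorem Deriv.closedCps_rel (R : CType) {Γ₁ : List VType} {Δ₁ : Option CType} {t : Tm}
    {A₁ : VType} (D₁ : Deriv Γ₁ Δ₁ t A₁) :
    ∀ {Γ₂ : List VType} {Δ₂ : Option CType} {A₂ : VType} (D₂ : Deriv Γ₂ Δ₂ t A₂)
      {Δ₀ : Option CType} (_ : LeS Δ₀ Δ₁) (_ : LeS Δ₀ Δ₂) {Γ : List VType} {σ₁ σ₂ : ℕ → Tm}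
      (_ : Sub σ₁ (cpsCtx R Γ₁) Γ) (_ : Sub σ₂ (cpsCtx R Γ₂) Γ)
      (_ : CtxRel R Γ Γ₁ Γ₂ σ₁ σ₂),
      Rel R Γ Δ₀ Δ₁ Δ₂ A₁ A₂ (Tm.psubst σ₁ (closedCps R D₁)) (Tm.psubst σ₂ (closedCps R D₂)) := by
  induction D₁ with
  | var _ n A e =>
    intro _ _ _ D₂ _ l₁ l₂ _ _ _ k₁ k₂ h
    cases D₂ with
    | var _ _ _ e₂ => exact RelV.rel (h _ _ _ e e₂) l₁
  | svar _ A =>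
    intro _ _ _ D₂ _ l₁ l₂ _ _ _ k₁ k₂ h
    cases D₂ with
    | svar _ A₂ =>
      refine RelC.rel ?_ l₁
      cases l₁ with
      | stoup l₁ =>
      cases l₂ with
      | stoup l₂ =>
      simp only [closedCps, Tm.psubst]
      exact ⟨_, _, .svar l₁, .svar l₂⟩
  | unit =>
    intro _ _ _ D₂ _ l₁ l₂ _ _ _ k₁ k₂ h
    cases D₂
    exact RelV.rel (.refl (.unit _)) l₁
  | vpair _ _ _ _ _ _ _ i j =>
    intro _ _ _ D₂ _ l₁ l₂ _ _ _ k₁ k₂ h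
    cases D₂ with
    | vpair _ _ _ _ _ d₁ d₂ =>
      refine RelV.rel ?_ l₁
      obtain ⟨_, _, a₁, a₂⟩ := (i d₁ .empty .empty k₁ k₂ h).val rfl rfl
      obtain ⟨_, _, b₁, b₂⟩ := (j d₂ .empty .empty k₁ k₂ h).val rfl rfl
      exact ⟨_, _, a₁.prod b₁, a₂.prod b₂⟩
  | vfst _ _ _ _ _ i =>
    intro _ _ _ D₂ _ l₁ l₂ _ _ _ k₁ k₂ h
    cases D₂ with
    | vfst _ _ _ _ d₁ =>
      refine RelV.rel ?_ l₁
      obtain ⟨_, _, a₁, a₂⟩ := (i d₁ .empty .empty k₁ k₂ h).val rfl rfl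
      have m₁ := a₁.1
      cases m₁
      exact ⟨_, _, a₁.vfst, a₂.vfst⟩
  | vsnd _ _ _ _ _ i =>
    intro _ _ _ D₂ _ l₁ l₂ _ _ _ k₁ k₂ h
    cases D₂ with
    | vsnd _ _ _ _ d₁ =>
      refine RelV.rel ?_ l₁
      obtain ⟨_, _, a₁, a₂⟩ := (i d₁ .empty .empty k₁ k₂ h).val rfl rfl
      have m₁ := a₁.1
      cases m₁
      exact ⟨_, _, a₁.vsnd, a₂.vsnd⟩
  | vlam _ _ A _ _ i =>
    intro _ _ _ D₂ _ l₁ l₂ _ _ _ k₁ k₂ h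
    cases D₂ with
    | vlam _ _ _ _ d₁ =>
      refine RelV.rel ?_ l₁
      obtain ⟨_, _, a₁, a₂⟩ :=
        (i d₁ .empty .empty (k₁.lift (cpsV R A)) (k₂.lift (cpsV R A)) (h.lift A)).val rfl rfl
      exact ⟨_, _, a₁.vlam, a₂.vlam⟩
  | vapp _ _ _ _ _ _ _ i j =>
    intro _ _ _ D₂ _ l₁ l₂ _ _ _ k₁ k₂ h
    cases D₂ with
    | vapp _ _ _ _ _ d₁ d₂ =>
      refine RelV.rel ?_ l₁
      obtain ⟨_, _, a₁, a₂⟩ := (i d₁ .empty .empty k₁ k₂ h).val rfl rfl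
      have b := (j d₂ .empty .empty k₁ k₂ h).val rfl rfl
      have m₁ := a₁.1
      have m₂ := a₂.1
      cases m₁ with
      | arr _ m₁ =>
      cases m₂ with
      | arr _ m₂ =>
      exact ⟨_, _, a₁.vapp b.eq, a₂.vapp (.refl b.eq.wt.2.some)⟩
  | cunit _ Δ =>
    intro _ _ _ D₂ _ l₁ l₂ _ _ _ k₁ k₂ h
    cases D₂ with
    | cunit _ Δ₂ =>
      refine RelC.rel ?_ l₁
      simp only [closedCps, Tm.psubst]
      exact ⟨_, _, .cunit l₁, .cunit l₂⟩
  | cpair _ _ _ _ _ _ _ _ i j =>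
    intro _ _ _ D₂ _ l₁ l₂ _ _ _ k₁ k₂ h
    cases D₂ with
    | cpair _ _ _ _ _ _ d₁ d₂ =>
      refine RelC.rel ?_ l₁
      obtain ⟨_, _, a₁, a₂⟩ := (i d₁ l₁ l₂ k₁ k₂ h).comp _ _ rfl rfl
      obtain ⟨_, _, b₁, b₂⟩ := (j d₂ l₁ l₂ k₁ k₂ h).comp _ _ rfl rfl
      exact ⟨_, _, a₁.cpair b₁, a₂.cpair b₂⟩
  | cfst _ _ _ _ _ _ i =>
    intro _ _ _ D₂ _ l₁ l₂ _ _ _ k₁ k₂ h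
    cases D₂ with
    | cfst _ _ _ _ _ d₁ =>
      refine RelC.rel ?_ l₁
      obtain ⟨_, _, a₁, a₂⟩ := (i d₁ l₁ l₂ k₁ k₂ h).comp _ _ rfl rfl
      have m₁ := a₁.1
      cases m₁ with
      | czero =>
        exact RelC.of_czero a₁ a₂ ⟨.cinl _ _ _ _ _ (.svar _ _)⟩ ⟨.cinl _ _ _ _ _ (.svar _ _)⟩
      | cand => exact ⟨_, _, a₁.cfst, a₂.cfst⟩
  | csnd _ _ _ _ _ _ i =>
    intro _ _ _ D₂ _ l₁ l₂ _ _ _ k₁ k₂ h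
    cases D₂ with
    | csnd _ _ _ _ _ d₁ =>
      refine RelC.rel ?_ l₁
      obtain ⟨_, _, a₁, a₂⟩ := (i d₁ l₁ l₂ k₁ k₂ h).comp _ _ rfl rfl
      have m₁ := a₁.1
      cases m₁ with
      | czero =>
        exact RelC.of_czero a₁ a₂ ⟨.cinr _ _ _ _ _ (.svar _ _)⟩ ⟨.cinr _ _ _ _ _ (.svar _ _)⟩
      | cand => exact ⟨_, _, a₁.csnd, a₂.csnd⟩
  | clam _ _ _ A _ _ i =>
    intro _ _ _ D₂ _ l₁ l₂ _ _ _ k₁ k₂ h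
    cases D₂ with
    | clam _ _ _ _ _ d₁ =>
      refine RelC.rel ?_ l₁
      obtain ⟨_, _, a₁, a₂⟩ :=
        (i d₁ l₁ l₂ (k₁.lift (cpsV R A)) (k₂.lift (cpsV R A)) (h.lift A)).comp _ _ rfl rfl
      exact ⟨_, _, a₁.clam l₁, a₂.clam l₂⟩
  | capp _ _ _ _ _ _ _ e₂ i j =>
    intro _ _ _ D₂ _ l₁ l₂ _ _ _ k₁ k₂ h
    cases D₂ with
    | capp _ _ _ _ _ _ d₁ d₂ =>
      refine RelC.rel ?_ l₁
      obtain ⟨_, _, a₁, a₂⟩ := (i d₁ l₁ l₂ k₁ k₂ h).comp _ _ rfl rfl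
      have b := (j d₂ .empty .empty k₁ k₂ h).val rfl rfl
      have m₁ := a₁.1
      have m₂ := a₂.1
      cases m₁ with
      | czero =>
        exact RelC.of_czero a₁ a₂
          ⟨.copow _ _ _ _ _ _ (closedCps_psubst_val e₂ k₁).some (.svar _ _)⟩
          ⟨.copow _ _ _ _ _ _ (closedCps_psubst_val d₂ k₂).some (.svar _ _)⟩
      | carr _ m₁ =>
      cases m₂ with
      | carr _ m₂ =>
      exact ⟨_, _, a₁.capp b.eq, a₂.capp (.refl b.eq.wt.2.some)⟩
  | top =>
    intro _ _ _ D₂ _ l₁ l₂ _ _ _ k₁ k₂ h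
    cases D₂
    refine RelV.rel (.refl ?_) l₁
    simp only [closedCps, Tm.psubst, cpsV, cpsC]
    exact (llam_svar_wt _ _).some
  | ilet _ _ _ _ _ _ e₂ i j =>
    intro _ _ _ D₂ _ l₁ l₂ _ _ _ k₁ k₂ h
    cases D₂ with
    | ilet _ _ _ _ _ d₁ d₂ =>
      refine RelC.rel ?_ l₁
      obtain ⟨_, _, a₁, a₂⟩ := (i d₁ l₁ l₂ k₁ k₂ h).comp _ _ rfl rfl
      obtain ⟨_, _, b₁, b₂⟩ := (j d₂ .empty .empty k₁ k₂ h).comp _ _ rfl rfl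
      have m₁ := a₁.1
      cases m₁ with
      | czero =>
        exact RelC.of_czero a₁ a₂
          ⟨.lapp _ _ _ _ _ _ (closedCps_psubst_comp e₂ k₁).some (.svar _ _)⟩
          ⟨.lapp _ _ _ _ _ _ (closedCps_psubst_comp d₂ k₂).some (.svar _ _)⟩
      | iunit => exact ⟨_, _, a₁.ilet b₁, a₂.ilet b₂⟩
  | bang _ _ _ _ i =>
    intro _ _ _ D₂ _ l₁ l₂ _ _ _ k₁ k₂ h
    cases D₂ with
    | bang _ _ _ d₁ =>
      cases l₁
      refine RelC.rel ?_ .empty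
      obtain ⟨_, _, a₁, a₂⟩ := (i d₁ .empty .empty k₁ k₂ h).val rfl rfl
      exact ⟨_, _, a₁.bang, a₂.bang⟩
  | banglet _ _ _ _ A _ _ e₂ i j =>
    intro _ _ _ D₂ _ l₁ l₂ _ _ _ k₁ k₂ h
    cases D₂ with
    | banglet _ _ _ _ A' _ d₁ d₂ =>
      refine RelC.rel ?_ l₁
      obtain ⟨_, _, a₁, a₂⟩ := (i d₁ l₁ l₂ k₁ k₂ h).comp _ _ rfl rfl
      have w₁ := (closedCps_psubst_comp e₂ (k₁.lift (cpsV R A))).some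
      have w₂ := (closedCps_psubst_comp d₂ (k₂.lift (cpsV R A'))).some
      have m₁ := a₁.1
      have m₂ := a₂.1
      cases m₁ with
      | czero =>
        exact RelC.of_czero a₁ a₂
          ⟨.clam _ _ _ _ _ (.lapp _ _ _ _ _ _ w₁ (.svar _ _))⟩
          ⟨.clam _ _ _ _ _ (.lapp _ _ _ _ _ _ w₂ (.svar _ _))⟩
      | bang m₁ =>
      cases m₂ with
      | bang m₂ =>
      obtain ⟨_, _, b₁, b₂⟩ := (j d₂ .empty .empty
        ((k₁.shift _).cons (.vapp _ _ _ _ _ (m₁.wtIn R _).some (.var0 _ _)))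
        ((k₂.shift _).cons (.vapp _ _ _ _ _ (m₂.wtIn R _).some (.var0 _ _)))
        ((h.shift _).cons (.coerced_var m₁ m₂))).comp _ _ rfl rfl
      rw [← Tm.subst0_rename_liftN_psubst_liftS] at b₁ b₂
      exact ⟨_, _, ApproxC.powlet m₁ .empty a₁.2 b₁ w₁, ApproxC.powlet m₂ .empty a₂.2 b₂ w₂⟩
  | copow _ _ _ _ _ _ _ _ i j =>
    intro _ _ _ D₂ _ l₁ l₂ _ _ _ k₁ k₂ h
    cases D₂ with
    | copow _ _ _ _ _ _ d₁ d₂ =>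
      refine RelC.rel ?_ l₁
      obtain ⟨_, _, a₁, a₂⟩ := (i d₁ .empty .empty k₁ k₂ h).val rfl rfl
      obtain ⟨_, _, b₁, b₂⟩ := (j d₂ l₁ l₂ k₁ k₂ h).comp _ _ rfl rfl
      exact ⟨_, _, .copow a₁ b₁, .copow a₂ b₂⟩
  | copowlet _ _ _ _ A _ _ _ e₂ i j =>
    intro _ _ _ D₂ _ l₁ l₂ _ _ _ k₁ k₂ h
    cases D₂ with
    | copowlet _ _ _ _ A' _ _ d₁ d₂ =>
      refine RelC.rel ?_ l₁
      obtain ⟨_, _, a₁, a₂⟩ := (i d₁ l₁ l₂ k₁ k₂ h).comp _ _ rfl rfl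
      have w₁ := (closedCps_psubst_comp e₂ (k₁.lift (cpsV R A))).some
      have w₂ := (closedCps_psubst_comp d₂ (k₂.lift (cpsV R A'))).some
      have m₁ := a₁.1
      have m₂ := a₂.1
      cases m₁ with
      | czero =>
        exact RelC.of_czero a₁ a₂
          ⟨.clam _ _ _ _ _ (.lapp _ _ _ _ _ _ w₁ (.svar _ _))⟩
          ⟨.clam _ _ _ _ _ (.lapp _ _ _ _ _ _ w₂ (.svar _ _))⟩
      | copow m₁ n₁ =>
      cases m₂ with
      | copow m₂ n₂ =>
      obtain ⟨_, _, b₁, b₂⟩ := (j d₂ (.stoup n₁) (.stoup n₂)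
        ((k₁.shift _).cons (.vapp _ _ _ _ _ (m₁.wtIn R _).some (.var0 _ _)))
        ((k₂.shift _).cons (.vapp _ _ _ _ _ (m₂.wtIn R _).some (.var0 _ _)))
        ((h.shift _).cons (.coerced_var m₁ m₂))).comp _ _ rfl rfl
      rw [← Tm.subst0_rename_liftN_psubst_liftS] at b₁ b₂
      exact ⟨_, _, ApproxC.powlet m₁ (.stoup n₁) a₁.2 b₁ w₁,
        ApproxC.powlet m₂ (.stoup n₂) a₂.2 b₂ w₂⟩
  | cimage _ _ _ _ _ i =>
    intro _ _ _ D₂ _ l₁ l₂ _ _ _ k₁ k₂ h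
    cases D₂ with
    | cimage _ _ _ _ d₁ =>
      refine RelC.rel ?_ l₁
      obtain ⟨_, _, a₁, a₂⟩ := (i d₁ l₁ l₂ k₁ k₂ h).comp _ _ rfl rfl
      have m₁ := a₁.1
      cases m₁
      exact RelC.of_czero a₁ a₂ ⟨.cunit _ _⟩ ⟨.cunit _ _⟩
  | cinl _ _ _ _ _ _ i =>
    intro _ _ _ D₂ _ l₁ l₂ _ _ _ k₁ k₂ h
    cases D₂ with
    | cinl _ _ _ _ _ d₁ =>
      refine RelC.rel ?_ l₁
      obtain ⟨_, _, a₁, a₂⟩ := (i d₁ l₁ l₂ k₁ k₂ h).comp _ _ rfl rfl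
      exact ⟨_, _, a₁.cinl (.czero _), a₂.cinl (.czero _)⟩
  | cinr _ _ _ _ _ _ i =>
    intro _ _ _ D₂ _ l₁ l₂ _ _ _ k₁ k₂ h
    cases D₂ with
    | cinr _ _ _ _ _ d₁ =>
      refine RelC.rel ?_ l₁
      obtain ⟨_, _, a₁, a₂⟩ := (i d₁ l₁ l₂ k₁ k₂ h).comp _ _ rfl rfl
      exact ⟨_, _, .cinr (.czero _) a₁, .cinr (.czero _) a₂⟩
  | ccase _ _ _ _ _ _ _ _ _ e₂ e₃ i j k =>
    intro _ _ _ D₂ _ l₁ l₂ _ _ _ k₁ k₂ h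
    cases D₂ with
    | ccase _ _ _ _ _ _ _ _ d₁ d₂ d₃ =>
      refine RelC.rel ?_ l₁
      obtain ⟨_, _, a₁, a₂⟩ := (i d₁ l₁ l₂ k₁ k₂ h).comp _ _ rfl rfl
      have m₁ := a₁.1
      have m₂ := a₂.1
      cases m₁ with
      | czero =>
        exact RelC.of_czero a₁ a₂
          ⟨.cpair _ _ _ _ _ _
            (.lapp _ _ _ _ _ _ (closedCps_psubst_comp e₂ k₁).some (.svar _ _))
            (.lapp _ _ _ _ _ _ (closedCps_psubst_comp e₃ k₁).some (.svar _ _))⟩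
          ⟨.cpair _ _ _ _ _ _
            (.lapp _ _ _ _ _ _ (closedCps_psubst_comp d₂ k₂).some (.svar _ _))
            (.lapp _ _ _ _ _ _ (closedCps_psubst_comp d₃ k₂).some (.svar _ _))⟩
      | csum m₁ n₁ =>
      cases m₂ with
      | csum m₂ n₂ =>
      obtain ⟨_, _, b₁, b₂⟩ := (j d₂ (.stoup m₁) (.stoup m₂) k₁ k₂ h).comp _ _ rfl rfl
      obtain ⟨_, _, c₁, c₂⟩ := (k d₃ (.stoup n₁) (.stoup n₂) k₁ k₂ h).comp _ _ rfl rfl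
      obtain ⟨C, p, q, r₁, r₂⟩ := LeC.directed b₁.1 b₂.1 c₁.1 c₂.1
      exact ⟨_, _, a₁.ccase (b₁.raise p r₁) (c₁.raise q r₁),
        a₂.ccase (b₂.raise p r₂) (c₂.raise q r₂)⟩
  | llam _ _ A _ _ i =>
    intro _ _ _ D₂ _ l₁ l₂ _ _ _ k₁ k₂ h
    cases D₂ with
    | llam _ _ _ _ d₁ =>
      refine RelV.rel ?_ l₁
      obtain ⟨_, _, a₁, a₂⟩ :=
        (i d₁ (.stoup (.refl A)) (.stoup (.refl A)) k₁ k₂ h).comp _ _ rfl rfl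
      exact ⟨_, _, a₁.llam, a₂.llam⟩
  | lapp _ _ _ _ _ _ _ _ i j =>
    intro _ _ _ D₂ _ l₁ l₂ _ _ _ k₁ k₂ h
    cases D₂ with
    | lapp _ _ _ _ _ _ d₁ d₂ =>
      refine RelC.rel ?_ l₁
      obtain ⟨_, _, a₁, a₂⟩ := (i d₁ .empty .empty k₁ k₂ h).val rfl rfl
      obtain ⟨_, _, b₁, b₂⟩ := (j d₂ l₁ l₂ k₁ k₂ h).comp _ _ rfl rfl
      have m₁ := a₁.1
      have m₂ := a₂.1
      cases m₁ with
      | lin _ m₁ =>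
      cases m₂ with
      | lin _ m₂ =>
      exact ⟨_, _, .lapp a₁ b₁, .lapp a₂ b₂⟩

/-- The translation of a term with an empty stoup does not depend on its derivation. -/
theorem closedCps_coherent (R : CType) {Γ : List VType} {t : Tm} {A : VType}
    (d d' : Deriv Γ none t A) :
    EEq (cpsCtx R Γ) none (closedCps R d) (closedCps R d') (cpsV R A) := by
  have h : CtxRel R (cpsCtx R Γ) Γ Γ .var .var := by
    intro n A₁ A₂ e₁ e₂
    obtain rfl : A₁ = A₂ := Option.some.inj (e₁.symm.trans e₂)
    exact .refl (.var _ _ _ (by simp [cpsCtx_getElem?, e₁]))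
  have := ((d.closedCps_rel R d' .empty .empty (.id _) (.id _) h).val rfl rfl).eq
  rwa [Tm.psubst_var, Tm.psubst_var] at this

/-- **Substitution property of the self-translation, stoup-free computation
term into stoup** (Proposition 5.1(3)): if `Γ | x:A̲ ⊢ t : B̲` and
`Γ ⊢ u : A̲`, then
`Γᶜ ⊢ (t[u/x])ᶜ = λ°k:B̲ᶜ. uᶜ[tᶜ[k/k_x]] : B̲ᶜ ⊸ R̲` in the equational
theory of EEC (in the nameless representation the renaming `[k/k_x]` is the
identity, and `uᶜ[s]` is the linear application `lapp uᶜ s`). -/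
theorem cps_subst_stoup_value (R : CType) (Γ : List VType) (t u : Tm) (A B : CType)
    (dt : Deriv Γ (some A) t (.comp B)) (du : Deriv Γ none u (.comp A))
    (dtu : Deriv Γ none (Tm.ssubst u t) (.comp B)) :
    EEq (cpsCtx R Γ) none (cps R dtu)
      (.llam (cpsC R B) (.lapp (cps R du) (cps R dt))) (.lin (cpsC R B) R) := by
  obtain ⟨dtu', ⟨⟨wu⟩, ⟨wt⟩, ⟨wtu⟩, -, k⟩⟩ := closedCps_ssubst R dt rfl rfl du
  have e := cps_eq_closedCps R dtu
  have eu := cps_eq_closedCps R du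
  have et := cps_eq_closedCps R dt
  have c := closedCps_coherent R dtu dtu'
  simp only [closeTm_none, closedType_none, cpsV] at e eu c
  refine e.trans (c.trans ((EEq.llam_eta wtu).symm.trans (.llam_cong ?_)))
  exact (EEq.ap wtu (EEq.llam_id (.svar _ _))).symm.trans
    (k.symm.trans (.lapp_cong eu.symm (EEq.body et).symm))

end EEC
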